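/- Let ℓ ≥ 2 be an integer, c, c₁ ∈ (0,1), δ > 0, K ≥ 1, and let Λ ⊆ (1,2] be compact; set θ(c,c₁) = min{c + c₁, 1/2 − 2c₁}. There exist C > 0 and ε₀ > 0 such that for every ε ∈ (0,ε₀), every λ ∈ Λ, and every interval I ⊆ [0,1] with K⁻¹·ε^c ≤ |I| ≤ K·ε^c, one has |G^{(2)}_{ℓ,I,ε}(λ) − (c_I·C(ℓ)/ℓ)·∫₀¹ ((1−u)/u)·ln(λ/(λ−u)) du| ≤ C·ε^{θ(c,c₁)−δ}, and the identical estimate holds with G^{(3)}_{ℓ,I,ε} in place of G^{(2)}_{ℓ,I,ε}. -/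

import Mathlib

open MeasureTheory Real Set Filter
open scoped ENNReal Pointwise

noncomputable def Cconst (l : ℕ) : ℝ :=
  ((Nat.totient l : ℝ) / l) * ∏' p : {p : ℕ // p.Prime ∧ ¬ p ∣ l}, (1 - 1 / (p.1 : ℝ) ^ 2)

def Zl (l : ℕ) : Set (ℝ × ℝ) :=
  {p | ∃ m n : ℤ, p = ((m : ℝ), (n : ℝ)) ∧ ¬ ((l : ℤ) ∣ (m - n))}

def Vseg (ε : ℝ) : Set (ℝ × ℝ) := {(0 : ℝ)} ×ˢ Set.Icc (-ε) ε

noncomputable def qfree (l : ℕ) (ε ω : ℝ) : ℝ≥0∞ :=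
  ⨅ q : {q : ℝ // 0 < q ∧ (q, q * Real.tan ω) ∈ Zl l + Vseg ε}, ENNReal.ofReal q.1

def FareyQ (Q : ℕ) : Set ℚ := {x | 0 < x ∧ x ≤ 1 ∧ x.den ≤ Q}

def FareyCong (l : ℕ) : Set ℚ := {x | 0 < x ∧ x ≤ 1 ∧ (l : ℤ) ∣ ((x.den : ℤ) - x.num)}

def ConsecFarey (Q : ℕ) (γ γ' : ℚ) : Prop :=
  γ ∈ FareyQ Q ∧ γ' ∈ FareyQ Q ∧ γ < γ' ∧ ∀ z ∈ FareyQ Q, ¬ (γ < z ∧ z < γ')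

/-- `G^{(2)}_{ℓ,I,ε}(λ)`: the measure of the set of `ω ∈ arctan I` with `q_{ℓ,ε}(ω) > λQ`
(`Q = ⌊1/ε⌋`) and `γ < tan ω < γ'` for some consecutive `γ, γ'` in `F_Q` with
`γ, γ' ∈ I` and `γ ∈ F^{(ℓ)}`. -/
noncomputable def Gmeas2 (l : ℕ) (I : Set ℝ) (ε lam : ℝ) : ℝ :=
  (volume {ω ∈ Real.arctan '' I |
    ENNReal.ofReal (lam * (⌊1 / ε⌋₊ : ℝ)) < qfree l ε ω ∧
    ∃ γ γ' : ℚ, ConsecFarey ⌊1 / ε⌋₊ γ γ' ∧ (γ : ℝ) ∈ I ∧ (γ' : ℝ) ∈ I ∧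
      γ ∈ FareyCong l ∧ (γ : ℝ) < Real.tan ω ∧ Real.tan ω < (γ' : ℝ)}).toReal

/-- `G^{(3)}_{ℓ,I,ε}(λ)`: same as `G^{(2)}_{ℓ,I,ε}(λ)` but with the condition
`γ' ∈ F^{(ℓ)}` instead of `γ ∈ F^{(ℓ)}`. -/
noncomputable def Gmeas3 (l : ℕ) (I : Set ℝ) (ε lam : ℝ) : ℝ :=
  (volume {ω ∈ Real.arctan '' I |
    ENNReal.ofReal (lam * (⌊1 / ε⌋₊ : ℝ)) < qfree l ε ω ∧
    ∃ γ γ' : ℚ, ConsecFarey ⌊1 / ε⌋₊ γ γ' ∧ (γ : ℝ) ∈ I ∧ (γ' : ℝ) ∈ I ∧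
      γ' ∈ FareyCong l ∧ (γ : ℝ) < Real.tan ω ∧ Real.tan ω < (γ' : ℝ)}).toReal

theorem card_divisors_le_rpow {δ : ℝ} (hδ : 0 < δ) :
    ∃ C : ℝ, 1 ≤ C ∧ ∀ n : ℕ, n ≠ 0 → (n.divisors.card : ℝ) ≤ C * (n : ℝ) ^ δ := by
  have hlog : 0 < Real.log 2 := Real.log_pos (by norm_num)
  set B : ℝ := max 1 (1 / (δ * Real.log 2)) with hB
  have hB1 : 1 ≤ B := le_max_left _ _
  obtain ⟨P, hP⟩ := exists_nat_ge ((2 : ℝ) ^ (1 / δ))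
  refine ⟨B ^ P, one_le_pow₀ hB1, fun n hn => ?_⟩
  have key : ∀ p ∈ n.primeFactors, ((n.factorization p + 1 : ℕ) : ℝ) ≤
      (if p < P then B else 1) * ((p : ℝ) ^ n.factorization p) ^ δ := by
    intro p hp
    have hp2 : 2 ≤ p := (Nat.prime_of_mem_primeFactors hp).two_le
    have hp2' : (2 : ℝ) ≤ p := by exact_mod_cast hp2
    set k := n.factorization p
    have e : ((p : ℝ) ^ k) ^ δ = ((p : ℝ) ^ δ) ^ k := by
      rw [← Real.rpow_natCast, ← Real.rpow_natCast, ← Real.rpow_mul (by positivity),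
        ← Real.rpow_mul (by positivity), mul_comm]
    rw [e]
    split_ifs with h
    · have h1 : (2 : ℝ) ^ δ ≤ (p : ℝ) ^ δ := Real.rpow_le_rpow (by norm_num) hp2' hδ.le
      have h2 : ((2 : ℝ) ^ δ) ^ k ≤ ((p : ℝ) ^ δ) ^ k := pow_le_pow_left₀ (by positivity) h1 k
      have h3 : 1 + k * (δ * Real.log 2) ≤ ((2 : ℝ) ^ δ) ^ k := by
        have : ((2 : ℝ) ^ δ) ^ k = Real.exp (k * (δ * Real.log 2)) := by
          rw [Real.rpow_def_of_pos (by norm_num), ← Real.exp_nat_mul]; ring_nf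
        rw [this]
        linarith [Real.add_one_le_exp ((k : ℝ) * (δ * Real.log 2))]
      have h4 : 1 ≤ B * (δ * Real.log 2) := by
        have : 1 / (δ * Real.log 2) ≤ B := le_max_right _ _
        rwa [div_le_iff₀ (by positivity)] at this
      push_cast
      calc (k : ℝ) + 1 ≤ k * (B * (δ * Real.log 2)) + B := by nlinarith [(Nat.cast_nonneg k : (0 : ℝ) ≤ k)]
        _ = B * (1 + k * (δ * Real.log 2)) := by ring
        _ ≤ B * ((p : ℝ) ^ δ) ^ k := by gcongr; linarith
    · have h1 : (2 : ℝ) ≤ (p : ℝ) ^ δ := by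
        have : (2 : ℝ) ^ (1 / δ) ≤ p := hP.trans (by exact_mod_cast not_lt.mp h)
        calc (2 : ℝ) = ((2 : ℝ) ^ (1 / δ)) ^ δ := by
              rw [← Real.rpow_mul (by norm_num), one_div_mul_cancel hδ.ne', Real.rpow_one]
          _ ≤ _ := Real.rpow_le_rpow (by positivity) this hδ.le
      rw [one_mul]
      calc ((k + 1 : ℕ) : ℝ) ≤ 2 ^ k := by exact_mod_cast Nat.lt_two_pow_self (n := k)
        _ ≤ _ := pow_le_pow_left₀ (by norm_num) h1 k
  have hfac : (n : ℝ) = ∏ p ∈ n.primeFactors, (p : ℝ) ^ n.factorization p := by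
    conv_lhs => rw [← Nat.prod_factorization_pow_eq_self hn]
    rw [Finsupp.prod]; push_cast; rfl
  rw [Nat.card_divisors hn]
  push_cast
  calc ∏ p ∈ n.primeFactors, ((n.factorization p : ℝ) + 1)
      ≤ ∏ p ∈ n.primeFactors, ((if p < P then B else 1) * ((p : ℝ) ^ n.factorization p) ^ δ) := by
        apply Finset.prod_le_prod (fun _ _ => by positivity)
        intro p hp; have := key p hp; push_cast at this; exact this
    _ = (∏ p ∈ n.primeFactors, (if p < P then B else 1)) * (n : ℝ) ^ δ := by
        rw [Finset.prod_mul_distrib]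
        congr 1
        conv_rhs => rw [hfac]
        rw [← Real.finsetProd_rpow _ _ (fun _ _ => by positivity)]
    _ ≤ B ^ P * (n : ℝ) ^ δ := by
        gcongr
        rw [← Finset.prod_filter, Finset.prod_const]
        apply pow_le_pow_right₀ hB1
        calc _ ≤ (Finset.range P).card := Finset.card_le_card (by
              intro p hp; simp at hp ⊢; exact hp.2)
          _ = P := by simp

/-- Counting solutions of a linear congruence. -/
theorem ZMod.card_mul_eq_le {m : ℕ} [NeZero m] (w c : ZMod m) :
    (Finset.univ.filter fun x : ZMod m => w * x = c).card ≤ Nat.gcd w.val m := by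
  classical
  have h0 : (Finset.univ.filter fun x : ZMod m => w * x = 0).card ≤ Nat.gcd w.val m := by
    have hg : 0 < Nat.gcd w.val m := Nat.gcd_pos_of_pos_right _ (NeZero.pos m)
    refine le_trans (Finset.card_le_card ?_)
      (IsAddCyclic.card_nsmul_eq_zero_le (α := ZMod m) hg)
    intro x hx
    simp only [Finset.mem_filter, Finset.mem_univ, true_and] at hx ⊢
    rw [← addOrderOf_dvd_iff_nsmul_eq_zero]
    apply Nat.dvd_gcd
    · rw [addOrderOf_dvd_iff_nsmul_eq_zero, nsmul_eq_mul, ZMod.natCast_zmod_val, hx]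
    · rw [addOrderOf_dvd_iff_nsmul_eq_zero, nsmul_eq_mul, ZMod.natCast_self, zero_mul]
  by_cases h : ∃ x₀, w * x₀ = c
  · obtain ⟨x₀, hx₀⟩ := h
    refine le_trans ?_ h0
    apply Finset.card_le_card_of_injOn (fun x => x - x₀)
    · intro x hx
      simp only [Finset.coe_filter, Finset.mem_univ, true_and, Set.mem_ofPred_eq] at hx ⊢
      rw [mul_sub, hx, hx₀, sub_self]
    · intro x _ y _ hxy; simpa using hxy
  · rw [Finset.filter_eq_empty_iff.mpr]
    · simp
    · intro x _ hx; exact h ⟨x, hx⟩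

theorem ZMod.gcd_val_mul_le {m : ℕ} [NeZero m] (a b : ZMod m) :
    Nat.gcd (a * b).val m ≤ Nat.gcd a.val m * Nat.gcd b.val m := by
  rw [ZMod.val_mul, ← Nat.gcd_rec, Nat.gcd_comm m]
  exact Nat.le_of_dvd (Nat.mul_pos (Nat.gcd_pos_of_pos_right _ (NeZero.pos m))
    (Nat.gcd_pos_of_pos_right _ (NeZero.pos m))) (Nat.gcd_mul_left_dvd_mul_gcd _ _ _)

theorem sum_gcd_range_le (m : ℕ) (hm : m ≠ 0) :
    ∑ k ∈ Finset.range m, Nat.gcd k m ≤ m * m.divisors.card := by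
  have h1 : ∀ k ∈ Finset.range m, Nat.gcd k m ≤
      ∑ d ∈ m.divisors, if d ∣ k then d else 0 := by
    intro k _
    have hd : Nat.gcd k m ∈ m.divisors := by simp [hm, Nat.gcd_dvd_right]
    have := Finset.single_le_sum (f := fun d => if d ∣ k then d else 0)
      (fun _ _ => Nat.zero_le _) hd
    simpa [Nat.gcd_dvd_left] using this
  refine (Finset.sum_le_sum h1).trans ?_
  rw [Finset.sum_comm, mul_comm, ← smul_eq_mul]
  refine Finset.sum_le_card_nsmul _ _ _ fun d hd => ?_
  rw [← Finset.sum_filter, Finset.sum_const, smul_eq_mul]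
  obtain ⟨e, rfl⟩ := Nat.dvd_of_mem_divisors hd
  have hd0 : 0 < d := Nat.pos_of_ne_zero (left_ne_zero_of_mul hm)
  have : ((Finset.range (d * e)).filter fun k => d ∣ k).card ≤ e := by
    calc _ ≤ ((Finset.range e).image fun j => d * j).card := by
          apply Finset.card_le_card
          intro k hk
          simp only [Finset.mem_filter, Finset.mem_range, Finset.mem_image] at hk ⊢
          obtain ⟨hk, j, rfl⟩ := hk
          exact ⟨j, by exact lt_of_mul_lt_mul_left hk (Nat.zero_le _), rfl⟩
      _ ≤ _ := Finset.card_image_le.trans (by simp)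
  nlinarith

theorem ZMod.sum_gcd_val_le (m : ℕ) [NeZero m] :
    ∑ u : ZMod m, Nat.gcd u.val m ≤ m * m.divisors.card := by
  refine le_trans (le_of_eq ?_) (sum_gcd_range_le m (NeZero.ne m))
  refine Finset.sum_bij (fun u _ => u.val) (fun u _ => by simp [ZMod.val_lt])
    (fun a _ b _ h => ZMod.val_injective m h) (fun k hk => ⟨(k : ZMod m), by simp, ?_⟩)
    (fun _ _ => rfl)
  exact ZMod.val_cast_of_lt (Finset.mem_range.mp hk)

/-- Complete Kloosterman sums. -/
noncomputable def kloos (m : ℕ) [NeZero m] (n h : ZMod m) : ℂ :=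
  ∑ t : (ZMod m)ˣ, ZMod.stdAddChar (n * ((t⁻¹ : (ZMod m)ˣ) : ZMod m) + h * (t : ZMod m))

theorem kloos_twist {m : ℕ} [NeZero m] (n h : ZMod m) (u : (ZMod m)ˣ) :
    kloos m (n * (u : ZMod m)) (h * ((u⁻¹ : (ZMod m)ˣ) : ZMod m)) = kloos m n h := by
  unfold kloos
  refine Fintype.sum_equiv (Equiv.mulLeft u⁻¹) _ _ fun t => ?_
  simp only [Equiv.coe_mulLeft, mul_inv_rev, inv_inv, Units.val_mul]
  congr 1
  ring

/-- The additive energy entering the fourth moment of Kloosterman sums. -/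
theorem kloos_energy_le (m : ℕ) [NeZero m] :
    (Finset.univ.filter fun p : ((ZMod m)ˣ × (ZMod m)ˣ) × ((ZMod m)ˣ × (ZMod m)ˣ) =>
      ((p.1.1⁻¹ : (ZMod m)ˣ) : ZMod m) + ((p.1.2⁻¹ : (ZMod m)ˣ) : ZMod m) =
        ((p.2.1⁻¹ : (ZMod m)ˣ) : ZMod m) + ((p.2.2⁻¹ : (ZMod m)ˣ) : ZMod m) ∧
      (p.1.1 : ZMod m) + (p.1.2 : ZMod m) = (p.2.1 : ZMod m) + (p.2.2 : ZMod m)).card ≤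
      2 * (m * m.divisors.card) ^ 2 := by
  classical
  have step1 : (Finset.univ.filter fun p : ((ZMod m)ˣ × (ZMod m)ˣ) × ((ZMod m)ˣ × (ZMod m)ˣ) =>
      ((p.1.1⁻¹ : (ZMod m)ˣ) : ZMod m) + ((p.1.2⁻¹ : (ZMod m)ˣ) : ZMod m) =
        ((p.2.1⁻¹ : (ZMod m)ˣ) : ZMod m) + ((p.2.2⁻¹ : (ZMod m)ˣ) : ZMod m) ∧
      (p.1.1 : ZMod m) + (p.1.2 : ZMod m) = (p.2.1 : ZMod m) + (p.2.2 : ZMod m)).card ≤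
      ((Finset.univ : Finset (ZMod m × ZMod m)).sigma fun uv =>
        Finset.univ.filter fun x : ZMod m =>
          (2 * (uv.1 * uv.2)) * x = -((uv.1 + uv.2) * (uv.1 * uv.2))).card := by
    apply Finset.card_le_card_of_injOn (fun p =>
      ⟨((p.2.1 : ZMod m) - p.1.1, (p.1.2 : ZMod m) - p.2.1), (p.1.1 : ZMod m)⟩)
    · rintro ⟨⟨a, b⟩, ⟨c, d⟩⟩ hp
      simp only [Finset.coe_filter, Finset.mem_univ, true_and, Set.mem_ofPred_eq] at hp
      simp only [Finset.mem_coe, Finset.mem_sigma, Finset.mem_univ, true_and, Finset.mem_filter]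
      obtain ⟨h1, h2⟩ := hp
      have ha : (a : ZMod m) * ((a⁻¹ : (ZMod m)ˣ) : ZMod m) = 1 := Units.mul_inv a
      have hb : (b : ZMod m) * ((b⁻¹ : (ZMod m)ˣ) : ZMod m) = 1 := Units.mul_inv b
      have hc : (c : ZMod m) * ((c⁻¹ : (ZMod m)ˣ) : ZMod m) = 1 := Units.mul_inv c
      have hd : (d : ZMod m) * ((d⁻¹ : (ZMod m)ˣ) : ZMod m) = 1 := Units.mul_inv d
      generalize (a : ZMod m) = a at *
      generalize (b : ZMod m) = b at *
      generalize (c : ZMod m) = c at *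
      generalize (d : ZMod m) = d at *
      generalize ((_ : (ZMod m)ˣ) : ZMod m) = a' at *
      generalize ((_ : (ZMod m)ˣ) : ZMod m) = b' at *
      generalize ((_ : (ZMod m)ˣ) : ZMod m) = c' at *
      generalize ((_ : (ZMod m)ˣ) : ZMod m) = d' at *
      obtain rfl : d = a + b - c := by linear_combination -h2
      have : (a + b) * (c * (a + b - c)) = (a + b) * (a * b) := by
        linear_combination (a * b * c * (a + b - c)) * h1 - b * c * (a + b - c) * ha - a * c * (a + b - c) * hb
          + a * b * (a + b - c) * hc + a * b * c * hd
      linear_combination this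
    · rintro ⟨⟨a, b⟩, ⟨c, d⟩⟩ hp ⟨⟨a', b'⟩, ⟨c', d'⟩⟩ hp' h
      simp only [Finset.coe_filter, Finset.mem_univ, true_and, Set.mem_ofPred_eq] at hp hp'
      simp only [Sigma.mk.injEq, Prod.mk.injEq, heq_eq_eq] at h
      obtain ⟨⟨h1, h2⟩, h3⟩ := h
      have e1 : a = a' := Units.ext h3
      have e2 : c = c' := Units.ext (by linear_combination h1 + h3)
      have e3 : b = b' := Units.ext (by linear_combination h1 + h2 + h3)
      have e4 : d = d' := Units.ext (by
        subst e1 e2 e3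
        linear_combination hp'.2 - hp.2)
      subst e1 e2 e3 e4; rfl
  refine step1.trans ?_
  rw [Finset.card_sigma]
  have h2 : Nat.gcd (2 : ZMod m).val m ≤ 2 := by
    have : Nat.gcd (2 : ZMod m).val m = Nat.gcd 2 m := by
      have : (2 : ZMod m) = ((2 : ℕ) : ZMod m) := by norm_cast
      rw [this, ZMod.val_natCast, ← Nat.gcd_rec, Nat.gcd_comm]
    rw [this]; exact Nat.gcd_le_left _ (by norm_num)
  calc _ ≤ ∑ uv : ZMod m × ZMod m, 2 * (Nat.gcd uv.1.val m * Nat.gcd uv.2.val m) := by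
        apply Finset.sum_le_sum
        rintro ⟨u, v⟩ _
        refine (ZMod.card_mul_eq_le _ _).trans ?_
        refine (ZMod.gcd_val_mul_le _ _).trans ?_
        exact Nat.mul_le_mul h2 (ZMod.gcd_val_mul_le _ _)
    _ = 2 * (∑ u : ZMod m, Nat.gcd u.val m) ^ 2 := by
        rw [← Finset.mul_sum, sq, Finset.sum_mul_sum, Fintype.sum_prod_type]
    _ ≤ _ := by gcongr; exact ZMod.sum_gcd_val_le m

theorem ZMod.sum_stdAddChar_mul {m : ℕ} [NeZero m] (b : ZMod m) :
    ∑ x : ZMod m, ZMod.stdAddChar (x * b) = if b = 0 then (m : ℂ) else 0 := by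
  have := AddChar.sum_mulShift b (ZMod.isPrimitive_stdAddChar m)
  rw [this, ZMod.card]
  split_ifs <;> simp

/-- A discrete two dimensional Parseval identity. -/
theorem ZMod.parseval_two {m : ℕ} [NeZero m] {ι : Type*} [Fintype ι] (a b : ι → ZMod m) :
    ∑ n : ZMod m, ∑ h : ZMod m, ‖∑ i, (ZMod.stdAddChar (n * a i + h * b i) : ℂ)‖ ^ 2 =
      (m : ℝ) ^ 2 * ((Finset.univ.filter fun p : ι × ι =>
        a p.1 = a p.2 ∧ b p.1 = b p.2).card : ℝ) := by
  classical
  have key : ∀ n h : ZMod m, ((‖∑ i, (ZMod.stdAddChar (n * a i + h * b i) : ℂ)‖ ^ 2 : ℝ) : ℂ) =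
      ∑ p : ι × ι, ZMod.stdAddChar (n * (a p.1 - a p.2)) * ZMod.stdAddChar (h * (b p.1 - b p.2)) := by
    intro n h
    rw [Complex.ofReal_pow, ← Complex.mul_conj', map_sum, Finset.sum_mul_sum,
      Fintype.sum_prod_type]
    refine Finset.sum_congr rfl fun i _ => Finset.sum_congr rfl fun j _ => ?_
    rw [← AddChar.map_neg_eq_conj, ← AddChar.map_add_eq_mul, ← AddChar.map_add_eq_mul]
    congr 1; ring
  have : ((∑ n : ZMod m, ∑ h : ZMod m,
      ‖∑ i, (ZMod.stdAddChar (n * a i + h * b i) : ℂ)‖ ^ 2 : ℝ) : ℂ) =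
      (((m : ℝ) ^ 2 * ((Finset.univ.filter fun p : ι × ι =>
        a p.1 = a p.2 ∧ b p.1 = b p.2).card : ℝ) : ℝ) : ℂ) := by
    rw [Complex.ofReal_sum]
    simp_rw [Complex.ofReal_sum, key]
    simp_rw [Finset.sum_comm (s := (Finset.univ : Finset (ZMod m))) (t := (Finset.univ : Finset (ι × ι)))]
    simp_rw [← Finset.mul_sum, ← Finset.sum_mul, ZMod.sum_stdAddChar_mul, sub_eq_zero]
    push_cast
    rw [Finset.card_filter, Nat.cast_sum, Finset.mul_sum]
    refine Finset.sum_congr rfl fun p _ => ?_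
    by_cases h1 : a p.1 = a p.2 <;> by_cases h2 : b p.1 = b p.2 <;> simp [h1, h2, sq]
  exact_mod_cast this

theorem kloos_fourth_moment (m : ℕ) [NeZero m] :
    ∑ n : ZMod m, ∑ h : ZMod m, ‖kloos m n h‖ ^ 4 ≤
      2 * (m : ℝ) ^ 4 * (m.divisors.card : ℝ) ^ 2 := by
  have e : ∀ n h : ZMod m, ‖kloos m n h‖ ^ 4 =
      ‖∑ p : (ZMod m)ˣ × (ZMod m)ˣ, (ZMod.stdAddChar
        (n * (((p.1⁻¹ : (ZMod m)ˣ) : ZMod m) + ((p.2⁻¹ : (ZMod m)ˣ) : ZMod m)) +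
          h * ((p.1 : ZMod m) + (p.2 : ZMod m))) : ℂ)‖ ^ 2 := by
    intro n h
    have : kloos m n h ^ 2 = ∑ p : (ZMod m)ˣ × (ZMod m)ˣ, (ZMod.stdAddChar
        (n * (((p.1⁻¹ : (ZMod m)ˣ) : ZMod m) + ((p.2⁻¹ : (ZMod m)ˣ) : ZMod m)) +
          h * ((p.1 : ZMod m) + (p.2 : ZMod m))) : ℂ) := by
      rw [kloos, sq, Finset.sum_mul_sum, Fintype.sum_prod_type]
      refine Finset.sum_congr rfl fun i _ => Finset.sum_congr rfl fun j _ => ?_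
      rw [← AddChar.map_add_eq_mul]; congr 1; ring
    rw [← this, norm_pow, ← pow_mul]
  simp_rw [e]
  rw [ZMod.parseval_two]
  have := kloos_energy_le m
  have h2 : ((Finset.univ.filter fun p : ((ZMod m)ˣ × (ZMod m)ˣ) × ((ZMod m)ˣ × (ZMod m)ˣ) =>
      ((p.1.1⁻¹ : (ZMod m)ˣ) : ZMod m) + ((p.1.2⁻¹ : (ZMod m)ˣ) : ZMod m) =
        ((p.2.1⁻¹ : (ZMod m)ˣ) : ZMod m) + ((p.2.2⁻¹ : (ZMod m)ˣ) : ZMod m) ∧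
      (p.1.1 : ZMod m) + (p.1.2 : ZMod m) = (p.2.1 : ZMod m) + (p.2.2 : ZMod m)).card : ℝ) ≤
      2 * (m * m.divisors.card) ^ 2 := by exact_mod_cast this
  calc _ ≤ (m : ℝ) ^ 2 * (2 * (m * m.divisors.card) ^ 2) := by gcongr
    _ = _ := by ring

theorem le_totient_mul_card_divisors (m : ℕ) : m ≤ m.totient * m.divisors.card := by
  rcases Nat.eq_zero_or_pos m with rfl | hm
  · simp
  conv_lhs => rw [← Nat.sum_totient m]
  rw [mul_comm, ← smul_eq_mul]
  refine Finset.sum_le_card_nsmul _ _ _ fun d hd => ?_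
  exact Nat.le_of_dvd (Nat.totient_pos.mpr hm)
    (Nat.totient_dvd_of_dvd (Nat.dvd_of_mem_divisors hd))

/-- A Kloosterman type bound for complete Kloosterman sums. -/
theorem kloos_norm_pow_four_le {m : ℕ} [NeZero m] (n h : ZMod m) :
    ‖kloos m n h‖ ^ 4 ≤ 2 * (Nat.gcd n.val m : ℝ) * (m : ℝ) ^ 3 * (m.divisors.card : ℝ) ^ 3 := by
  classical
  set f : (ZMod m)ˣ → ZMod m × ZMod m :=
    fun u => (n * (u : ZMod m), h * ((u⁻¹ : (ZMod m)ˣ) : ZMod m)) with hf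
  have h1 : (m.totient : ℝ) * ‖kloos m n h‖ ^ 4 = ∑ u : (ZMod m)ˣ, ‖kloos m (f u).1 (f u).2‖ ^ 4 := by
    simp_rw [hf, kloos_twist]
    rw [Finset.sum_const, Finset.card_univ, ZMod.card_units_eq_totient, nsmul_eq_mul]
  have h2 : ∑ u : (ZMod m)ˣ, ‖kloos m (f u).1 (f u).2‖ ^ 4 ≤
      (Nat.gcd n.val m : ℝ) * ∑ p : ZMod m × ZMod m, ‖kloos m p.1 p.2‖ ^ 4 := by
    rw [← Finset.sum_fiberwise (s := (Finset.univ : Finset (ZMod m)ˣ)) f, Finset.mul_sum]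
    refine Finset.sum_le_sum fun p _ => ?_
    have : ∀ u ∈ Finset.univ.filter fun u => f u = p,
        ‖kloos m (f u).1 (f u).2‖ ^ 4 = ‖kloos m p.1 p.2‖ ^ 4 := by
      intro u hu; rw [(Finset.mem_filter.mp hu).2]
    rw [Finset.sum_congr rfl this, Finset.sum_const, nsmul_eq_mul]
    gcongr
    refine le_trans ?_ (ZMod.card_mul_eq_le n p.1)
    apply Finset.card_le_card_of_injOn (fun u : (ZMod m)ˣ => (u : ZMod m))
    · intro u hu
      simp only [Finset.coe_filter, Finset.mem_univ, true_and, Set.mem_ofPred_eq] at hu ⊢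
      rw [← hu]
    · intro a _ b _ hab; exact Units.ext hab
  have h3 : ∑ p : ZMod m × ZMod m, ‖kloos m p.1 p.2‖ ^ 4 ≤
      2 * (m : ℝ) ^ 4 * (m.divisors.card : ℝ) ^ 2 := by
    rw [Fintype.sum_prod_type]; exact kloos_fourth_moment m
  have h4 : (m : ℝ) ≤ m.totient * m.divisors.card := by
    exact_mod_cast le_totient_mul_card_divisors m
  have hm : (0 : ℝ) < m := by exact_mod_cast NeZero.pos m
  have h5 : (m : ℝ) * ‖kloos m n h‖ ^ 4 ≤
      m * (2 * (Nat.gcd n.val m : ℝ) * (m : ℝ) ^ 3 * (m.divisors.card : ℝ) ^ 3) := by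
    calc _ ≤ ((m.totient : ℝ) * m.divisors.card) * ‖kloos m n h‖ ^ 4 := by gcongr
      _ = m.divisors.card * ((m.totient : ℝ) * ‖kloos m n h‖ ^ 4) := by ring
      _ ≤ m.divisors.card * ((Nat.gcd n.val m : ℝ) *
          (2 * (m : ℝ) ^ 4 * (m.divisors.card : ℝ) ^ 2)) := by
          rw [h1]; gcongr; exact h2.trans (by gcongr)
      _ = _ := by ring
  exact le_of_mul_le_mul_left h5 hm

theorem one_div_sin_le {x y : ℝ} (hx : 0 < x) (hxy : x < y) :
    1 / Real.sin (π * x / y) ≤ y / 2 * (1 / x + 1 / (y - x)) := by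
  have hy : 0 < y := hx.trans hxy
  have hyx : 0 < y - x := sub_pos.mpr hxy
  rcases le_total (2 * x) y with h | h
  · have h1 : 2 / π * (π * x / y) ≤ Real.sin (π * x / y) := by
      apply Real.mul_le_sin (by positivity)
      rw [div_le_div_iff₀ hy two_pos]; nlinarith [Real.pi_pos]
    have h2 : 2 / π * (π * x / y) = 2 * x / y := by field_simp
    rw [h2] at h1
    calc 1 / Real.sin (π * x / y) ≤ 1 / (2 * x / y) := by gcongr
      _ = y / 2 * (1 / x) := by field_simp
      _ ≤ _ := by gcongr; linarith [one_div_pos.mpr hyx]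
  · have h1 : 2 / π * (π * (y - x) / y) ≤ Real.sin (π * (y - x) / y) := by
      apply Real.mul_le_sin (by positivity)
      rw [div_le_div_iff₀ hy two_pos]; nlinarith [Real.pi_pos]
    have h2 : 2 / π * (π * (y - x) / y) = 2 * (y - x) / y := by field_simp
    have h3 : Real.sin (π * (y - x) / y) = Real.sin (π * x / y) := by
      rw [← Real.sin_pi_sub]; congr 1; field_simp; ring
    rw [h2, h3] at h1
    calc 1 / Real.sin (π * x / y) ≤ 1 / (2 * (y - x) / y) := by gcongr
      _ = y / 2 * (1 / (y - x)) := by field_simp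
      _ ≤ _ := by gcongr; linarith [one_div_pos.mpr hx]

theorem ZMod.norm_geom_stdAddChar_le {m : ℕ} [NeZero m] {k : ZMod m} (hk : k ≠ 0) (J : ℕ) :
    ‖∑ j ∈ Finset.range J, (ZMod.stdAddChar (k * (j : ZMod m)) : ℂ)‖ ≤
      (m : ℝ) / 2 * (1 / (k.val : ℝ) + 1 / ((m : ℝ) - k.val)) := by
  have hk1 : (0 : ℝ) < k.val := by
    exact_mod_cast Nat.pos_of_ne_zero (by simpa [ZMod.val_eq_zero] using hk)
  have hk2 : (k.val : ℝ) < m := by exact_mod_cast ZMod.val_lt k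
  have hm : (0 : ℝ) < m := hk1.trans hk2
  have hval : (ZMod.stdAddChar k : ℂ) = Complex.exp (Complex.I * ((2 * π * k.val / m : ℝ) : ℂ)) := by
    have := ZMod.stdAddChar_coe (N := m) (k.val : ℤ)
    rw [Int.cast_natCast, ZMod.natCast_zmod_val] at this
    rw [this]; congr 1; push_cast; ring
  have hs : 0 < Real.sin (π * k.val / m) := by
    apply Real.sin_pos_of_pos_of_lt_pi (by positivity)
    rw [div_lt_iff₀ hm]; nlinarith [Real.pi_pos]
  have hnorm : ‖(ZMod.stdAddChar k : ℂ) - 1‖ = 2 * Real.sin (π * k.val / m) := by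
    rw [hval, Complex.norm_exp_I_mul_ofReal_sub_one, Real.norm_eq_abs]
    have : 2 * π * k.val / m / 2 = π * k.val / m := by ring
    rw [this, abs_of_pos (by positivity)]
  have hne : (ZMod.stdAddChar k : ℂ) ≠ 1 := by
    intro h; rw [h, sub_self, norm_zero] at hnorm; linarith
  have hpow : ∀ j : ℕ, (ZMod.stdAddChar (k * (j : ZMod m)) : ℂ) = (ZMod.stdAddChar k : ℂ) ^ j := by
    intro j; rw [← AddChar.map_nsmul_eq_pow, nsmul_eq_mul, mul_comm]
  simp_rw [hpow]
  rw [geom_sum_eq hne, norm_div, hnorm]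
  have h2 : ‖(ZMod.stdAddChar k : ℂ) ^ J - 1‖ ≤ 2 := by
    calc _ ≤ ‖(ZMod.stdAddChar k : ℂ) ^ J‖ + ‖(1 : ℂ)‖ := norm_sub_le _ _
      _ = 2 := by rw [norm_pow, AddChar.norm_apply]; norm_num
  calc _ ≤ 2 / (2 * Real.sin (π * k.val / m)) := by gcongr
    _ = 1 / Real.sin (π * k.val / m) := by field_simp
    _ ≤ _ := one_div_sin_le hk1 hk2

theorem ZMod.sum_ne_zero_eq {m : ℕ} [NeZero m] (F : ℕ → ℝ) :
    ∑ n ∈ (Finset.univ : Finset (ZMod m)).filter (· ≠ 0), F n.val = ∑ k ∈ Finset.Ico 1 m, F k := by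
  refine Finset.sum_bij (fun u _ => u.val) (fun u hu => ?_)
    (fun a _ b _ h => ZMod.val_injective m h) (fun k hk => ⟨(k : ZMod m), ?_, ?_⟩)
    (fun _ _ => rfl)
  · simp only [Finset.mem_filter, Finset.mem_univ, true_and] at hu
    rw [Finset.mem_Ico]
    exact ⟨Nat.pos_of_ne_zero (by simpa [ZMod.val_eq_zero] using hu), ZMod.val_lt u⟩
  · rw [Finset.mem_Ico] at hk
    simp only [Finset.mem_filter, Finset.mem_univ, true_and]
    intro h
    have := ZMod.val_cast_of_lt hk.2
    rw [h, ZMod.val_zero] at this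
    omega
  · rw [Finset.mem_Ico] at hk
    exact ZMod.val_cast_of_lt hk.2

theorem sum_Ico_symm {m : ℕ} (g : ℕ → ℝ) (hg : ∀ k ∈ Finset.Ico 1 m, g (m - k) = g k) :
    ∑ k ∈ Finset.Ico 1 m, g k * ((m : ℝ) / 2 * (1 / (k : ℝ) + 1 / ((m : ℝ) - k))) =
      m * ∑ k ∈ Finset.Ico 1 m, g k / k := by
  have h1 : ∑ k ∈ Finset.Ico 1 m, g k / ((m : ℝ) - k) = ∑ k ∈ Finset.Ico 1 m, g k / k := by
    refine Finset.sum_bij' (fun k _ => m - k) (fun k _ => m - k) ?_ ?_ ?_ ?_ ?_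
    · intro k hk; rw [Finset.mem_Ico] at hk ⊢; omega
    · intro k hk; rw [Finset.mem_Ico] at hk ⊢; omega
    · intro k hk; rw [Finset.mem_Ico] at hk; omega
    · intro k hk; rw [Finset.mem_Ico] at hk; omega
    · intro k hk
      rw [hg k hk]; rw [Finset.mem_Ico] at hk
      rw [Nat.cast_sub hk.2.le]
  have : ∀ k ∈ Finset.Ico 1 m, g k * ((m : ℝ) / 2 * (1 / (k : ℝ) + 1 / ((m : ℝ) - k))) =
      m / 2 * (g k / k) + m / 2 * (g k / ((m : ℝ) - k)) := by
    intro k _; ring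
  rw [Finset.sum_congr rfl this, Finset.sum_add_distrib, ← Finset.mul_sum, ← Finset.mul_sum, h1]
  ring

theorem sum_Ico_one_div_le (m : ℕ) : ∑ k ∈ Finset.Ico 1 m, (1 : ℝ) / k ≤ 1 + Real.log m := by
  calc ∑ k ∈ Finset.Ico 1 m, (1 : ℝ) / k ≤ ∑ k ∈ Finset.Icc 1 m, (1 : ℝ) / k := by
        apply Finset.sum_le_sum_of_subset_of_nonneg
        · intro k hk; simp at hk ⊢; omega
        · intros; positivity
    _ = (harmonic m : ℝ) := by
        rw [harmonic_eq_sum_Icc]; push_cast; simp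
    _ ≤ _ := harmonic_le_one_add_log m

theorem sum_Ico_gcd_div_le (m : ℕ) (hm : m ≠ 0) : ∑ k ∈ Finset.Ico 1 m, (Nat.gcd k m : ℝ) / k ≤
    m.divisors.card * (1 + Real.log m) := by
  have h1 : ∀ k ∈ Finset.Ico 1 m, (Nat.gcd k m : ℝ) / k ≤
      ∑ d ∈ m.divisors, if d ∣ k then (d : ℝ) / k else 0 := by
    intro k _
    have hd : Nat.gcd k m ∈ m.divisors := by simp [hm, Nat.gcd_dvd_right]
    have := Finset.single_le_sum (f := fun d : ℕ => if d ∣ k then (d : ℝ) / k else 0)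
      (fun _ _ => by positivity) hd
    simpa [Nat.gcd_dvd_left] using this
  refine (Finset.sum_le_sum h1).trans ?_
  rw [Finset.sum_comm, ← nsmul_eq_mul]
  refine Finset.sum_le_card_nsmul _ _ _ fun d hd => ?_
  rw [← Finset.sum_filter]
  have hd0 : 0 < d := Nat.pos_of_mem_divisors hd
  refine le_trans ?_ (sum_Ico_one_div_le m)
  calc _ ≤ ∑ k ∈ (Finset.Ico 1 m).image (fun j => d * j), (d : ℝ) / k := by
        apply Finset.sum_le_sum_of_subset_of_nonneg
        · intro k hk
          simp only [Finset.mem_filter, Finset.mem_image, Finset.mem_Ico] at hk ⊢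
          obtain ⟨⟨hk1, hk2⟩, j, rfl⟩ := hk
          refine ⟨j, ⟨Nat.pos_of_ne_zero (by rintro rfl; simp at hk1), ?_⟩, rfl⟩
          nlinarith
        · intros; positivity
    _ = ∑ k ∈ Finset.Ico 1 m, (1 : ℝ) / k := by
        rw [Finset.sum_image]
        · refine Finset.sum_congr rfl fun k hk => ?_
          have : (k : ℝ) ≠ 0 := by
            rw [Finset.mem_Ico] at hk; exact_mod_cast (by omega : k ≠ 0)
          have : (d : ℝ) ≠ 0 := by exact_mod_cast hd0.ne'
          push_cast; field_simp
        · intro a _ b _ h; exact Nat.eq_of_mul_eq_mul_left hd0 h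

theorem ZMod.sum_norm_geom_le {m : ℕ} [NeZero m] (l : ℕ) (hl : 0 < l) (J : ℕ) :
    ∑ h : ZMod m, ‖∑ j ∈ Finset.range J, (ZMod.stdAddChar (h * (l : ZMod m) * (j : ZMod m)) : ℂ)‖ ≤
      l * (J + m * (1 + Real.log m)) := by
  classical
  set G : ZMod m → ℝ := fun k => ‖∑ j ∈ Finset.range J, (ZMod.stdAddChar (k * (j : ZMod m)) : ℂ)‖ with hG
  have h1 : ∑ h : ZMod m, G (h * (l : ZMod m)) ≤ ∑ k : ZMod m, l * G k := by
    rw [← Finset.sum_fiberwise (s := (Finset.univ : Finset (ZMod m))) (fun h => h * (l : ZMod m))]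
    refine Finset.sum_le_sum fun k _ => ?_
    have : ∀ u ∈ Finset.univ.filter fun u : ZMod m => u * (l : ZMod m) = k, G (u * (l : ZMod m)) = G k := by
      intro u hu; rw [(Finset.mem_filter.mp hu).2]
    rw [Finset.sum_congr rfl this, Finset.sum_const, nsmul_eq_mul]
    gcongr
    have := ZMod.card_mul_eq_le (l : ZMod m) k
    simp_rw [mul_comm _ (l : ZMod m)]
    refine this.trans ?_
    rw [ZMod.val_natCast, ← Nat.gcd_rec, Nat.gcd_comm]
    exact Nat.gcd_le_left _ hl
  refine h1.trans ?_
  rw [← Finset.mul_sum]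
  gcongr
  rw [← Finset.sum_filter_add_sum_filter_not _ (fun k : ZMod m => k = 0)]
  gcongr
  · rw [Finset.filter_eq' , if_pos (Finset.mem_univ _), Finset.sum_singleton]
    simp [hG]
  · calc _ ≤ ∑ n ∈ (Finset.univ : Finset (ZMod m)).filter (· ≠ 0),
          (m : ℝ) / 2 * (1 / (n.val : ℝ) + 1 / ((m : ℝ) - n.val)) := by
          refine Finset.sum_le_sum fun n hn => ?_
          exact ZMod.norm_geom_stdAddChar_le (by simpa using hn) J
      _ = m * ∑ k ∈ Finset.Ico 1 m, (1 : ℝ) / k := by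
          rw [ZMod.sum_ne_zero_eq (fun k => (m : ℝ) / 2 * (1 / (k : ℝ) + 1 / ((m : ℝ) - k)))]
          rw [← sum_Ico_symm (fun _ => 1) (fun _ _ => rfl)]
          simp
      _ ≤ _ := by gcongr; exact sum_Ico_one_div_le m

theorem ZMod.count_fourier {m : ℕ} [NeZero m] (s : ZMod m) (y : ℕ → ZMod m) (J : ℕ)
    (W : Finset (ZMod m)) :
    (m : ℂ) ^ 2 * (((Finset.range J).filter fun j =>
      ∃ t : (ZMod m)ˣ, (t : ZMod m) = y j ∧ s * ((t⁻¹ : (ZMod m)ˣ) : ZMod m) ∈ W).card : ℂ) =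
    ∑ n : ZMod m, (∑ r ∈ W, (ZMod.stdAddChar (-(n * r)) : ℂ)) *
      ∑ h : ZMod m, (∑ j ∈ Finset.range J, (ZMod.stdAddChar (-(h * y j)) : ℂ)) *
        kloos m (s * n) h := by
  classical
  set X : Finset (ZMod m × ℕ × (ZMod m)ˣ) := W ×ˢ (Finset.range J ×ˢ Finset.univ) with hX
  have hexp : ∀ n h : ZMod m, (∑ r ∈ W, (ZMod.stdAddChar (-(n * r)) : ℂ)) *
      ((∑ j ∈ Finset.range J, (ZMod.stdAddChar (-(h * y j)) : ℂ)) * kloos m (s * n) h) =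
      ∑ p ∈ X, ZMod.stdAddChar (n * (s * ((p.2.2⁻¹ : (ZMod m)ˣ) : ZMod m) - p.1)) *
        ZMod.stdAddChar (h * ((p.2.2 : ZMod m) - y p.2.1)) := by
    intro n h
    rw [hX, Finset.sum_product, kloos, Finset.sum_mul]
    refine Finset.sum_congr rfl fun r _ => ?_
    rw [Finset.sum_product, Finset.sum_mul_sum, Finset.mul_sum]
    refine Finset.sum_congr rfl fun j _ => ?_
    rw [Finset.mul_sum]
    refine Finset.sum_congr rfl fun t _ => ?_
    rw [← AddChar.map_add_eq_mul, ← AddChar.map_add_eq_mul, ← AddChar.map_add_eq_mul]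
    congr 1; ring
  simp_rw [Finset.mul_sum, hexp]
  have hcomm : ∀ n : ZMod m, ∑ h : ZMod m, ∑ p ∈ X,
      (ZMod.stdAddChar (n * (s * ((p.2.2⁻¹ : (ZMod m)ˣ) : ZMod m) - p.1)) : ℂ) *
        ZMod.stdAddChar (h * ((p.2.2 : ZMod m) - y p.2.1)) =
      ∑ p ∈ X, (ZMod.stdAddChar (n * (s * ((p.2.2⁻¹ : (ZMod m)ˣ) : ZMod m) - p.1)) : ℂ) *
        ∑ h : ZMod m, ZMod.stdAddChar (h * ((p.2.2 : ZMod m) - y p.2.1)) := by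
    intro n
    rw [Finset.sum_comm]
    simp_rw [Finset.mul_sum]
  simp_rw [hcomm]
  rw [Finset.sum_comm]
  simp_rw [← Finset.sum_mul, ZMod.sum_stdAddChar_mul, sub_eq_zero]
  have hcard : ((Finset.range J).filter fun j =>
      ∃ t : (ZMod m)ˣ, (t : ZMod m) = y j ∧ s * ((t⁻¹ : (ZMod m)ˣ) : ZMod m) ∈ W).card =
      (X.filter fun p => s * ((p.2.2⁻¹ : (ZMod m)ˣ) : ZMod m) = p.1 ∧
        (p.2.2 : ZMod m) = y p.2.1).card := by
    symm
    refine Finset.card_bij (fun p _ => p.2.1) ?_ ?_ ?_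
    · rintro ⟨r, j, t⟩ hp
      simp only [hX, Finset.mem_filter, Finset.mem_product, Finset.mem_univ, and_true] at hp ⊢
      exact ⟨hp.1.2, t, hp.2.2, hp.2.1 ▸ hp.1.1⟩
    · rintro ⟨r, j, t⟩ hp ⟨r', j', t'⟩ hp' h
      simp only [hX, Finset.mem_filter, Finset.mem_product, Finset.mem_univ, and_true] at hp hp' h
      subst h
      have : t = t' := Units.ext (hp.2.2.trans hp'.2.2.symm)
      subst this
      rw [← hp.2.1, ← hp'.2.1]
    · intro j hj
      simp only [Finset.mem_filter] at hj
      obtain ⟨hj, t, ht, hW⟩ := hj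
      refine ⟨(s * ((t⁻¹ : (ZMod m)ˣ) : ZMod m), j, t), ?_, rfl⟩
      simp only [hX, Finset.mem_filter, Finset.mem_product, Finset.mem_univ, and_true]
      exact ⟨⟨hW, hj⟩, trivial, ht⟩
  rw [hcard, Finset.card_filter, Nat.cast_sum, Finset.mul_sum]
  refine Finset.sum_congr rfl fun p _ => ?_
  by_cases h1 : s * ((p.2.2⁻¹ : (ZMod m)ˣ) : ZMod m) = p.1 <;>
    by_cases h2 : (p.2.2 : ZMod m) = y p.2.1 <;> simp [h1, h2, sq]

theorem kloos_norm_le {m : ℕ} [NeZero m] (n h : ZMod m) :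
    ‖kloos m n h‖ ≤ 2 * (Nat.gcd n.val m : ℝ) * (m : ℝ) ^ (3 / 4 : ℝ) * (m.divisors.card : ℝ) := by
  have hm : (0 : ℝ) < m := by exact_mod_cast NeZero.pos m
  have hg : (1 : ℝ) ≤ (Nat.gcd n.val m : ℝ) := by
    exact_mod_cast Nat.gcd_pos_of_pos_right _ (NeZero.pos m)
  have hd : (1 : ℝ) ≤ (m.divisors.card : ℝ) := by
    exact_mod_cast Finset.card_pos.mpr ⟨1, by simp [NeZero.ne m]⟩
  refine le_of_pow_le_pow_left₀ (n := 4) (by norm_num) (by positivity) ?_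
  refine (kloos_norm_pow_four_le n h).trans ?_
  have e : ((m : ℝ) ^ (3 / 4 : ℝ)) ^ 4 = (m : ℝ) ^ 3 := by
    rw [← Real.rpow_natCast, ← Real.rpow_mul hm.le]; norm_num
  rw [mul_pow, mul_pow, mul_pow, e]
  have h1 : (Nat.gcd n.val m : ℝ) ≤ (Nat.gcd n.val m : ℝ) ^ 4 := le_self_pow₀ hg (by norm_num)
  have h2 : (m.divisors.card : ℝ) ^ 3 ≤ (m.divisors.card : ℝ) ^ 4 := pow_le_pow_right₀ hd (by norm_num)
  gcongr
  norm_num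

theorem ZMod.disc_fourier {m : ℕ} [NeZero m] (l : ℕ) (hl : 0 < l) (s : ZMod m) (hs : IsUnit s)
    (b : ZMod m) (J : ℕ) (W : Finset (ZMod m))
    (hW : ∀ n : ZMod m, n ≠ 0 → ‖∑ r ∈ W, (ZMod.stdAddChar (-(n * r)) : ℂ)‖ ≤
      (m : ℝ) / 2 * (1 / (n.val : ℝ) + 1 / ((m : ℝ) - n.val))) :
    |(((Finset.range J).filter fun j : ℕ => ∃ t : (ZMod m)ˣ,
        (t : ZMod m) = b + l * (j : ZMod m) ∧ s * ((t⁻¹ : (ZMod m)ˣ) : ZMod m) ∈ W).card : ℝ) -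
      (W.card : ℝ) / m * ((Finset.range J).filter fun j : ℕ =>
        IsUnit (b + l * (j : ZMod m))).card| ≤
    2 * l * (m : ℝ) ^ (3 / 4 : ℝ) * (m.divisors.card : ℝ) ^ 2 * (1 + Real.log m) *
      (J / m + (1 + Real.log m)) := by
  classical
  have hm : (0 : ℝ) < m := by exact_mod_cast NeZero.pos m
  have hm1 : (1 : ℝ) ≤ m := by exact_mod_cast NeZero.pos m
  have hlog : 0 ≤ Real.log m := Real.log_nonneg hm1
  set y : ℕ → ZMod m := fun j => b + l * (j : ZMod m) with hy
  set Y : ZMod m → ℂ := fun h => ∑ j ∈ Finset.range J, (ZMod.stdAddChar (-(h * y j)) : ℂ) with hY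
  set Z : ZMod m → ℂ := fun n => ∑ h : ZMod m, Y h * kloos m (s * n) h with hZ
  have hmain := ZMod.count_fourier s y J W
  have hone : (m : ℂ) * (((Finset.range J).filter fun j => IsUnit (y j)).card : ℂ) = Z 0 := by
    have := ZMod.count_fourier s y J Finset.univ
    have h0 : ∀ n : ZMod m, ∑ r : ZMod m, (ZMod.stdAddChar (-(n * r)) : ℂ) =
        if n = 0 then (m : ℂ) else 0 := by
      intro n
      have := ZMod.sum_stdAddChar_mul (-n)
      simp_rw [neg_eq_zero] at this
      rw [← this]
      refine Finset.sum_congr rfl fun r _ => ?_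
      congr 1; ring
    simp_rw [h0, ite_mul, zero_mul] at this
    rw [Finset.sum_ite_eq' , if_pos (Finset.mem_univ _)] at this
    simp only [Finset.mem_univ, and_true] at this
    have hmc : (m : ℂ) ≠ 0 := by exact_mod_cast hm.ne'
    apply mul_left_cancel₀ hmc
    rw [hZ, ← this, ← mul_assoc, sq]
    rfl
  have hY1 : ∑ h : ZMod m, ‖Y h‖ ≤ l * (J + m * (1 + Real.log m)) := by
    refine le_trans (le_of_eq ?_) (ZMod.sum_norm_geom_le l hl J)
    refine Fintype.sum_equiv (Equiv.neg _) _ _ fun h => ?_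
    have : Y h = ZMod.stdAddChar (-(h * b)) *
        ∑ j ∈ Finset.range J, (ZMod.stdAddChar (-h * (l : ZMod m) * (j : ZMod m)) : ℂ) := by
      rw [hY, Finset.mul_sum]
      refine Finset.sum_congr rfl fun j _ => ?_
      rw [← AddChar.map_add_eq_mul]; congr 1; rw [hy]; ring
    rw [this, norm_mul, AddChar.norm_apply, one_mul]; rfl
  have hZn : ∀ n : ZMod m, ‖Z n‖ ≤ (Nat.gcd n.val m : ℝ) * (2 * (m : ℝ) ^ (3 / 4 : ℝ) *
      (m.divisors.card : ℝ) * (l * (J + m * (1 + Real.log m)))) := by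
    intro n
    have hgs : Nat.gcd (s * n).val m ≤ Nat.gcd n.val m := by
      refine (ZMod.gcd_val_mul_le s n).trans ?_
      have : Nat.gcd s.val m = 1 := by
        obtain ⟨u, rfl⟩ := hs
        exact ZMod.val_coe_unit_coprime u
      rw [this, one_mul]
    calc ‖Z n‖ ≤ ∑ h : ZMod m, ‖Y h‖ * (2 * (Nat.gcd n.val m : ℝ) * (m : ℝ) ^ (3 / 4 : ℝ) *
          (m.divisors.card : ℝ)) := by
          refine (norm_sum_le _ _).trans (Finset.sum_le_sum fun h _ => ?_)
          rw [norm_mul]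
          gcongr
          refine (kloos_norm_le _ _).trans ?_
          gcongr
      _ = (∑ h : ZMod m, ‖Y h‖) * (2 * (Nat.gcd n.val m : ℝ) * (m : ℝ) ^ (3 / 4 : ℝ) *
          (m.divisors.card : ℝ)) := by rw [Finset.sum_mul]
      _ ≤ (l * (J + m * (1 + Real.log m))) * (2 * (Nat.gcd n.val m : ℝ) * (m : ℝ) ^ (3 / 4 : ℝ) *
          (m.divisors.card : ℝ)) := by gcongr
      _ = _ := by ring
  set V : ℝ := 2 * (m : ℝ) ^ (3 / 4 : ℝ) *
      (m.divisors.card : ℝ) * (l * (J + m * (1 + Real.log m))) with hV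
  have hdiff : (m : ℂ) ^ 2 * ((((Finset.range J).filter fun j => ∃ t : (ZMod m)ˣ,
        (t : ZMod m) = y j ∧ s * ((t⁻¹ : (ZMod m)ˣ) : ZMod m) ∈ W).card : ℂ) -
      (W.card : ℂ) / m * (((Finset.range J).filter fun j : ℕ => IsUnit (y j)).card : ℂ)) =
      ∑ n ∈ (Finset.univ : Finset (ZMod m)).filter (· ≠ 0),
        (∑ r ∈ W, (ZMod.stdAddChar (-(n * r)) : ℂ)) * Z n := by
    rw [mul_sub, hmain]
    have hmc : (m : ℂ) ≠ 0 := by exact_mod_cast hm.ne'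
    have : (m : ℂ) ^ 2 * ((W.card : ℂ) / m *
        (((Finset.range J).filter fun j : ℕ => IsUnit (y j)).card : ℂ)) = W.card * Z 0 := by
      rw [← hone]; field_simp
    rw [this, Finset.filter_ne', ← Finset.sum_erase_add _ _ (Finset.mem_univ (0 : ZMod m))]
    simp [hZ, hY]
  have hbound : ‖∑ n ∈ (Finset.univ : Finset (ZMod m)).filter (· ≠ 0),
        (∑ r ∈ W, (ZMod.stdAddChar (-(n * r)) : ℂ)) * Z n‖ ≤
      m * (m.divisors.card * (1 + Real.log m)) * V := by
    calc _ ≤ ∑ n ∈ (Finset.univ : Finset (ZMod m)).filter (· ≠ 0),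
          (Nat.gcd n.val m : ℝ) * ((m : ℝ) / 2 * (1 / (n.val : ℝ) + 1 / ((m : ℝ) - n.val))) * V := by
          refine (norm_sum_le _ _).trans (Finset.sum_le_sum fun n hn => ?_)
          rw [norm_mul]
          calc _ ≤ ((m : ℝ) / 2 * (1 / (n.val : ℝ) + 1 / ((m : ℝ) - n.val))) *
                ((Nat.gcd n.val m : ℝ) * V) := by
                gcongr
                · exact (norm_nonneg _).trans (hW n (by simpa using hn))
                · exact hW n (by simpa using hn)
                · exact hZn n
            _ = _ := by ring
      _ = (m * ∑ k ∈ Finset.Ico 1 m, (Nat.gcd k m : ℝ) / k) * V := by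
          rw [← Finset.sum_mul]
          congr 1
          rw [ZMod.sum_ne_zero_eq (fun k => (Nat.gcd k m : ℝ) *
            ((m : ℝ) / 2 * (1 / (k : ℝ) + 1 / ((m : ℝ) - k))))]
          apply sum_Ico_symm (fun k => (Nat.gcd k m : ℝ))
          intro k hk
          rw [Finset.mem_Ico] at hk
          have : Nat.gcd (m - k) m = Nat.gcd k m := by
            rw [Nat.gcd_comm, Nat.gcd_self_sub_right hk.2.le, Nat.gcd_comm]
          simp only [this]
      _ ≤ _ := by gcongr; exact sum_Ico_gcd_div_le m (NeZero.ne m)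
  rw [← hdiff] at hbound
  have hn : ‖((((Finset.range J).filter fun j => ∃ t : (ZMod m)ˣ,
        (t : ZMod m) = y j ∧ s * ((t⁻¹ : (ZMod m)ˣ) : ZMod m) ∈ W).card : ℂ) -
      (W.card : ℂ) / m * (((Finset.range J).filter fun j : ℕ => IsUnit (y j)).card : ℂ))‖ =
      |(((Finset.range J).filter fun j => ∃ t : (ZMod m)ˣ,
        (t : ZMod m) = y j ∧ s * ((t⁻¹ : (ZMod m)ˣ) : ZMod m) ∈ W).card : ℝ) -
      (W.card : ℝ) / m * ((Finset.range J).filter fun j : ℕ => IsUnit (y j)).card| := by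
    rw [← Real.norm_eq_abs, ← Complex.norm_real]; push_cast; rfl
  rw [norm_mul, norm_pow, Complex.norm_natCast, hn] at hbound
  have hm2 : (0 : ℝ) < (m : ℝ) ^ 2 := by positivity
  refine le_of_mul_le_mul_left (hbound.trans (le_of_eq ?_)) hm2
  rw [hV]; field_simp

/-- The residues `r` modulo `m` with `fract (θ - r / m) < ζ` form an arc. -/
theorem ZMod.exists_arc (m : ℕ) [NeZero m] (θ ζ : ℝ) (h0 : 0 ≤ ζ) (h1 : ζ ≤ 1) :
    ∃ W : Finset (ZMod m), (∀ k : ℤ, (k : ZMod m) ∈ W ↔ Int.fract (θ - k / m) < ζ) ∧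
      |(W.card : ℝ) - ζ * m| ≤ 1 ∧
      ∀ n : ZMod m, n ≠ 0 → ‖∑ r ∈ W, (ZMod.stdAddChar (-(n * r)) : ℂ)‖ ≤
        (m : ℝ) / 2 * (1 / (n.val : ℝ) + 1 / ((m : ℝ) - n.val)) := by
  classical
  have hm : (0 : ℝ) < m := by exact_mod_cast NeZero.pos m
  set a₀ : ℤ := ⌊m * θ - m * ζ⌋ with ha₀
  set a₁ : ℤ := ⌊m * θ⌋ with ha₁
  have hle : a₀ ≤ a₁ := Int.floor_le_floor (by nlinarith)
  obtain ⟨w, hw⟩ := Int.eq_ofNat_of_zero_le (sub_nonneg.mpr hle)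
  have hinj : Set.InjOn (fun i : ℕ => ((a₀ + 1 + i : ℤ) : ZMod m)) (Finset.range w : Set ℕ) := by
    intro i hi j hj hij
    simp only [Finset.coe_range, Set.mem_Iio] at hi hj
    have hd : (m : ℤ) ∣ (i : ℤ) - j := by
      obtain ⟨e, he⟩ := (ZMod.intCast_eq_intCast_iff_dvd_sub _ _ _).mp hij
      exact ⟨-e, by linarith⟩
    have hlt : (w : ℝ) < m + 1 := by
      have e1 : (w : ℝ) = a₁ - a₀ := by exact_mod_cast hw.symm
      have e2 : (a₁ : ℝ) ≤ m * θ := Int.floor_le _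
      have e3 : m * θ - m * ζ < a₀ + 1 := Int.lt_floor_add_one _
      nlinarith
    have hlt' : w ≤ m := by
      have : w < m + 1 := by exact_mod_cast hlt
      omega
    have := Int.eq_zero_of_abs_lt_dvd hd (by rw [abs_lt]; omega)
    omega
  refine ⟨(Finset.range w).image fun i : ℕ => ((a₀ + 1 + i : ℤ) : ZMod m), ?_, ?_, ?_⟩
  · intro k
    simp only [Finset.mem_image, Finset.mem_range]
    constructor
    · rintro ⟨i, hi, hk⟩
      obtain ⟨e, he⟩ := (ZMod.intCast_eq_intCast_iff_dvd_sub _ _ _).mp hk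
      have hk' : (k : ℝ) = (a₀ + 1 + i : ℤ) + m * e := by
        have : k = (a₀ + 1 + i : ℤ) + m * e := by linarith
        exact_mod_cast this
      have e1 : ((a₀ + 1 + i : ℤ) : ℝ) ≤ m * θ := by
        have : a₀ + 1 + i ≤ a₁ := by omega
        exact (Int.cast_le.mpr this).trans (Int.floor_le _)
      have e2 : m * θ - m * ζ < ((a₀ + 1 + i : ℤ) : ℝ) := by
        have : (a₀ : ℝ) + 1 ≤ ((a₀ + 1 + i : ℤ) : ℝ) := by push_cast; linarith [(Nat.cast_nonneg i : (0:ℝ) ≤ i)]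
        exact (Int.lt_floor_add_one _).trans_le this
      set a : ℝ := ((a₀ + 1 + i : ℤ) : ℝ)
      have e3 : θ - k / m = (θ - a / m) - e := by rw [hk']; field_simp; ring
      rw [e3, Int.fract_sub_intCast]
      have e4 : a / m ≤ θ := by rw [div_le_iff₀ hm]; linarith
      have e5 : θ - ζ < a / m := by rw [lt_div_iff₀ hm]; linarith
      rw [Int.fract_eq_self.mpr ⟨by linarith, by linarith⟩]
      linarith
    · intro h
      set f : ℤ := ⌊θ - k / m⌋ with hf
      have e1 : ((k + m * f : ℤ) : ℝ) = m * θ - m * Int.fract (θ - k / m) := by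
        rw [Int.fract, ← hf]; push_cast; field_simp; ring
      have h2 := Int.fract_nonneg (θ - k / m)
      have e2 : k + m * f ≤ a₁ := by
        rw [ha₁, Int.le_floor, e1]; nlinarith
      have e3 : a₀ < k + m * f := by
        rw [ha₀, Int.floor_lt, e1]; nlinarith
      refine ⟨(k + m * f - a₀ - 1).toNat, by omega, ?_⟩
      rw [Int.toNat_of_nonneg (by omega)]
      push_cast; simp
  · rw [Finset.card_image_of_injOn hinj, Finset.card_range]
    have e1 : (w : ℝ) = a₁ - a₀ := by exact_mod_cast hw.symm
    have e2 : (a₁ : ℝ) ≤ m * θ := Int.floor_le _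
    have e3 : m * θ - m * ζ < a₀ + 1 := Int.lt_floor_add_one _
    have e4 : (a₀ : ℝ) ≤ m * θ - m * ζ := Int.floor_le _
    have e5 : m * θ < a₁ + 1 := Int.lt_floor_add_one _
    rw [abs_le]; constructor <;> linarith
  · intro n hn
    rw [Finset.sum_image hinj]
    have : ∀ i : ℕ, (ZMod.stdAddChar (-(n * ((a₀ + 1 + i : ℤ) : ZMod m))) : ℂ) =
        ZMod.stdAddChar (-(n * ((a₀ + 1 : ℤ) : ZMod m))) *
          ZMod.stdAddChar (-n * (i : ZMod m)) := by
      intro i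
      rw [← AddChar.map_add_eq_mul]; congr 1; push_cast; ring
    simp_rw [this]
    rw [← Finset.mul_sum, norm_mul, AddChar.norm_apply, one_mul]
    refine (ZMod.norm_geom_stdAddChar_le (neg_ne_zero.mpr hn) w).trans (le_of_eq ?_)
    have : NeZero n := ⟨hn⟩
    rw [ZMod.val_neg_of_ne_zero, Nat.cast_sub (ZMod.val_lt n).le]
    ring

theorem one_add_log_le_rpow {δ : ℝ} (hδ : 0 < δ) {x : ℝ} (hx : 1 ≤ x) :
    1 + Real.log x ≤ (1 + 1 / δ) * x ^ δ := by
  have h1 := Real.log_le_rpow_div (by linarith : 0 ≤ x) hδ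
  have h2 : 1 ≤ x ^ δ := Real.one_le_rpow hx hδ.le
  have : (1 + 1 / δ) * x ^ δ = x ^ δ + x ^ δ / δ := by ring
  linarith

theorem disc_progression {δ : ℝ} (hδ : 0 < δ) (l : ℕ) (hl : 0 < l) :
    ∃ C : ℝ, 1 ≤ C ∧ ∀ m : ℕ, 0 < m → ∀ σ : ℤ, IsUnit σ → ∀ ν : ℤ → ℤ,
      (∀ B : ℤ, Int.gcd B m = 1 → (m : ℤ) ∣ ν B * B - σ) → ∀ (b : ℤ) (J : ℕ) (θ ζ : ℝ),
      0 ≤ ζ → ζ ≤ 1 →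
      |(((Finset.range J).filter fun j : ℕ => Int.gcd (b + l * j) m = 1 ∧
          Int.fract (θ - ν (b + l * j) / m) < ζ).card : ℝ) -
        ζ * ((Finset.range J).filter fun j : ℕ => Int.gcd (b + l * j) m = 1).card| ≤
      C * (m : ℝ) ^ (3 / 4 + δ) * (1 + J / m) := by
  obtain ⟨C₁, hC₁, hd⟩ := card_divisors_le_rpow (δ := δ / 4) (by positivity)
  refine ⟨2 * l * C₁ ^ 2 * (1 + 1 / (δ / 4)) ^ 2 + 1, ?_, ?_⟩
  · have : 0 ≤ 2 * l * C₁ ^ 2 * (1 + 1 / (δ / 4)) ^ 2 := by positivity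
    linarith
  intro m hm0 σ hσ ν hν b J θ ζ h0 h1
  have : NeZero m := ⟨hm0.ne'⟩
  have hm : (0 : ℝ) < m := by exact_mod_cast hm0
  have hm1 : (1 : ℝ) ≤ m := by exact_mod_cast hm0
  obtain ⟨W, hW1, hW2, hW3⟩ := ZMod.exists_arc m θ ζ h0 h1
  have hσu : IsUnit ((σ : ℤ) : ZMod m) := hσ.map (Int.castRingHom (ZMod m))
  have hunit : ∀ j : ℕ, IsUnit (((b : ℤ) : ZMod m) + (l : ZMod m) * (j : ZMod m)) ↔
      Int.gcd (b + l * j) m = 1 := by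
    intro j
    rw [← Int.isCoprime_iff_gcd_eq_one, ← isCoprime_comm,
      ← ZMod.coe_int_isUnit_iff_isCoprime]
    push_cast; rfl
  have key := ZMod.disc_fourier l hl ((σ : ℤ) : ZMod m) hσu ((b : ℤ) : ZMod m) J W hW3
  have hset1 : ((Finset.range J).filter fun j : ℕ => ∃ t : (ZMod m)ˣ,
        (t : ZMod m) = ((b : ℤ) : ZMod m) + l * (j : ZMod m) ∧
          ((σ : ℤ) : ZMod m) * ((t⁻¹ : (ZMod m)ˣ) : ZMod m) ∈ W) =
      ((Finset.range J).filter fun j : ℕ => Int.gcd (b + l * j) m = 1 ∧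
          Int.fract (θ - ν (b + l * j) / m) < ζ) := by
    apply Finset.filter_congr
    intro j _
    rw [← hW1, ← hunit]
    have aux : ∀ t : (ZMod m)ˣ, (t : ZMod m) = ((b : ℤ) : ZMod m) + l * (j : ZMod m) →
        ((σ : ℤ) : ZMod m) * ((t⁻¹ : (ZMod m)ˣ) : ZMod m) = ((ν (b + l * j) : ℤ) : ZMod m) := by
      intro t ht
      have hg : Int.gcd (b + l * j) m = 1 := (hunit j).mp (ht ▸ t.isUnit)
      have := (ZMod.intCast_zmod_eq_zero_iff_dvd _ m).mpr (hν _ hg)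
      push_cast at this
      rw [← ht] at this
      rw [← sub_eq_zero.mp this, mul_assoc, Units.mul_inv, mul_one]
    constructor
    · rintro ⟨t, ht, htW⟩
      exact ⟨ht ▸ t.isUnit, aux t ht ▸ htW⟩
    · rintro ⟨⟨t, ht⟩, hW⟩
      exact ⟨t, ht, (aux t ht).symm ▸ hW⟩
  have hset2 : ((Finset.range J).filter fun j : ℕ =>
        IsUnit (((b : ℤ) : ZMod m) + l * (j : ZMod m))) =
      ((Finset.range J).filter fun j : ℕ => Int.gcd (b + l * j) m = 1) :=
    Finset.filter_congr fun j _ => hunit j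
  simp only [hset1, hset2] at key
  set N₁ : ℝ := (((Finset.range J).filter fun j : ℕ => Int.gcd (b + l * j) m = 1 ∧
          Int.fract (θ - ν (b + l * j) / m) < ζ).card : ℝ) with hN₁
  set N₂ : ℝ := (((Finset.range J).filter fun j : ℕ => Int.gcd (b + l * j) m = 1).card : ℝ) with hN₂
  have hN₂J : N₂ ≤ J := by
    rw [hN₂]; exact_mod_cast (Finset.card_filter_le _ _).trans (by simp)
  have hN₂0 : 0 ≤ N₂ := by positivity
  have h3 : |((W.card : ℝ) / m - ζ) * N₂| ≤ J / m := by
    rw [abs_mul, abs_of_nonneg hN₂0]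
    have : (W.card : ℝ) / m - ζ = ((W.card : ℝ) - ζ * m) / m := by field_simp
    rw [this, abs_div, abs_of_pos hm]
    calc _ ≤ 1 / (m : ℝ) * J := by gcongr
      _ = _ := by ring
  have hlog := one_add_log_le_rpow (δ := δ / 4) (by positivity) hm1
  have hlog0 : 0 ≤ Real.log m := Real.log_nonneg hm1
  have hdm := hd m hm0.ne'
  have hdiv0 : (0 : ℝ) ≤ m.divisors.card := by positivity
  have hJm : (0 : ℝ) ≤ J / m := by positivity
  have hpow : (m : ℝ) ^ (3 / 4 : ℝ) * ((m : ℝ) ^ (δ / 4)) ^ 4 = (m : ℝ) ^ (3 / 4 + δ) := by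
    rw [← Real.rpow_natCast, ← Real.rpow_mul hm.le, ← Real.rpow_add hm]; congr 1; push_cast; ring
  have hbig : 2 * l * (m : ℝ) ^ (3 / 4 : ℝ) * (m.divisors.card : ℝ) ^ 2 * (1 + Real.log m) *
      (J / m + (1 + Real.log m)) ≤
      2 * l * C₁ ^ 2 * (1 + 1 / (δ / 4)) ^ 2 * (m : ℝ) ^ (3 / 4 + δ) * (1 + J / m) := by
    calc _ ≤ 2 * l * (m : ℝ) ^ (3 / 4 : ℝ) * (m.divisors.card : ℝ) ^ 2 * (1 + Real.log m) *
          ((1 + Real.log m) * (1 + J / m)) := by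
          gcongr; nlinarith
      _ ≤ 2 * l * (m : ℝ) ^ (3 / 4 : ℝ) * (C₁ * (m : ℝ) ^ (δ / 4)) ^ 2 *
          ((1 + 1 / (δ / 4)) * (m : ℝ) ^ (δ / 4)) *
          (((1 + 1 / (δ / 4)) * (m : ℝ) ^ (δ / 4)) * (1 + J / m)) := by
          gcongr
      _ = 2 * l * C₁ ^ 2 * (1 + 1 / (δ / 4)) ^ 2 *
          ((m : ℝ) ^ (3 / 4 : ℝ) * ((m : ℝ) ^ (δ / 4)) ^ 4) * (1 + J / m) := by ring
      _ = _ := by rw [hpow]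
  have hsmall : (J : ℝ) / m ≤ 1 * (m : ℝ) ^ (3 / 4 + δ) * (1 + J / m) := by
    have : 1 ≤ (m : ℝ) ^ (3 / 4 + δ) := Real.one_le_rpow hm1 (by positivity)
    nlinarith
  have heq : N₁ - ζ * N₂ = (N₁ - (W.card : ℝ) / m * N₂) + ((W.card : ℝ) / m - ζ) * N₂ := by ring
  rw [heq]
  refine (abs_add_le _ _).trans ?_
  calc _ ≤ _ := add_le_add (key.trans hbig) (h3.trans hsmall)
    _ = _ := by ring

theorem Finset.exists_progression (S : Finset ℤ) (hS : (S : Set ℤ).OrdConnected) (l : ℕ)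
    (hl : 0 < l) (β : ℤ) :
    ∃ (b : ℤ) (J : ℕ), J ≤ S.card ∧ ∀ P : ℤ → Prop, ∀ _ : DecidablePred P,
      (S.filter fun B => (l : ℤ) ∣ B - β ∧ P B).card =
        ((Finset.range J).filter fun j : ℕ => P (b + l * j)).card := by
  rcases S.eq_empty_or_nonempty with rfl | hne
  · exact ⟨0, 0, by simp, by simp⟩
  set lo := S.min' hne
  set hi := S.max' hne
  have hlS : lo ∈ S := S.min'_mem hne
  have hhS : hi ∈ S := S.max'_mem hne
  have hmem : ∀ B, B ∈ S ↔ lo ≤ B ∧ B ≤ hi := fun B =>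
    ⟨fun h => ⟨S.min'_le B h, S.le_max' B h⟩, fun h => by
      simpa using hS.out hlS hhS ⟨h.1, h.2⟩⟩
  have hScard : S.card = (hi + 1 - lo).toNat := by
    have : S = Finset.Icc lo hi := by ext B; rw [hmem, Finset.mem_Icc]
    rw [this, Int.card_Icc]
  have hlohi : lo ≤ hi := S.min'_le _ hhS
  have hl' : (0 : ℤ) < l := by exact_mod_cast hl
  set b := lo + (β - lo) % l with hb
  have hr0 : 0 ≤ (β - lo) % l := Int.emod_nonneg _ hl'.ne'
  have hr1 : (β - lo) % l < l := Int.emod_lt_of_pos _ hl'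
  have hdb : (l : ℤ) ∣ b - β := by
    rw [hb, Int.emod_def]; exact ⟨-((β - lo) / l), by ring⟩
  have hbj : ∀ B, lo ≤ B → (l : ℤ) ∣ B - β → ∃ j : ℕ, B = b + l * j := by
    intro B h1 h2
    obtain ⟨e, he⟩ : (l : ℤ) ∣ B - b := by
      have := dvd_sub h2 hdb
      rwa [sub_sub_sub_cancel_right] at this
    have : 0 ≤ e := by
      by_contra hneg
      push Not at hneg
      have : (l : ℤ) * e ≤ -l := by nlinarith
      omega
    obtain ⟨j, rfl⟩ := Int.eq_ofNat_of_zero_le this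
    exact ⟨j, by linarith⟩
  set J := ((hi - b) / l + 1).toNat with hJ
  have hjJ : ∀ j : ℕ, j < J ↔ b + l * j ≤ hi := by
    intro j
    rw [hJ, Int.lt_toNat, Int.lt_add_one_iff, Int.le_ediv_iff_mul_le hl']
    constructor <;> intro h <;> linarith
  refine ⟨b, J, ?_, ?_⟩
  · rw [hScard, hJ]
    apply Int.toNat_le_toNat
    rcases le_or_gt 0 (hi - b) with h | h
    · have := Int.ediv_le_self (l : ℤ) h
      omega
    · have := Int.ediv_neg_of_neg_of_pos h hl'
      omega
  · intro P _
    symm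
    refine Finset.card_bij (fun j _ => b + l * (j : ℤ)) ?_ ?_ ?_
    · intro j hj
      rw [Finset.mem_filter, Finset.mem_range] at hj
      rw [Finset.mem_filter, hmem]
      refine ⟨⟨?_, (hjJ j).mp hj.1⟩, ?_, hj.2⟩
      · have : (0 : ℤ) ≤ l * j := by positivity
        omega
      · obtain ⟨e, he⟩ := hdb
        exact ⟨e + j, by linear_combination he⟩
    · intro i _ j _ h
      have h2 := mul_left_cancel₀ hl'.ne' (add_left_cancel h)
      exact_mod_cast h2
    · intro B hB
      rw [Finset.mem_filter, hmem] at hB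
      obtain ⟨j, rfl⟩ := hbj B hB.1.1 hB.2.1
      exact ⟨j, by rw [Finset.mem_filter, Finset.mem_range]; exact ⟨(hjJ j).mpr hB.1.2, hB.2.2⟩, rfl⟩

theorem disc_ordConnected {δ : ℝ} (hδ : 0 < δ) (l : ℕ) (hl : 0 < l) :
    ∃ C : ℝ, 1 ≤ C ∧ ∀ m : ℕ, 0 < m → ∀ σ : ℤ, IsUnit σ → ∀ ν : ℤ → ℤ,
      (∀ B : ℤ, Int.gcd B m = 1 → (m : ℤ) ∣ ν B * B - σ) → ∀ (S : Finset ℤ),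
      (S : Set ℤ).OrdConnected → ∀ (β : ℤ) (θ ζ : ℝ), 0 ≤ ζ → ζ ≤ 1 →
      |((S.filter fun B => (l : ℤ) ∣ B - β ∧ Int.gcd B m = 1 ∧
          Int.fract (θ - ν B / m) < ζ).card : ℝ) -
        ζ * (S.filter fun B => (l : ℤ) ∣ B - β ∧ Int.gcd B m = 1).card| ≤
      C * (m : ℝ) ^ (3 / 4 + δ) * (1 + S.card / m) := by
  obtain ⟨C, hC, h⟩ := disc_progression hδ l hl
  refine ⟨C, hC, ?_⟩
  intro m hm σ hσ ν hν S hS β θ ζ h0 h1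
  obtain ⟨b, J, hJ, hcard⟩ := S.exists_progression hS l hl β
  rw [hcard (fun B => Int.gcd B m = 1 ∧ Int.fract (θ - ν B / m) < ζ) _,
    hcard (fun B => Int.gcd B m = 1) _]
  refine (h m hm σ hσ ν hν b J θ ζ h0 h1).trans ?_
  gcongr

theorem fract_lt_of_le {y y' ζ t : ℝ} (h1 : y ≤ y') (h2 : y' ≤ y + t) (h : Int.fract y < ζ) :
    Int.fract y' < min (ζ + t) 1 := by
  rw [lt_min_iff]
  refine ⟨?_, Int.fract_lt_one _⟩
  have e1 := Int.fract_nonneg y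
  rcases lt_or_ge (Int.fract y + (y' - y)) 1 with h3 | h3
  · have : Int.fract y' = Int.fract y + (y' - y) := by
      rw [Int.fract_eq_iff]
      exact ⟨by linarith, h3, ⌊y⌋, by rw [Int.fract]; ring⟩
    rw [this]; linarith
  · linarith [Int.fract_lt_one y']

/-- Equidistribution with a slowly varying centre. -/
theorem disc_variable {δ : ℝ} (hδ : 0 < δ) (l : ℕ) (hl : 0 < l) :
    ∃ C : ℝ, 1 ≤ C ∧ ∀ m : ℕ, 0 < m → ∀ σ : ℤ, IsUnit σ → ∀ ν : ℤ → ℤ,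
      (∀ B : ℤ, Int.gcd B m = 1 → (m : ℤ) ∣ ν B * B - σ) → ∀ (S : Finset ℤ),
      (S : Set ℤ).OrdConnected → ∀ (β : ℤ) (ζ : ℝ), 0 ≤ ζ → ζ ≤ 1 →
      ∀ (ψ : ℤ → ℝ) (V T : ℝ), 0 < T → 0 ≤ V → (MonotoneOn ψ S ∨ AntitoneOn ψ S) →
      (∀ x ∈ S, ∀ y ∈ S, ψ x - ψ y ≤ V) →
      |((S.filter fun B => (l : ℤ) ∣ B - β ∧ Int.gcd B m = 1 ∧
          Int.fract (ψ B - ν B / m) < ζ).card : ℝ) -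
        ζ * (S.filter fun B => (l : ℤ) ∣ B - β ∧ Int.gcd B m = 1).card| ≤
      C * (m : ℝ) ^ (3 / 4 + δ) * (T * V + 2 + S.card / m) +
        1 / T * (S.filter fun B => (l : ℤ) ∣ B - β ∧ Int.gcd B m = 1).card := by
  classical
  obtain ⟨C, hC, h⟩ := disc_ordConnected hδ l hl
  refine ⟨C, hC, ?_⟩
  intro m hm σ hσ ν hν S hS β ζ h0 h1 ψ V T hT hV0 hmono hV
  rcases S.eq_empty_or_nonempty with rfl | hne
  · simp only [Finset.filter_empty, Finset.card_empty]
    have : 0 ≤ C := by linarith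
    simp only [Nat.cast_zero, mul_zero, sub_zero, abs_zero, zero_div, add_zero]
    positivity
  set κ : ℤ → ℤ := fun B => ⌊T * ψ B⌋ with hκ
  set 𝒦 := S.image κ with h𝒦
  set blk : ℤ → Finset ℤ := fun k => S.filter fun B => κ B = k with hblk
  have hblkconn : ∀ k, (blk k : Set ℤ).OrdConnected := by
    intro k
    refine ⟨fun x hx y hy z hz => ?_⟩
    simp only [hblk, Finset.coe_filter, Set.mem_ofPred_eq] at hx hy ⊢
    have hzS : z ∈ S := by simpa using hS.out hx.1 hy.1 hz
    refine ⟨hzS, ?_⟩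
    rcases hmono with hmono | hmono
    · have e1 := hmono hx.1 hzS hz.1
      have e2 := hmono hzS hy.1 hz.2
      have e3 : κ x ≤ κ z := Int.floor_le_floor (by gcongr)
      have e4 : κ z ≤ κ y := Int.floor_le_floor (by gcongr)
      omega
    · have e1 := hmono hx.1 hzS hz.1
      have e2 := hmono hzS hy.1 hz.2
      have e3 : κ z ≤ κ x := Int.floor_le_floor (by gcongr)
      have e4 : κ y ≤ κ z := Int.floor_le_floor (by gcongr)
      omega
  have hsum : ∀ (P : ℤ → Prop) [DecidablePred P], (((S.filter fun B => P B).card : ℕ) : ℝ) =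
      ∑ k ∈ 𝒦, (((blk k).filter fun B => P B).card : ℝ) := by
    intro P _
    have := Finset.card_eq_sum_card_fiberwise (f := κ) (s := S.filter fun B => P B) (t := 𝒦)
      (fun x hx => by
        simp only [Finset.coe_filter, Set.mem_ofPred_eq] at hx
        exact Finset.mem_coe.mpr (Finset.mem_image_of_mem κ hx.1))
    rw [this]; push_cast
    refine Finset.sum_congr rfl fun k _ => ?_
    rw [hblk, Finset.filter_filter, Finset.filter_filter]
    simp_rw [and_comm]
  have h𝒦card : (𝒦.card : ℝ) ≤ T * V + 2 := by
    have hne' : 𝒦.Nonempty := hne.image κ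
    obtain ⟨x, hx, hxe⟩ := Finset.mem_image.mp (𝒦.min'_mem hne')
    obtain ⟨y, hy, hye⟩ := Finset.mem_image.mp (𝒦.max'_mem hne')
    have hsub : 𝒦 ⊆ Finset.Icc (κ x) (κ y) := by
      intro k hk
      rw [Finset.mem_Icc, hxe, hye]
      exact ⟨𝒦.min'_le k hk, 𝒦.le_max' k hk⟩
    have hc := Finset.card_le_card hsub
    rw [Int.card_Icc] at hc
    have hxy : κ x ≤ κ y := by rw [hxe, hye]; exact 𝒦.min'_le _ (𝒦.max'_mem hne')
    have hc' : (𝒦.card : ℤ) ≤ κ y + 1 - κ x := by omega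
    have hc'' : (𝒦.card : ℝ) ≤ κ y + 1 - κ x := by exact_mod_cast hc'
    have e1 : (κ y : ℝ) ≤ T * ψ y := Int.floor_le _
    have e2 : T * ψ x < κ x + 1 := Int.lt_floor_add_one _
    have e3 := hV y hy x hx
    nlinarith
  have hblock : ∀ k ∈ 𝒦,
      |(((blk k).filter fun B => (l : ℤ) ∣ B - β ∧ Int.gcd B m = 1 ∧
          Int.fract (ψ B - ν B / m) < ζ).card : ℝ) -
        ζ * ((blk k).filter fun B => (l : ℤ) ∣ B - β ∧ Int.gcd B m = 1).card| ≤
      C * (m : ℝ) ^ (3 / 4 + δ) * (1 + (blk k).card / m) +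
        1 / T * ((blk k).filter fun B => (l : ℤ) ∣ B - β ∧ Int.gcd B m = 1).card := by
    intro k _
    have hT1 : 0 < 1 / T := by positivity
    have hψ : ∀ B ∈ blk k, (k : ℝ) / T ≤ ψ B ∧ ψ B ≤ k / T + 1 / T := by
      intro B hB
      have hk : κ B = k := (Finset.mem_filter.mp hB).2
      have e1 : (κ B : ℝ) ≤ T * ψ B := Int.floor_le _
      have e2 : T * ψ B < κ B + 1 := Int.lt_floor_add_one _
      rw [hk] at e1 e2
      rw [← add_div, div_le_iff₀ hT, le_div_iff₀ hT]
      constructor <;> linarith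
    set n₀ : ℝ := (((blk k).filter fun B => (l : ℤ) ∣ B - β ∧ Int.gcd B m = 1).card : ℝ) with hn₀
    have hn0 : 0 ≤ n₀ := by positivity
    have hup := h m hm σ hσ ν hν (blk k) (hblkconn k) β (k / T + 1 / T) (min (ζ + 1 / T) 1)
      (le_min (by linarith) zero_le_one) (min_le_right _ _)
    have hdn := h m hm σ hσ ν hν (blk k) (hblkconn k) β (k / T) (max (ζ - 1 / T) 0)
      (le_max_right _ _) (max_le (by linarith) zero_le_one)
    rw [← hn₀] at hup hdn
    have c1 : (((blk k).filter fun B => (l : ℤ) ∣ B - β ∧ Int.gcd B m = 1 ∧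
          Int.fract (ψ B - ν B / m) < ζ).card : ℝ) ≤
        ((blk k).filter fun B => (l : ℤ) ∣ B - β ∧ Int.gcd B m = 1 ∧
          Int.fract (k / T + 1 / T - ν B / m) < min (ζ + 1 / T) 1).card := by
      refine Nat.cast_le.mpr (Finset.card_le_card fun B hB => ?_)
      rw [Finset.mem_filter] at hB ⊢
      obtain ⟨hB, g1, g2, g3⟩ := hB
      have := hψ B hB
      exact ⟨hB, g1, g2, fract_lt_of_le (by linarith) (by linarith) g3⟩
    have c2 : (((blk k).filter fun B => (l : ℤ) ∣ B - β ∧ Int.gcd B m = 1 ∧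
          Int.fract (k / T - ν B / m) < max (ζ - 1 / T) 0).card : ℝ) ≤
        ((blk k).filter fun B => (l : ℤ) ∣ B - β ∧ Int.gcd B m = 1 ∧
          Int.fract (ψ B - ν B / m) < ζ).card := by
      refine Nat.cast_le.mpr (Finset.card_le_card fun B hB => ?_)
      rw [Finset.mem_filter] at hB ⊢
      obtain ⟨hB, g1, g2, g3⟩ := hB
      have := hψ B hB
      refine ⟨hB, g1, g2, ?_⟩
      rcases lt_max_iff.mp g3 with g3 | g3
      · have := fract_lt_of_le (y' := ψ B - ν B / m) (t := 1 / T) (by linarith) (by linarith) g3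
        exact (this.trans_le (min_le_left _ _)).trans_le (by linarith)
      · exact absurd (Int.fract_nonneg _) (not_le.mpr g3)
    have d1 : min (ζ + 1 / T) 1 * n₀ ≤ ζ * n₀ + 1 / T * n₀ := by
      rw [← add_mul]; gcongr; exact min_le_left _ _
    have d2 : ζ * n₀ - 1 / T * n₀ ≤ max (ζ - 1 / T) 0 * n₀ := by
      rw [← sub_mul]; gcongr; exact le_max_left _ _
    rw [abs_le] at hup hdn ⊢
    constructor <;> linarith [hup.1, hup.2, hdn.1, hdn.2]
  rw [hsum, hsum, Finset.mul_sum, ← Finset.sum_sub_distrib]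
  refine (Finset.abs_sum_le_sum_abs _ _).trans ((Finset.sum_le_sum hblock).trans ?_)
  rw [Finset.sum_add_distrib, ← Finset.mul_sum, ← Finset.mul_sum, Finset.sum_add_distrib,
    ← Finset.sum_div]
  have hScard : ∑ k ∈ 𝒦, ((blk k).card : ℝ) = S.card := by
    have := hsum (fun _ => True)
    simpa using this.symm
  rw [hScard]
  have : ∑ k ∈ 𝒦, (1 : ℝ) = 𝒦.card := by simp
  rw [this]
  gcongr

/-- The normalised position of the partner denominator of `a / q`. -/
noncomputable def zcoord (N : ℝ) (σ a q : ℤ) : ℝ :=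
  Int.fract ((N + σ * Int.gcdA a q) / q)

theorem Finset.card_le_one_add_of_sub_le (I : Finset ℤ) {D : ℝ} (hD : 0 ≤ D)
    (h : ∀ x ∈ I, ∀ y ∈ I, x ≤ y → (y : ℝ) - x ≤ D) : (I.card : ℝ) ≤ 1 + D := by
  rcases I.eq_empty_or_nonempty with rfl | hne
  · simp; linarith
  have h1 := h _ (I.min'_mem hne) _ (I.max'_mem hne) (I.min'_le_max' hne)
  have h2 : I ⊆ Finset.Icc (I.min' hne) (I.max' hne) := fun x hx =>
    Finset.mem_Icc.mpr ⟨I.min'_le x hx, I.le_max' x hx⟩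
  have h3 := Finset.card_le_card h2
  rw [Int.card_Icc] at h3
  have h4 : (I.card : ℤ) ≤ I.max' hne + 1 - I.min' hne := by
    have := I.min'_le_max' hne
    omega
  have h5 : (I.card : ℝ) ≤ I.max' hne + 1 - I.min' hne := by exact_mod_cast h4
  linarith

open Classical in
/-- The fractions `a / q ∈ J` (as pairs `(a, q)`) with `q ≤ Q` and `a ≡ q` modulo `l`. -/
noncomputable def fareyPts (l Q : ℕ) (J : Set ℝ) : Finset (ℤ × ℤ) :=
  (Finset.Icc (1 : ℤ) Q ×ˢ Finset.Icc (1 : ℤ) Q).filter fun p =>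
    (p.1 : ℝ) / p.2 ∈ J ∧ (l : ℤ) ∣ p.1 - p.2 ∧ Int.gcd p.1 p.2 = 1

theorem mem_fareyPts {l Q : ℕ} {J : Set ℝ} {p : ℤ × ℤ} :
    p ∈ fareyPts l Q J ↔ ((1 ≤ p.1 ∧ p.1 ≤ Q) ∧ 1 ≤ p.2 ∧ p.2 ≤ Q) ∧
      (p.1 : ℝ) / p.2 ∈ J ∧ (l : ℤ) ∣ p.1 - p.2 ∧ Int.gcd p.1 p.2 = 1 := by
  simp only [fareyPts, Finset.mem_filter, Finset.mem_product, Finset.mem_Icc]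

theorem slice_bound {δ : ℝ} (hδ : 0 < δ) (l : ℕ) (hl : 0 < l) :
    ∃ C : ℝ, 1 ≤ C ∧ ∀ (σ : ℤ), IsUnit σ → ∀ (s r u v : ℤ), s * v + r * u = 1 →
      ∀ (N : ℝ), 0 ≤ N → ∀ (J : Set ℝ), J.OrdConnected → J ⊆ Set.Ioc 0 1 →
      ∀ (w : ℝ), 0 ≤ w → (∀ x ∈ J, ∀ y ∈ J, x - y ≤ w) → ∀ (Q m : ℕ), 0 < m → ∀ T : ℝ, 0 < T →
      ∀ ζ : ℝ, 0 ≤ ζ → ζ ≤ 1 →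
      |(((fareyPts l Q J).filter fun p => s * p.1 - r * p.2 = m ∧ zcoord N σ p.1 p.2 < ζ).card : ℝ) -
        ζ * ((fareyPts l Q J).filter fun p => s * p.1 - r * p.2 = m).card| ≤
      C * (m : ℝ) ^ (3 / 4 + δ) *
        (T * ((N + |(s : ℝ)|) * |(s : ℝ)| * w / m) + 2 + (1 + Q / max 1 |(s : ℝ)|) / m) +
      1 / T * ((fareyPts l Q J).filter fun p => s * p.1 - r * p.2 = m).card := by
  classical
  obtain ⟨C, hC, hdisc⟩ := disc_variable hδ l hl
  refine ⟨l * C, ?_, ?_⟩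
  · have : (1 : ℝ) ≤ l := by exact_mod_cast hl
    nlinarith
  intro σ hσ s r u v huv N hN J hJ hJs w hw hJw Q m hm T hT ζ h0 h1
  have hm' : (0 : ℝ) < m := by exact_mod_cast hm
  have hmz : (0 : ℤ) < m := by exact_mod_cast hm
  set aa : ℤ → ℤ := fun B => v * m + r * B with haa
  set qq : ℤ → ℤ := fun B => s * B - u * m with hqq
  set I : Finset ℤ := ((Finset.Icc (1 : ℤ) Q ×ˢ Finset.Icc (1 : ℤ) Q).filter fun p =>
    (p.1 : ℝ) / p.2 ∈ J ∧ s * p.1 - r * p.2 = m).image (fun p => u * p.1 + v * p.2) with hI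
  have hmemI : ∀ B, B ∈ I ↔ (1 ≤ qq B ∧ qq B ≤ Q) ∧ ((aa B : ℤ) : ℝ) / (qq B : ℤ) ∈ J := by
    intro B
    simp only [hI, Finset.mem_image, Finset.mem_filter, Finset.mem_product, Finset.mem_Icc,
      Prod.exists]
    constructor
    · rintro ⟨a, q, ⟨⟨⟨ha1, ha2⟩, hq⟩, hmem, hA⟩, hB⟩
      have e1 : aa B = a := by
        simp only [haa]; rw [← hB, ← hA]; linear_combination a * huv
      have e2 : qq B = q := by
        simp only [hqq]; rw [← hB, ← hA]; linear_combination q * huv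
      rw [e1, e2]; exact ⟨hq, hmem⟩
    · rintro ⟨⟨hq1, hq2⟩, hmem⟩
      have hr := hJs hmem
      have hqpos : (0 : ℝ) < (qq B : ℤ) := by exact_mod_cast hq1
      have ha1 : (0 : ℝ) < (aa B : ℤ) := by
        have := hr.1
        rw [div_pos_iff_of_pos_right hqpos] at this; exact this
      have ha2 : ((aa B : ℤ) : ℝ) ≤ (qq B : ℤ) := by
        have := hr.2
        rwa [div_le_one hqpos] at this
      have ha1' : 0 < aa B := by exact_mod_cast ha1
      have ha2' : aa B ≤ qq B := by exact_mod_cast ha2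
      refine ⟨aa B, qq B, ⟨⟨⟨ha1', ha2'.trans hq2⟩, hq1, hq2⟩, hmem, ?_⟩, ?_⟩
      · simp only [haa, hqq]; linear_combination m * huv
      · simp only [haa, hqq]; linear_combination B * huv
  have hdet : ∀ B B', aa B * qq B' - aa B' * qq B = m * (B' - B) := by
    intro B B'; simp only [haa, hqq]; linear_combination m * (B' - B) * huv
  have hqpos : ∀ B ∈ I, (0 : ℝ) < (qq B : ℤ) := fun B hB => by
    have := ((hmemI B).mp hB).1.1
    exact_mod_cast this
  have hconn : (I : Set ℤ).OrdConnected := by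
    refine ⟨fun x hx y hy z hz => ?_⟩
    rw [Finset.mem_coe] at hx hy ⊢
    have hx0 := hqpos x hx
    have hy0 := hqpos y hy
    rw [hmemI] at hx hy ⊢
    have hqz : 1 ≤ qq z ∧ qq z ≤ Q := by
      simp only [hqq] at hx hy ⊢
      rcases le_total 0 s with hs | hs
      · have e1 : s * x ≤ s * z := mul_le_mul_of_nonneg_left hz.1 hs
        have e2 : s * z ≤ s * y := mul_le_mul_of_nonneg_left hz.2 hs
        constructor <;> linarith [hx.1.1, hy.1.2]
      · have e1 : s * z ≤ s * x := mul_le_mul_of_nonpos_left hz.1 hs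
        have e2 : s * y ≤ s * z := mul_le_mul_of_nonpos_left hz.2 hs
        constructor <;> linarith [hx.1.2, hy.1.1]
    have hz0 : (0 : ℝ) < (qq z : ℤ) := by exact_mod_cast hqz.1
    refine ⟨hqz, hJ.out hy.2 hx.2 ⟨?_, ?_⟩⟩
    · rw [div_le_div_iff₀ hy0 hz0]
      have h2 := hdet z y
      have h3 : (0 : ℤ) ≤ m * (y - z) := mul_nonneg hmz.le (sub_nonneg.mpr hz.2)
      have : aa y * qq z ≤ aa z * qq y := by linarith
      exact_mod_cast this
    · rw [div_le_div_iff₀ hz0 hx0]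
      have h2 := hdet x z
      have h3 : (0 : ℤ) ≤ m * (z - x) := mul_nonneg hmz.le (sub_nonneg.mpr hz.1)
      have : aa z * qq x ≤ aa x * qq z := by linarith
      exact_mod_cast this
  set c : ℝ := N + s * σ / m with hc
  set ψ : ℤ → ℝ := fun B => c / (qq B : ℤ) with hψ
  have hψsub : ∀ x ∈ I, ∀ y ∈ I, ψ x - ψ y = c * s * (y - x) / ((qq x : ℤ) * (qq y : ℤ)) := by
    intro x hx y hy
    have hx0 := (hqpos x hx).ne'
    have hy0 := (hqpos y hy).ne'
    simp only [hψ]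
    rw [div_sub_div _ _ hx0 hy0]
    congr 1
    simp only [hqq]; push_cast; ring
  have hmono : MonotoneOn ψ I ∨ AntitoneOn ψ I := by
    rcases le_total 0 (c * s) with hcs | hcs
    · right
      intro x hx y hy hxy
      have := hψsub x hx y hy
      have hxy' : (x : ℝ) ≤ y := by exact_mod_cast hxy
      have hp : 0 ≤ c * s * (y - x) / ((qq x : ℤ) * (qq y : ℤ)) :=
        div_nonneg (mul_nonneg hcs (by linarith)) (mul_pos (hqpos x hx) (hqpos y hy)).le
      linarith
    · left
      intro x hx y hy hxy
      have := hψsub x hx y hy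
      have hxy' : (x : ℝ) ≤ y := by exact_mod_cast hxy
      have hp : c * s * (y - x) / ((qq x : ℤ) * (qq y : ℤ)) ≤ 0 :=
        div_nonpos_of_nonpos_of_nonneg (mul_nonpos_of_nonpos_of_nonneg hcs (by linarith))
          (mul_pos (hqpos x hx) (hqpos y hy)).le
      linarith
  have hσabs : |(σ : ℝ)| = 1 := by
    rcases Int.isUnit_iff.mp hσ with h | h <;> simp [h]
  have hcabs : |c| ≤ N + |(s : ℝ)| := by
    rw [hc]
    refine (abs_add_le _ _).trans ?_
    rw [abs_of_nonneg hN, abs_div, abs_mul, hσabs, mul_one, abs_of_pos hm']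
    gcongr
    exact div_le_self (abs_nonneg _) (by exact_mod_cast hm)
  have hV : ∀ x ∈ I, ∀ y ∈ I, ψ x - ψ y ≤ (N + |(s : ℝ)|) * |(s : ℝ)| * w / m := by
    intro x hx y hy
    have hx0 := hqpos x hx
    have hy0 := hqpos y hy
    have hγ : ((y : ℝ) - x) / ((qq x : ℤ) * (qq y : ℤ)) =
        (((aa x : ℤ) : ℝ) / (qq x : ℤ) - ((aa y : ℤ) : ℝ) / (qq y : ℤ)) / m := by
      have := hdet x y
      have h2 : ((aa x : ℤ) : ℝ) * (qq y : ℤ) - (aa y : ℤ) * (qq x : ℤ) = m * (y - x) := by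
        exact_mod_cast this
      have hx1 := hx0.ne'
      have hy1 := hy0.ne'
      field_simp
      linarith
    rw [hψsub x hx y hy, mul_div_assoc, hγ]
    have hJ1 := hJw _ ((hmemI x).mp hx).2 _ ((hmemI y).mp hy).2
    have hJ2 := hJw _ ((hmemI y).mp hy).2 _ ((hmemI x).mp hx).2
    set d := ((aa x : ℤ) : ℝ) / (qq x : ℤ) - ((aa y : ℤ) : ℝ) / (qq y : ℤ)
    have hd : |d| ≤ w := by rw [abs_le]; constructor <;> linarith
    rw [← mul_div_assoc]
    refine div_le_div_of_nonneg_right ?_ hm'.le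
    calc c * s * d ≤ |c * s * d| := le_abs_self _
      _ = |c| * |(s : ℝ)| * |d| := by rw [abs_mul, abs_mul]
      _ ≤ _ := by gcongr
  have hcard : (I.card : ℝ) ≤ 1 + Q / max 1 |(s : ℝ)| := by
    refine Finset.card_le_one_add_of_sub_le I (by positivity) fun x hx y hy hxy => ?_
    have hxI := (hmemI x).mp hx
    have hyI := (hmemI y).mp hy
    have hxy' : (0 : ℝ) ≤ y - x := by
      have : (x : ℝ) ≤ y := by exact_mod_cast hxy
      linarith
    rw [le_div_iff₀ (by positivity)]
    rcases eq_or_ne s 0 with hs | hs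
    · have hr : |(r : ℝ)| = 1 := by
        have : IsUnit r := IsUnit.of_mul_eq_one u (by rw [hs] at huv; linarith)
        rcases Int.isUnit_iff.mp this with h | h <;> simp [h]
      have key : ∀ B ∈ I, (0 : ℝ) ≤ (aa B : ℤ) ∧ ((aa B : ℤ) : ℝ) ≤ Q := by
        intro B hB
        have hBI := (hmemI B).mp hB
        have h0 := hqpos B hB
        have h1 := hJs hBI.2
        have h2 := h1.1
        have h3 := h1.2
        rw [div_pos_iff_of_pos_right h0] at h2
        rw [div_le_one h0] at h3
        have h4 : ((qq B : ℤ) : ℝ) ≤ Q := by exact_mod_cast hBI.1.2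
        exact ⟨h2.le, h3.trans h4⟩
      have hx1 := key x hx
      have hy1 := key y hy
      have e : ((aa y : ℤ) : ℝ) - (aa x : ℤ) = r * (y - x) := by
        simp only [haa]; push_cast; ring
      have e2 : (y - x : ℝ) = |((aa y : ℤ) : ℝ) - (aa x : ℤ)| := by
        rw [e, abs_mul, hr, one_mul, abs_of_nonneg hxy']
      rw [hs]
      simp only [Int.cast_zero, abs_zero, zero_le_one, sup_of_le_left, mul_one]
      rw [e2, abs_le]
      constructor <;> linarith [hx1.1, hx1.2, hy1.1, hy1.2]
    · have hs1 : (1 : ℝ) ≤ |(s : ℝ)| := by exact_mod_cast Int.one_le_abs hs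
      rw [max_eq_right hs1]
      have e : ((qq y : ℤ) : ℝ) - (qq x : ℤ) = s * (y - x) := by
        simp only [hqq]; push_cast; ring
      have e2 : (y - x : ℝ) * |(s : ℝ)| = |((qq y : ℤ) : ℝ) - (qq x : ℤ)| := by
        rw [e, abs_mul, abs_of_nonneg hxy', mul_comm]
      have h1 : ((qq x : ℤ) : ℝ) ≤ Q := by exact_mod_cast hxI.1.2
      have h2 : ((qq y : ℤ) : ℝ) ≤ Q := by exact_mod_cast hyI.1.2
      rw [e2, abs_le]
      constructor <;> linarith [hqpos x hx, hqpos y hy]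
  set R := (Finset.range l).filter fun β : ℕ => (l : ℤ) ∣ (v + u) * m + (r - s) * β with hR
  have hcount : ∀ (P : ℤ → Prop) [DecidablePred P],
      ((((fareyPts l Q J).filter fun p => s * p.1 - r * p.2 = m ∧ P (u * p.1 + v * p.2)).card : ℕ) : ℝ) =
      ∑ β ∈ R, ((I.filter fun B => (l : ℤ) ∣ B - (β : ℤ) ∧ Int.gcd B m = 1 ∧ P B).card : ℝ) := by
    intro P _
    have hbij : ((fareyPts l Q J).filter fun p => s * p.1 - r * p.2 = m ∧
        P (u * p.1 + v * p.2)).card = (I.filter fun B => (l : ℤ) ∣ (v + u) * m + (r - s) * B ∧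
          Int.gcd B m = 1 ∧ P B).card := by
      refine Finset.card_nbij' (fun p => u * p.1 + v * p.2) (fun B => (aa B, qq B)) ?_ ?_ ?_ ?_
      · rintro ⟨a, q⟩ hp
        rw [Finset.mem_coe, Finset.mem_filter, mem_fareyPts] at hp
        obtain ⟨⟨⟨g1, g2⟩, hmem, hd, hg⟩, hA, hP⟩ := hp
        rw [Finset.mem_coe, Finset.mem_filter]
        refine ⟨?_, ?_, ?_, hP⟩
        · rw [hI, Finset.mem_image]
          exact ⟨(a, q), by simp only [Finset.mem_filter, Finset.mem_product, Finset.mem_Icc]; exact ⟨⟨g1, g2⟩, hmem, hA⟩, rfl⟩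
        · have : (v + u) * (m : ℤ) + (r - s) * (u * a + v * q) = a - q := by
            rw [← hA]; linear_combination (a - q) * huv
          simpa only [this] using hd
        · rw [← Int.isCoprime_iff_gcd_eq_one] at hg ⊢
          obtain ⟨x, y, hxy⟩ := hg
          refine ⟨x * r + y * s, x * v - y * u, ?_⟩
          simp only at hA ⊢
          rw [← hA, ← hxy]; linear_combination (x * a + y * q) * huv
      · intro B hB
        rw [Finset.mem_coe, Finset.mem_filter] at hB
        obtain ⟨hB, hd, hg, hP⟩ := hB
        have hBI := hB
        rw [hI, Finset.mem_image] at hB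
        obtain ⟨⟨a, q⟩, hp, hpB⟩ := hB
        rw [Finset.mem_filter, Finset.mem_product, Finset.mem_Icc, Finset.mem_Icc] at hp
        obtain ⟨g1, hmem, hA⟩ := hp
        simp only at hpB hA g1 hmem
        have e1 : aa B = a := by
          simp only [haa]; rw [← hpB, ← hA]; linear_combination a * huv
        have e2 : qq B = q := by
          simp only [hqq]; rw [← hpB, ← hA]; linear_combination q * huv
        rw [Finset.mem_coe, Finset.mem_filter, mem_fareyPts]
        simp only [e1, e2]
        refine ⟨⟨g1, hmem, ?_, ?_⟩, hA, ?_⟩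
        · have : (v + u) * (m : ℤ) + (r - s) * B = a - q := by
            rw [← e1, ← e2]; simp only [haa, hqq]; ring
          rwa [← this]
        · rw [← Int.isCoprime_iff_gcd_eq_one] at hg ⊢
          obtain ⟨x, y, hxy⟩ := hg
          refine ⟨x * u + y * s, x * v - y * r, ?_⟩
          rw [← hxy, ← hA, ← hpB]; ring
        · rw [hpB]; exact hP
      · rintro ⟨a, q⟩ hp
        rw [Finset.mem_coe, Finset.mem_filter] at hp
        have hA := hp.2.1
        simp only at hA
        simp only [haa, hqq, Prod.mk.injEq]
        rw [← hA]
        constructor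
        · linear_combination a * huv
        · linear_combination q * huv
      · intro B _
        simp only [haa, hqq]
        linear_combination B * huv
    rw [hbij]
    have hlz : (l : ℤ) ≠ 0 := by exact_mod_cast hl.ne'
    rw [Finset.card_eq_sum_card_fiberwise (f := fun B : ℤ => (B % l).toNat) (t := R)]
    · rw [Nat.cast_sum]
      refine Finset.sum_congr rfl fun β hβ => ?_
      congr 2
      rw [hR, Finset.mem_filter, Finset.mem_range] at hβ
      ext B
      simp only [Finset.mem_filter]
      have hB0 := Int.emod_nonneg B hlz
      have hBβ : (B % l).toNat = β ↔ (l : ℤ) ∣ B - β := by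
        constructor
        · intro h
          have : B % (l : ℤ) = β := by omega
          rw [← this]
          exact Int.dvd_self_sub_emod
        · intro h
          have h2 : (β : ℤ) % l = B % l := (Int.modEq_iff_dvd).mpr h
          rw [← h2, Int.emod_eq_of_lt (by positivity) (by exact_mod_cast hβ.1)]
          simp
      rw [hBβ]
      constructor
      · rintro ⟨⟨h1, h2, h3, h4⟩, h5⟩; exact ⟨h1, h5, h3, h4⟩
      · rintro ⟨h1, h5, h3, h4⟩
        refine ⟨⟨h1, ?_, h3, h4⟩, h5⟩
        obtain ⟨e, he⟩ := h5
        obtain ⟨f, hf⟩ := hβ.2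
        exact ⟨f + (r - s) * e, by linear_combination hf + (r - s) * he⟩
    · intro B hB
      rw [Finset.mem_coe, Finset.mem_filter] at hB
      have hB0 := Int.emod_nonneg B hlz
      have hB1 := Int.emod_lt_of_pos B (b := (l : ℤ)) (by exact_mod_cast hl)
      rw [Finset.mem_coe, hR, Finset.mem_filter, Finset.mem_range]
      refine ⟨by simp only; omega, ?_⟩
      simp only
      rw [Int.toNat_of_nonneg hB0]
      obtain ⟨f, hf⟩ := hB.2.1
      have := Int.emod_add_mul_ediv B l
      exact ⟨f - (r - s) * (B / l), by linear_combination hf + (r - s) * this⟩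
  set ν : ℤ → ℤ := fun B => s * (σ * Int.gcdB (aa B) (qq B)) + r * (σ * Int.gcdA (aa B) (qq B)) with hν
  have hνd : ∀ B : ℤ, Int.gcd B m = 1 → (m : ℤ) ∣ ν B * B - σ := by
    intro B hB
    have hg : Int.gcd (aa B) (qq B) = 1 := by
      rw [← Int.isCoprime_iff_gcd_eq_one] at hB ⊢
      obtain ⟨x, y, hxy⟩ := hB
      refine ⟨x * u + y * s, x * v - y * r, ?_⟩
      simp only [haa, hqq]
      linear_combination (x * B + y * m) * huv + hxy
    have hbz := Int.gcd_eq_gcd_ab (aa B) (qq B)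
    rw [hg] at hbz
    refine ⟨σ * (u * Int.gcdB (aa B) (qq B) - v * Int.gcdA (aa B) (qq B)), ?_⟩
    simp only [hν]
    set α := Int.gcdA (aa B) (qq B)
    set β := Int.gcdB (aa B) (qq B)
    simp only [haa, hqq] at hbz
    push_cast at hbz
    linear_combination -σ * hbz
  have hz : ∀ p ∈ fareyPts l Q J, s * p.1 - r * p.2 = m →
      (zcoord N σ p.1 p.2 < ζ ↔ Int.fract (ψ (u * p.1 + v * p.2) - ν (u * p.1 + v * p.2) / m) < ζ) := by
    rintro ⟨a, q⟩ hp hA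
    rw [mem_fareyPts] at hp
    obtain ⟨⟨_, hq1, _⟩, _, _, hg⟩ := hp
    simp only at hA hq1 hg ⊢
    have e1 : aa (u * a + v * q) = a := by
      simp only [haa]; rw [← hA]; linear_combination a * huv
    have e2 : qq (u * a + v * q) = q := by
      simp only [hqq]; rw [← hA]; linear_combination q * huv
    have hbz := Int.gcd_eq_gcd_ab a q
    rw [hg] at hbz
    have hq0 : (q : ℝ) ≠ 0 := by
      have : q ≠ 0 := by omega
      exact_mod_cast this
    have hm0 := hm'.ne'
    have : (N + σ * Int.gcdA a q) / q = ψ (u * a + v * q) - ν (u * a + v * q) / m := by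
      simp only [hψ, hν, e1, e2, hc]
      set α := Int.gcdA a q
      set β := Int.gcdB a q
      have hbz' : (1 : ℝ) = a * α + q * β := by exact_mod_cast hbz
      have hA' : (s : ℝ) * a - r * q = m := by exact_mod_cast hA
      push_cast
      field_simp
      linear_combination (σ : ℝ) * s * hbz' * (-1) - σ * α * hA'
    rw [zcoord, this]
  have hset : ((fareyPts l Q J).filter fun p => s * p.1 - r * p.2 = m ∧ zcoord N σ p.1 p.2 < ζ) =
      ((fareyPts l Q J).filter fun p => s * p.1 - r * p.2 = m ∧
        Int.fract (ψ (u * p.1 + v * p.2) - ν (u * p.1 + v * p.2) / m) < ζ) := by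
    apply Finset.filter_congr
    intro p hp
    constructor
    · rintro ⟨g1, g2⟩; exact ⟨g1, (hz p hp g1).mp g2⟩
    · rintro ⟨g1, g2⟩; exact ⟨g1, (hz p hp g1).mpr g2⟩
  have htrue := hcount (fun _ => True)
  simp only [and_true] at htrue
  rw [hset, hcount (fun B => Int.fract (ψ B - ν B / m) < ζ), htrue, Finset.mul_sum,
    ← Finset.sum_sub_distrib, Finset.mul_sum]
  refine (Finset.abs_sum_le_sum_abs _ _).trans ?_
  have hV0 : 0 ≤ (N + |(s : ℝ)|) * |(s : ℝ)| * w / m := by positivity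
  refine (Finset.sum_le_sum fun (β : ℕ) _ => hdisc m hm σ hσ ν hνd I hconn (β : ℤ) ζ h0 h1 ψ
    _ T hT hV0 hmono hV).trans ?_
  rw [Finset.sum_add_distrib]
  gcongr
  rw [Finset.sum_const, nsmul_eq_mul, mul_assoc (l : ℝ) C, mul_assoc (l : ℝ)]
  have hC0 : 0 ≤ C := by linarith
  have hRc : R.card ≤ l := (Finset.card_filter_le _ _).trans (by simp)
  gcongr

theorem sum_rpow_neg_quarter_le (M : ℕ) :
    ∑ m ∈ Finset.Icc 1 M, (m : ℝ) ^ (-(1 / 4) : ℝ) ≤ 4 / 3 * (M : ℝ) ^ (3 / 4 : ℝ) := by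
  induction M with
  | zero => simp
  | succ M ih =>
    rw [Finset.sum_Icc_succ_top (by omega)]
    have h0 : (0 : ℝ) < ((M + 1 : ℕ) : ℝ) := by positivity
    set y : ℝ := ((M + 1 : ℕ) : ℝ) with hy
    have hM : (M : ℝ) = y * (1 + -(1 / y)) := by
      rw [mul_add, mul_neg, mul_one_div_cancel h0.ne', hy]; push_cast; ring
    have hy1 : 1 / y ≤ 1 := by
      rw [div_le_one h0, hy]; push_cast; linarith [Nat.cast_nonneg (α := ℝ) M]
    have hb : (1 + -(1 / y)) ^ (3 / 4 : ℝ) ≤ 1 + 3 / 4 * -(1 / y) :=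
      rpow_one_add_le_one_add_mul_self (by linarith) (by norm_num) (by norm_num)
    have h1 : (M : ℝ) ^ (3 / 4 : ℝ) ≤ y ^ (3 / 4 : ℝ) * (1 + 3 / 4 * -(1 / y)) := by
      rw [hM, Real.mul_rpow h0.le (by linarith)]
      gcongr
    have h2 : y ^ (-(1 / 4) : ℝ) = y ^ (3 / 4 : ℝ) * (1 / y) := by
      rw [one_div y, ← Real.rpow_neg_one, ← Real.rpow_add h0]; norm_num
    rw [h2]
    linarith

theorem sum_rpow_mul_le {δ : ℝ} (hδ : 0 < δ) {x A B : ℝ} (hx : 0 ≤ x) (hA : 0 ≤ A) (hB : 0 ≤ B) :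
    ∑ m ∈ Finset.Icc 1 ⌊x⌋₊, (m : ℝ) ^ (3 / 4 + δ) * (A / m + 2 + B / m) ≤
      2 * x ^ δ * (x ^ (7 / 4 : ℝ) + x ^ (3 / 4 : ℝ) * (A + B)) := by
  have hterm : ∀ m ∈ Finset.Icc 1 ⌊x⌋₊, (m : ℝ) ^ (3 / 4 + δ) * (A / m + 2 + B / m) ≤
      x ^ δ * (2 * x ^ (3 / 4 : ℝ) + (A + B) * (m : ℝ) ^ (-(1 / 4) : ℝ)) := by
    intro m hm
    rw [Finset.mem_Icc] at hm
    have hm0 : (0 : ℝ) < m := by exact_mod_cast hm.1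
    have hmx : (m : ℝ) ≤ x := (Nat.le_floor_iff hx).mp hm.2
    have e1 : (m : ℝ) ^ (3 / 4 + δ) = (m : ℝ) ^ δ * (m : ℝ) ^ (3 / 4 : ℝ) := by
      rw [← Real.rpow_add hm0]; congr 1; ring
    have e2 : (m : ℝ) ^ (-(1 / 4) : ℝ) = (m : ℝ) ^ (3 / 4 : ℝ) * (1 / m) := by
      rw [one_div (m : ℝ), ← Real.rpow_neg_one, ← Real.rpow_add hm0]; norm_num
    rw [e1, mul_assoc]
    have e3 : (m : ℝ) ^ (3 / 4 : ℝ) * (A / m + 2 + B / m) =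
        2 * (m : ℝ) ^ (3 / 4 : ℝ) + (A + B) * (m : ℝ) ^ (-(1 / 4) : ℝ) := by
      rw [e2]; ring
    rw [e3]
    gcongr
  refine (Finset.sum_le_sum hterm).trans ?_
  rw [← Finset.mul_sum, Finset.sum_add_distrib, Finset.sum_const, nsmul_eq_mul,
    Nat.card_Icc, Nat.add_sub_cancel, ← Finset.mul_sum]
  have hfl : (⌊x⌋₊ : ℝ) ≤ x := Nat.floor_le hx
  have h1 : (⌊x⌋₊ : ℝ) * (2 * x ^ (3 / 4 : ℝ)) ≤ 2 * x ^ (7 / 4 : ℝ) := by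
    have : x ^ (7 / 4 : ℝ) = x * x ^ (3 / 4 : ℝ) := by
      rw [← Real.rpow_one_add' hx (by norm_num)]; norm_num
    rw [this]
    have : 0 ≤ x ^ (3 / 4 : ℝ) := by positivity
    nlinarith
  have h2 : ∑ m ∈ Finset.Icc 1 ⌊x⌋₊, (m : ℝ) ^ (-(1 / 4) : ℝ) ≤ 2 * x ^ (3 / 4 : ℝ) := by
    refine (sum_rpow_neg_quarter_le _).trans ?_
    gcongr
    norm_num
  have h3 : (A + B) * ∑ m ∈ Finset.Icc 1 ⌊x⌋₊, (m : ℝ) ^ (-(1 / 4) : ℝ) ≤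
      (A + B) * (2 * x ^ (3 / 4 : ℝ)) := by gcongr
  calc _ ≤ x ^ δ * (2 * x ^ (7 / 4 : ℝ) + (A + B) * (2 * x ^ (3 / 4 : ℝ))) := by gcongr
    _ = 2 * x ^ δ * (x ^ (7 / 4 : ℝ) + x ^ (3 / 4 : ℝ) * (A + B)) := by ring

theorem slice_zero_card_le {l Q : ℕ} {J : Set ℝ} {s r u v : ℤ} (huv : s * v + r * u = 1) :
    ((fareyPts l Q J).filter fun p => s * p.1 - r * p.2 = 0).card ≤ 1 := by
  rw [Finset.card_le_one]
  rintro ⟨a, q⟩ h ⟨a', q'⟩ h'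
  rw [Finset.mem_filter, mem_fareyPts] at h h'
  obtain ⟨⟨⟨⟨ha, _⟩, hq, _⟩, _, _, hg⟩, hA⟩ := h
  obtain ⟨⟨⟨⟨ha', _⟩, hq', _⟩, _, _, hg'⟩, hA'⟩ := h'
  simp only at *
  rw [← Int.isCoprime_iff_gcd_eq_one] at hg hg'
  have hcross : a * q' = a' * q := by
    have h1 : s * (a * q' - a' * q) = 0 := by linear_combination q' * hA - q * hA'
    have h2 : r * (a * q' - a' * q) = 0 := by linear_combination a' * hA - a * hA'
    have : (s * v + r * u) * (a * q' - a' * q) = 0 := by linear_combination v * h1 + u * h2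
    rw [huv, one_mul] at this
    linarith
  have e1 : a ∣ a' := hg.dvd_of_dvd_mul_right (Dvd.intro _ hcross)
  have e2 : a' ∣ a := hg'.dvd_of_dvd_mul_right (Dvd.intro _ hcross.symm)
  have e : a = a' := Int.dvd_antisymm (by omega) (by omega) e1 e2
  subst e
  have : q' = q := mul_left_cancel₀ (by omega) hcross
  rw [this]

theorem zcoord_disc {δ : ℝ} (hδ : 0 < δ) (l : ℕ) (hl : 0 < l) :
    ∃ C : ℝ, 1 ≤ C ∧ ∀ (σ : ℤ), IsUnit σ → ∀ (s r u v : ℤ), s * v + r * u = 1 →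
      ∀ (N : ℝ), 0 ≤ N → ∀ (J : Set ℝ), J.OrdConnected → J ⊆ Set.Ioc 0 1 →
      ∀ (w : ℝ), 0 ≤ w → (∀ x ∈ J, ∀ y ∈ J, x - y ≤ w) →
      ∀ D : ℝ, 0 ≤ D → (∀ x ∈ J, |s * x - r| ≤ D) → ∀ (Q : ℕ), ∀ T : ℝ, 0 < T →
      ∀ ζ : ℝ, 0 ≤ ζ → ζ ≤ 1 →
      |(((fareyPts l Q J).filter fun p => zcoord N σ p.1 p.2 < ζ).card : ℝ) -
        ζ * (fareyPts l Q J).card| ≤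
      C * (Q * D) ^ δ * ((Q * D) ^ (7 / 4 : ℝ) + (Q * D) ^ (3 / 4 : ℝ) *
        (T * ((N + |(s : ℝ)|) * |(s : ℝ)| * w) + (1 + Q / max 1 |(s : ℝ)|))) +
      1 + 1 / T * (fareyPts l Q J).card := by
  classical
  obtain ⟨C, hC, hsl⟩ := slice_bound hδ l hl
  refine ⟨4 * C, by linarith, ?_⟩
  intro σ hσ s r u v huv N hN J hJ hJs w hw hJw D hD hJD Q T hT ζ h0 h1
  set P := fareyPts l Q J with hP
  set f : ℤ × ℤ → ℕ := fun p => (s * p.1 - r * p.2).natAbs with hf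
  set x : ℝ := Q * D with hx
  have hx0 : 0 ≤ x := by positivity
  have hmaps : ∀ p ∈ P, f p ∈ Finset.range (⌊x⌋₊ + 1) := by
    rintro ⟨a, q⟩ hp
    rw [hP, mem_fareyPts] at hp
    obtain ⟨⟨_, hq1, hqQ⟩, hmem, _, _⟩ := hp
    simp only at hq1 hqQ hmem
    have hq0 : (0 : ℝ) < q := by exact_mod_cast hq1
    rw [Finset.mem_range, Nat.lt_succ_iff, Nat.le_floor_iff hx0]
    have e : ((f (a, q) : ℕ) : ℝ) = |(s : ℝ) * (a / q) - r| * q := by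
      simp only [hf]
      rw [Nat.cast_natAbs, Int.cast_abs]
      push_cast
      rw [← abs_of_pos hq0, ← abs_mul, abs_of_pos hq0]
      congr 1
      field_simp
    rw [e, hx, mul_comm]
    have := hJD _ hmem
    have hqQ' : (q : ℝ) ≤ Q := by exact_mod_cast hqQ
    gcongr
  have hfib : ∀ S : Finset (ℤ × ℤ), S ⊆ P →
      (S.card : ℝ) = ∑ m ∈ Finset.range (⌊x⌋₊ + 1), ((S.filter fun p => f p = m).card : ℝ) := by
    intro S hS
    rw [← Nat.cast_sum, Finset.card_eq_sum_card_fiberwise (f := f) (t := Finset.range (⌊x⌋₊ + 1))]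
    intro p hp
    exact hmaps p (hS hp)
  have hsplit : ∀ m : ℕ, 0 < m → ∀ (c : ℤ × ℤ → Prop) [DecidablePred c],
      (((P.filter c).filter fun p => f p = m).card : ℝ) =
        ((P.filter fun p => s * p.1 - r * p.2 = m ∧ c p).card : ℝ) +
        ((P.filter fun p => (-s) * p.1 - (-r) * p.2 = m ∧ c p).card : ℝ) := by
    intro m hm c _
    rw [← Nat.cast_add, ← Finset.card_union_of_disjoint]
    · congr 2
      ext p
      simp only [Finset.mem_filter, Finset.mem_union, hf]
      constructor
      · rintro ⟨⟨h1, h2⟩, h3⟩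
        rcases Int.natAbs_eq (s * p.1 - r * p.2) with h | h <;> rw [h3] at h
        · exact Or.inl ⟨h1, h, h2⟩
        · exact Or.inr ⟨h1, by linarith, h2⟩
      · rintro (⟨h1, h2, h3⟩ | ⟨h1, h2, h3⟩)
        · exact ⟨⟨h1, h3⟩, by omega⟩
        · refine ⟨⟨h1, h3⟩, ?_⟩
          have : s * p.1 - r * p.2 = -m := by linarith
          omega
    · rw [Finset.disjoint_left]
      intro p hp hp'
      rw [Finset.mem_filter] at hp hp'
      have := hp.2.1
      have := hp'.2.1
      have : (0 : ℤ) < m := by exact_mod_cast hm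
      linarith
  have hb : ∀ m ∈ Finset.range (⌊x⌋₊ + 1),
      |((((P.filter fun p => zcoord N σ p.1 p.2 < ζ).filter fun p => f p = m).card : ℕ) : ℝ) -
        ζ * ((P.filter fun p => f p = m).card : ℝ)| ≤
      (if m = 0 then 1 else 2 * (C * ((m : ℝ) ^ (3 / 4 + δ) *
        (T * ((N + |(s : ℝ)|) * |(s : ℝ)| * w) / m + 2 + (1 + Q / max 1 |(s : ℝ)|) / m)))) +
      1 / T * ((P.filter fun p => f p = m).card : ℝ) := by
    intro m _
    split_ifs with hm
    · subst hm
      have hz : ∀ p : ℤ × ℤ, f p = 0 ↔ s * p.1 - r * p.2 = 0 := fun p => by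
        simp only [hf, Int.natAbs_eq_zero]
      have h2 : ((P.filter fun p => f p = 0).card : ℝ) ≤ 1 := by
        simp only [hz]
        exact_mod_cast slice_zero_card_le huv
      have h3 : ((((P.filter fun p => zcoord N σ p.1 p.2 < ζ).filter fun p => f p = 0).card : ℕ) : ℝ)
          ≤ (P.filter fun p => f p = 0).card := by
        refine Nat.cast_le.mpr (Finset.card_le_card fun p hp => ?_)
        simp only [Finset.mem_filter] at hp ⊢
        exact ⟨hp.1.1, hp.2⟩
      have h4 : 0 ≤ ((((P.filter fun p => zcoord N σ p.1 p.2 < ζ).filter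
        fun p => f p = 0).card : ℕ) : ℝ) := by positivity
      set n := ((P.filter fun p => f p = 0).card : ℝ)
      have h5 : 0 ≤ n := by positivity
      have h6 : 0 ≤ 1 / T * n := by positivity
      have h7 : ζ * n ≤ n := by nlinarith
      have h8 : 0 ≤ ζ * n := by positivity
      rw [abs_le]
      constructor <;> linarith
    · have hm0 : 0 < m := Nat.pos_of_ne_zero hm
      have g1 := hsl σ hσ s r u v huv N hN J hJ hJs w hw hJw Q m hm0 T hT ζ h0 h1
      have g2 := hsl σ hσ (-s) (-r) (-u) (-v) (by linarith) N hN J hJ hJs w hw hJw Q m hm0 T hT ζ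
        h0 h1
      have e1 := hsplit m hm0 (fun p => zcoord N σ p.1 p.2 < ζ)
      have e2 := hsplit m hm0 (fun _ => True)
      simp only [Finset.filter_true, and_true] at e2
      rw [e1, e2]
      push_cast at g2
      simp only [abs_neg] at g2
      rw [← hP] at g1 g2
      have e3 : T * ((N + |(s : ℝ)|) * |(s : ℝ)| * w / m) =
        T * ((N + |(s : ℝ)|) * |(s : ℝ)| * w) / m := by ring
      rw [e3] at g1 g2
      rw [abs_le] at g1 g2 ⊢
      constructor
      · linarith [g1.1, g2.1]
      · linarith [g1.2, g2.2]
  rw [hfib _ (Finset.filter_subset _ P), hfib P subset_rfl, Finset.mul_sum, ← Finset.sum_sub_distrib]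
  refine (Finset.abs_sum_le_sum_abs _ _).trans ((Finset.sum_le_sum hb).trans ?_)
  rw [Finset.sum_add_distrib, ← Finset.mul_sum, ← hfib P subset_rfl]
  gcongr
  rw [Finset.sum_range_succ', if_pos rfl]
  gcongr
  have hre : ∀ g : ℕ → ℝ, ∑ i ∈ Finset.range ⌊x⌋₊, g (i + 1) = ∑ i ∈ Finset.Icc 1 ⌊x⌋₊, g i := by
    intro g
    rw [Finset.range_eq_Ico, Finset.sum_Ico_add' g 0 ⌊x⌋₊ 1]
    rfl
  have := sum_rpow_mul_le hδ hx0 (A := T * ((N + |(s : ℝ)|) * |(s : ℝ)| * w))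
    (B := 1 + Q / max 1 |(s : ℝ)|) (by positivity) (by positivity)
  simp only [Nat.succ_ne_zero, if_false, ← Finset.mul_sum]
  rw [hre fun m => (m : ℝ) ^ (3 / 4 + δ) *
        (T * ((N + |(s : ℝ)|) * |(s : ℝ)| * w) / m + 2 + (1 + Q / max 1 |(s : ℝ)|) / m)]
  have hC0 : 0 ≤ C := by linarith
  refine (mul_le_mul_of_nonneg_left (mul_le_mul_of_nonneg_left this hC0) zero_le_two).trans_eq ?_
  ring

theorem abs_sum_mul_le_of_monovary {a v : ℕ → ℝ} {E V : ℝ} {n : ℕ}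
    (hV : 0 ≤ V) (hA : ∀ k ≤ n, |∑ i ∈ Finset.range k, a i| ≤ E)
    (hv : ∀ i < n, 0 ≤ v i ∧ v i ≤ V) (hmono : MonotoneOn v (Set.Iio n) ∨ AntitoneOn v (Set.Iio n)) :
    ∀ k ≤ n, |∑ i ∈ Finset.range k, a i * v i| ≤ 2 * E * V := by
  intro k hk
  have hE : 0 ≤ E := (abs_nonneg _).trans (hA 0 (Nat.zero_le _))
  rcases Nat.eq_zero_or_pos k with rfl | hk0
  · simpa using mul_nonneg (mul_nonneg zero_le_two hE) hV
  have hV0 := hv (k - 1) (by omega)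
  have hsub : |∑ i ∈ Finset.range (k - 1), (v (i + 1) - v i) * ∑ j ∈ Finset.range (i + 1), a j| ≤
      E * V := by
    refine (Finset.abs_sum_le_sum_abs _ _).trans ?_
    have h1 : ∀ i ∈ Finset.range (k - 1), |(v (i + 1) - v i) * ∑ j ∈ Finset.range (i + 1), a j| ≤
        E * |v (i + 1) - v i| := by
      intro i hi
      rw [Finset.mem_range] at hi
      rw [abs_mul, mul_comm]
      exact mul_le_mul_of_nonneg_right (hA _ (by omega)) (abs_nonneg _)
    refine (Finset.sum_le_sum h1).trans ?_
    rw [← Finset.mul_sum]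
    refine mul_le_mul_of_nonneg_left ?_ hE
    have h00 := hv 0 (by omega)
    rcases hmono with hm | hm
    · rw [Finset.sum_congr rfl fun i hi => abs_of_nonneg (sub_nonneg.mpr (hm (a := i) (b := i + 1)
        (by rw [Finset.mem_range] at hi; simp only [Set.mem_Iio]; omega)
        (by rw [Finset.mem_range] at hi; simp only [Set.mem_Iio]; omega) (by omega))),
        Finset.sum_range_sub]
      linarith
    · rw [Finset.sum_congr rfl fun i hi => abs_of_nonpos (sub_nonpos.mpr (hm (a := i) (b := i + 1)
        (by rw [Finset.mem_range] at hi; simp only [Set.mem_Iio]; omega)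
        (by rw [Finset.mem_range] at hi; simp only [Set.mem_Iio]; omega) (by omega))),
        Finset.sum_neg_distrib, Finset.sum_range_sub]
      linarith
  have hparts := Finset.sum_range_by_parts v a k
  simp only [smul_eq_mul] at hparts
  simp only [mul_comm (a _)]
  rw [hparts]
  refine (abs_sub _ _).trans ?_
  have h2 : |v (k - 1) * ∑ i ∈ Finset.range k, a i| ≤ E * V := by
    rw [abs_mul, abs_of_nonneg hV0.1, mul_comm]
    exact mul_le_mul (hA k hk) hV0.2 hV0.1 hE
  linarith

theorem sub_integral_eq_layer {q N z : ℝ} (hq : 0 < q) (hN : q < N) (hz0 : 0 ≤ z) (hz1 : z ≤ 1) :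
    IntegrableOn (fun ζ => (ζ - (Set.Ioi z).indicator 1 ζ) * (1 / (N - q * ζ) ^ 2)) (Set.Ioc 0 1) ∧
    1 / (q * (N - q * z)) - ∫ ζ in (0 : ℝ)..1, 1 / (q * (N - q * ζ)) =
      ∫ ζ in Set.Ioc (0 : ℝ) 1, (ζ - (Set.Ioi z).indicator 1 ζ) * (1 / (N - q * ζ) ^ 2) := by
  have hpos : ∀ ζ ∈ Set.Icc (0 : ℝ) 1, 0 < N - q * ζ := by
    intro ζ hζ
    nlinarith [hζ.1, hζ.2]
  have hder : ∀ ζ ∈ Set.Icc (0 : ℝ) 1,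
      HasDerivAt (fun ζ => 1 / (q * (N - q * ζ))) (1 / (N - q * ζ) ^ 2) ζ := by
    intro ζ hζ
    have h1 := hpos ζ hζ
    have h2 : HasDerivAt (fun ζ => q * (N - q * ζ)) (q * (0 - q * 1)) ζ :=
      ((hasDerivAt_const ζ N).sub ((hasDerivAt_id ζ).const_mul q)).const_mul q
    have h3 := h2.inv (by positivity)
    have h4 : -(q * (0 - q * 1)) / (q * (N - q * ζ)) ^ 2 = 1 / (N - q * ζ) ^ 2 := by
      rw [div_eq_div_iff (by positivity) (by positivity)]
      ring
    rw [h4] at h3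
    refine h3.congr_of_eventuallyEq (Filter.Eventually.of_forall fun x => ?_)
    simp
  have hcont : ContinuousOn (fun ζ : ℝ => 1 / (N - q * ζ) ^ 2) (Set.Icc 0 1) := by
    refine ContinuousOn.div (by fun_prop) (by fun_prop) fun ζ hζ => ?_
    have := hpos ζ hζ
    positivity
  have hInt : IntegrableOn (fun ζ : ℝ => 1 / (N - q * ζ) ^ 2) (Set.Ioc 0 1) :=
    (hcont.integrableOn_Icc).mono_set Set.Ioc_subset_Icc_self
  have hInt1 : IntegrableOn (fun ζ : ℝ => ζ * (1 / (N - q * ζ) ^ 2)) (Set.Ioc 0 1) :=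
    ((continuousOn_id.mul hcont).integrableOn_Icc).mono_set Set.Ioc_subset_Icc_self
  have hInt2 : IntegrableOn ((Set.Ioi z).indicator fun ζ : ℝ => 1 / (N - q * ζ) ^ 2)
      (Set.Ioc 0 1) := hInt.indicator measurableSet_Ioi
  have hfun : (fun ζ => (ζ - (Set.Ioi z).indicator 1 ζ) * (1 / (N - q * ζ) ^ 2)) =
      fun ζ => ζ * (1 / (N - q * ζ) ^ 2) -
        (Set.Ioi z).indicator (fun ζ : ℝ => 1 / (N - q * ζ) ^ 2) ζ := by
    funext ζ
    by_cases h : ζ ∈ Set.Ioi z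
    · simp only [Set.indicator_of_mem h, Pi.one_apply]; ring
    · simp only [Set.indicator_of_notMem h]; ring
  rw [hfun]
  refine ⟨hInt1.sub hInt2, ?_⟩
  rw [integral_sub hInt1 hInt2, setIntegral_indicator measurableSet_Ioi]
  have hset : Set.Ioc (0 : ℝ) 1 ∩ Set.Ioi z = Set.Ioc z 1 := by
    ext ζ
    simp only [Set.mem_inter_iff, Set.mem_Ioc, Set.mem_Ioi]
    constructor
    · rintro ⟨⟨_, h1⟩, h2⟩; exact ⟨h2, h1⟩
    · rintro ⟨h1, h2⟩; exact ⟨⟨by linarith, h2⟩, h1⟩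
  rw [hset, ← intervalIntegral.integral_of_le hz1, ← intervalIntegral.integral_of_le zero_le_one]
  have hicc : Set.uIcc (0 : ℝ) 1 = Set.Icc 0 1 := Set.uIcc_of_le zero_le_one
  rw [intervalIntegral.integral_eq_sub_of_hasDerivAt (f := fun ζ => 1 / (q * (N - q * ζ)))
    (a := z) (b := 1)]
  · rw [intervalIntegral.integral_mul_deriv_eq_deriv_mul (u := fun ζ => ζ) (u' := fun _ => 1)
      (v := fun ζ => 1 / (q * (N - q * ζ))) (a := 0) (b := 1)]
    · simp only [one_mul, zero_mul, sub_zero]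
      ring
    · intro ζ _
      exact hasDerivAt_id ζ
    · intro ζ hζ
      rw [hicc] at hζ
      exact hder ζ hζ
    · exact intervalIntegrable_const
    · rw [intervalIntegrable_iff_integrableOn_Ioc_of_le zero_le_one]; exact hInt
  · intro ζ hζ
    rw [Set.uIcc_of_le hz1] at hζ
    exact hder ζ ⟨hz0.trans hζ.1, hζ.2⟩
  · rw [intervalIntegrable_iff_integrableOn_Ioc_of_le hz1]
    exact hInt.mono_set fun ζ hζ => ⟨hz0.trans_lt hζ.1, hζ.2⟩

/-- Equidistribution of `z` on `P`, uniform over the cut-offs `p.2 ≤ (k : ℤ)`, transfers to the sum of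
`(1 - ε q) / (q (N - q z))`. -/
theorem sum_sub_integral_le_of_disc {Q : ℕ} {ε N E : ℝ} (hε : 0 ≤ ε) (hεQ : ε * Q ≤ 1)
    (hN : (Q : ℝ) < N) (P : Finset (ℤ × ℤ)) (hP : ∀ p ∈ P, 1 ≤ p.2 ∧ p.2 ≤ Q) (z : ℤ × ℤ → ℝ)
    (hz : ∀ p ∈ P, 0 ≤ z p ∧ z p < 1)
    (hdisc : ∀ k : ℕ, k ≤ Q → ∀ ζ : ℝ, 0 ≤ ζ → ζ ≤ 1 →
      |(((P.filter fun p => p.2 ≤ (k : ℤ)).filter fun p => z p < ζ).card : ℝ) -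
        ζ * (P.filter fun p => p.2 ≤ (k : ℤ)).card| ≤ E) :
    |∑ p ∈ P, (1 - ε * p.2) / (p.2 * (N - p.2 * z p)) -
      ∑ p ∈ P, (1 - ε * p.2) * ∫ ζ in (0 : ℝ)..1, 1 / ((p.2 : ℝ) * (N - p.2 * ζ))| ≤
      4 * E / (N - Q) ^ 2 := by
  classical
  have hNQ : 0 < N - Q := by linarith
  have hlay : ∀ p ∈ P, IntegrableOn (fun ζ => (ζ - (Set.Ioi (z p)).indicator 1 ζ) *
      (1 / (N - p.2 * ζ) ^ 2)) (Set.Ioc 0 1) ∧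
    1 / ((p.2 : ℝ) * (N - p.2 * z p)) - ∫ ζ in (0 : ℝ)..1, 1 / ((p.2 : ℝ) * (N - p.2 * ζ)) =
      ∫ ζ in Set.Ioc (0 : ℝ) 1, (ζ - (Set.Ioi (z p)).indicator 1 ζ) *
        (1 / (N - p.2 * ζ) ^ 2) := by
    intro p hp
    have h1 := hP p hp
    have h2 := hz p hp
    have h3 : (0 : ℝ) < p.2 := by exact_mod_cast h1.1
    have h4 : (p.2 : ℝ) ≤ Q := by exact_mod_cast h1.2
    exact sub_integral_eq_layer h3 (by linarith) h2.1 h2.2.le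
  have hrepr : ∑ p ∈ P, (1 - ε * p.2) / (p.2 * (N - p.2 * z p)) -
      ∑ p ∈ P, (1 - ε * p.2) * ∫ ζ in (0 : ℝ)..1, 1 / ((p.2 : ℝ) * (N - p.2 * ζ)) =
      ∫ ζ in Set.Ioc (0 : ℝ) 1, ∑ p ∈ P, (1 - ε * p.2) *
        ((ζ - (Set.Ioi (z p)).indicator 1 ζ) * (1 / (N - p.2 * ζ) ^ 2)) := by
    rw [integral_finsetSum _ fun p hp => ((hlay p hp).1.const_mul _), ← Finset.sum_sub_distrib]
    refine Finset.sum_congr rfl fun p hp => ?_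
    rw [integral_const_mul, ← (hlay p hp).2]
    ring
  rw [hrepr, ← Real.norm_eq_abs]
  have hbound : ∀ ζ ∈ Set.Ioc (0 : ℝ) 1, ‖∑ p ∈ P, (1 - ε * p.2) *
        ((ζ - (Set.Ioi (z p)).indicator 1 ζ) * (1 / (N - p.2 * ζ) ^ 2))‖ ≤ 4 * E / (N - Q) ^ 2 := by
    intro ζ hζ
    set a : ℕ → ℝ := fun i => ∑ p ∈ P.filter (fun p => p.2 = (i : ℤ) + 1),
      (ζ - (Set.Ioi (z p)).indicator 1 ζ) with ha
    set V : ℕ → ℝ := fun i => 1 / (N - ((i : ℝ) + 1) * ζ) ^ 2 with hV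
    set U : ℕ → ℝ := fun i => 1 - ε * ((i : ℝ) + 1) with hU
    have hfib : ∀ (k : ℕ), ∀ F : ℤ × ℤ → ℝ, ∑ p ∈ P.filter (fun p => p.2 ≤ (k : ℤ)), F p =
        ∑ i ∈ Finset.range k, ∑ p ∈ P.filter (fun p => p.2 = (i : ℤ) + 1), F p := by
      intro k F
      rw [← Finset.sum_fiberwise_of_maps_to (g := fun p : ℤ × ℤ => (p.2 - 1).toNat)
        (t := Finset.range k)]
      · refine Finset.sum_congr rfl fun i hi => Finset.sum_congr ?_ fun _ _ => rfl
        ext p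
        simp only [Finset.mem_filter]
        rw [Finset.mem_range] at hi
        constructor
        · rintro ⟨⟨h1, h2⟩, h3⟩
          have := (hP p h1).1
          exact ⟨h1, by omega⟩
        · rintro ⟨h1, h2⟩
          exact ⟨⟨h1, by omega⟩, by omega⟩
      · intro p hp
        rw [Finset.mem_filter] at hp
        have := (hP p hp.1).1
        rw [Finset.mem_range]
        omega
    have hA : ∀ k ≤ Q, |∑ i ∈ Finset.range k, a i| ≤ E := by
      intro k hk
      have h1 := hdisc k hk ζ hζ.1.le hζ.2
      rw [← abs_neg] at h1
      convert h1 using 2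
      simp only [ha]
      rw [← hfib k fun p => (ζ - (Set.Ioi (z p)).indicator 1 ζ), Finset.sum_sub_distrib,
        Finset.sum_const, nsmul_eq_mul]
      have : ∑ p ∈ P.filter (fun p => p.2 ≤ (k : ℤ)), (Set.Ioi (z p)).indicator (1 : ℝ → ℝ) ζ =
          ((P.filter fun p => p.2 ≤ (k : ℤ)).filter fun p => z p < ζ).card := by
        rw [Finset.card_filter, Nat.cast_sum]
        refine Finset.sum_congr rfl fun p _ => ?_
        simp [Set.indicator_apply]
      rw [this]; ring
    have hden : ∀ i < Q, N - Q ≤ N - ((i : ℝ) + 1) * ζ := by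
      intro i hi
      have : ((i : ℝ) + 1) ≤ Q := by exact_mod_cast hi
      have h2 : ((i : ℝ) + 1) * ζ ≤ ((i : ℝ) + 1) * 1 :=
        mul_le_mul_of_nonneg_left hζ.2 (by positivity)
      linarith
    have hAV := abs_sum_mul_le_of_monovary (v := V) (V := 1 / (N - Q) ^ 2) (by positivity) hA
      (fun i hi => ⟨by simp only [hV]; positivity, by
        have := hden i hi
        simp only [hV]
        gcongr⟩)
      (Or.inl fun i hi j hj hij => by
        have h1 := hden j hj
        have h2 : (i : ℝ) ≤ j := by exact_mod_cast hij
        have h3 := hζ.1.le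
        simp only [hV]
        have : 0 < N - ((j : ℝ) + 1) * ζ := by linarith
        gcongr)
    have hAVU := abs_sum_mul_le_of_monovary (v := U) (V := 1) zero_le_one hAV
      (fun i hi => by
        have h1 : ((i : ℝ) + 1) ≤ Q := by exact_mod_cast hi
        have h2 : ε * ((i : ℝ) + 1) ≤ ε * Q := mul_le_mul_of_nonneg_left h1 hε
        simp only [hU]
        constructor
        · linarith
        · have : 0 ≤ ε * ((i : ℝ) + 1) := by positivity
          linarith)
      (Or.inr fun i hi j hj hij => by
        have h2 : (i : ℝ) ≤ j := by exact_mod_cast hij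
        simp only [hU]
        gcongr) Q le_rfl
    have hPQ : P = P.filter fun p => p.2 ≤ (Q : ℤ) := by
      rw [Finset.filter_true_of_mem]
      exact fun p hp => (hP p hp).2
    rw [hPQ, hfib Q, Real.norm_eq_abs]
    convert hAVU using 2
    · refine Finset.sum_congr rfl fun i _ => ?_
      simp only [ha]
      rw [Finset.sum_mul, Finset.sum_mul]
      refine Finset.sum_congr rfl fun p hp => ?_
      rw [Finset.mem_filter] at hp
      rw [hp.2]
      simp only [hU, hV]
      push_cast
      ring
    · ring
  have := norm_setIntegral_le_of_norm_le_const (μ := volume) (s := Set.Ioc (0 : ℝ) 1)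
    (by simp) hbound
  simpa using this

theorem abs_card_sub_volume_le_one {J : Set ℝ} (hJ : J.OrdConnected) (S : Finset ℤ)
    (hS : ∀ t : ℤ, t ∈ S ↔ (t : ℝ) ∈ J) : |(S.card : ℝ) - (volume J).toReal| ≤ 1 := by
  rcases S.eq_empty_or_nonempty with rfl | hne
  · have hno : ∀ t : ℤ, (t : ℝ) ∉ J := fun t ht => by simpa using (hS t).mpr ht
    rcases J.eq_empty_or_nonempty with rfl | ⟨t, ht⟩
    · simp
    have hsub : J ⊆ Set.Icc (⌊t⌋ : ℝ) (⌊t⌋ + 1) := by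
      intro y hy
      constructor
      · by_contra h
        push Not at h
        exact hno ⌊t⌋ (hJ.out hy ht ⟨h.le, Int.floor_le t⟩)
      · by_contra h
        push Not at h
        refine hno (⌊t⌋ + 1) (hJ.out ht hy ⟨?_, ?_⟩)
        · push_cast; exact (Int.lt_floor_add_one t).le
        · push_cast; exact h.le
    have hv : (volume J).toReal ≤ 1 := by
      have := measure_mono (μ := volume) hsub
      rw [Real.volume_Icc, add_sub_cancel_left, ENNReal.ofReal_one] at this
      exact ENNReal.toReal_le_of_le_ofReal zero_le_one (by simpa using this)
    have h0 : 0 ≤ (volume J).toReal := ENNReal.toReal_nonneg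
    rw [abs_le]
    simp only [Finset.card_empty, Nat.cast_zero]
    constructor <;> linarith
  · have hmin := (hS _).mp (S.min'_mem hne)
    have hmax := (hS _).mp (S.max'_mem hne)
    set a := S.min' hne with ha
    set b := S.max' hne with hb
    have hab : a ≤ b := S.min'_le_max' hne
    have hSI : S = Finset.Icc a b := by
      ext x
      rw [Finset.mem_Icc]
      constructor
      · intro hx
        exact ⟨S.min'_le x hx, S.le_max' x hx⟩
      · rintro ⟨h1, h2⟩
        rw [hS]
        exact hJ.out hmin hmax ⟨by exact_mod_cast h1, by exact_mod_cast h2⟩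
    have hcard : (S.card : ℝ) = b - a + 1 := by
      rw [hSI, Int.card_Icc]
      have : ((b + 1 - a).toNat : ℤ) = b + 1 - a := by omega
      have h2 : ((b + 1 - a).toNat : ℝ) = b + 1 - a := by exact_mod_cast this
      rw [h2]; ring
    have hab' : (a : ℝ) ≤ b := by exact_mod_cast hab
    have hsub1 : Set.Icc (a : ℝ) b ⊆ J := hJ.out hmin hmax
    have hsub2 : J ⊆ Set.Icc ((a : ℝ) - 1) (b + 1) := by
      intro y hy
      constructor
      · by_contra h
        push Not at h
        have h1 : ((a - 1 : ℤ) : ℝ) ∈ J := hJ.out hy hmin ⟨by push_cast; exact h.le, by push_cast; linarith⟩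
        have h2 := S.min'_le _ ((hS _).mpr h1)
        omega
      · by_contra h
        push Not at h
        have h1 : ((b + 1 : ℤ) : ℝ) ∈ J := hJ.out hmax hy ⟨by push_cast; linarith, by push_cast; exact h.le⟩
        have h2 := S.le_max' _ ((hS _).mpr h1)
        omega
    have hv2 := measure_mono (μ := volume) hsub2
    have hv1 := measure_mono (μ := volume) hsub1
    rw [Real.volume_Icc] at hv1 hv2
    have e2 : (volume J).toReal ≤ (b : ℝ) + 1 - (a - 1) :=
      ENNReal.toReal_le_of_le_ofReal (by linarith) hv2
    have e1 : (b : ℝ) - a ≤ (volume J).toReal := by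
      rw [← ENNReal.ofReal_le_iff_le_toReal (hv2.trans_lt ENNReal.ofReal_lt_top).ne]
      exact hv1
    rw [hcard, abs_le]
    constructor <;> linarith

theorem abs_card_progression_sub_le {J : Set ℝ} (hJ : J.OrdConnected) {q M : ℕ} (hq : 0 < q)
    (hM : 0 < M) (c : ℤ) (S : Finset ℤ)
    (hS : ∀ a : ℤ, a ∈ S ↔ (a : ℝ) / q ∈ J ∧ (M : ℤ) ∣ a - c) :
    |(S.card : ℝ) - q * (volume J).toReal / M| ≤ 1 := by
  have hq' : (0 : ℝ) < q := by exact_mod_cast hq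
  have hM' : (0 : ℝ) < M := by exact_mod_cast hM
  have hMz : (M : ℤ) ≠ 0 := by exact_mod_cast hM.ne'
  set J' : Set ℝ := (fun t => (M / q : ℝ) * t) ⁻¹' ((fun y => (c / q : ℝ) + y) ⁻¹' J) with hJ'
  have hord : J'.OrdConnected := by
    refine ⟨fun x hx y hy z hz => ?_⟩
    simp only [hJ', Set.mem_preimage] at hx hy ⊢
    refine hJ.out hx hy ⟨?_, ?_⟩
    · have := hz.1; gcongr
    · have := hz.2; gcongr
  have hinj : Set.InjOn (fun a => (a - c) / (M : ℤ)) (S : Set ℤ) := by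
    intro a ha b hb hab
    obtain ⟨x, hx⟩ := ((hS a).mp ha).2
    obtain ⟨y, hy⟩ := ((hS b).mp hb).2
    simp only at hab
    rw [hx, hy, Int.mul_ediv_cancel_left _ hMz, Int.mul_ediv_cancel_left _ hMz] at hab
    rw [hab] at hx
    linarith
  have hmem : ∀ t : ℤ, t ∈ S.image (fun a => (a - c) / (M : ℤ)) ↔ (t : ℝ) ∈ J' := by
    intro t
    have e : (c / q : ℝ) + M / q * t = ((c + M * t : ℤ) : ℝ) / q := by
      push_cast; field_simp
    rw [Finset.mem_image, hJ', Set.mem_preimage, Set.mem_preimage, e]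
    constructor
    · rintro ⟨a, ha, hat⟩
      obtain ⟨h1, x, hx⟩ := (hS a).mp ha
      rw [hx, Int.mul_ediv_cancel_left _ hMz] at hat
      have : a = c + M * t := by rw [← hat]; linarith
      rwa [← this]
    · intro h
      refine ⟨c + M * t, (hS _).mpr ⟨h, ?_⟩, ?_⟩
      · exact ⟨t, by ring⟩
      · rw [add_sub_cancel_left, Int.mul_ediv_cancel_left _ hMz]
  have hvol : (volume J').toReal = q * (volume J).toReal / M := by
    rw [hJ', Real.volume_preimage_mul_left (by positivity), measure_preimage_add,
      ENNReal.toReal_mul, ENNReal.toReal_ofReal (abs_nonneg _), abs_of_nonneg (by positivity)]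
    field_simp
  have := abs_card_sub_volume_le_one hord _ hmem
  rwa [Finset.card_image_of_injOn hinj, hvol] at this

theorem sum_divisors_moebius_eq_ite (n : ℕ) :
    ∑ d ∈ n.divisors, (ArithmeticFunction.moebius d : ℝ) = if n = 1 then 1 else 0 := by
  have h := congrArg (fun f : ArithmeticFunction ℤ => f n) ArithmeticFunction.coe_zeta_mul_moebius
  simp only [ArithmeticFunction.coe_zeta_mul_apply, ArithmeticFunction.one_apply] at h
  rw [← Int.cast_sum, h]
  split_ifs <;> simp

theorem totient_div_eq_sum {n : ℕ} (hn : 0 < n) :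
    (Nat.totient n : ℝ) = n * ∑ d ∈ n.divisors, (ArithmeticFunction.moebius d : ℝ) / d := by
  have h := (ArithmeticFunction.sum_eq_iff_sum_mul_moebius_eq (R := ℝ) (f := fun n => (Nat.totient n : ℝ))
    (g := fun n => (n : ℝ))).mp (fun n _ => by exact_mod_cast Nat.sum_totient n) n hn
  rw [← h, Nat.sum_divisorsAntidiagonal (f := fun a b => (ArithmeticFunction.moebius a : ℝ) * (b : ℝ)),
    Finset.mul_sum]
  refine Finset.sum_congr rfl fun d hd => ?_
  have hd' := Nat.dvd_of_mem_divisors hd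
  have hd0 : (d : ℝ) ≠ 0 := by
    have := Nat.pos_of_mem_divisors hd
    positivity
  rw [Nat.cast_div hd' hd0]
  ring

open Classical in
theorem card_fibre_sub_le {J : Set ℝ} (hJ : J.OrdConnected) (hJs : J ⊆ Set.Ioc 0 1)
    {l q : ℕ} (hl : 0 < l) (hq : 0 < q) :
    |(((Finset.Icc (1 : ℤ) q).filter fun a : ℤ => (a : ℝ) / q ∈ J ∧ (l : ℤ) ∣ a - q ∧
        Int.gcd a q = 1).card : ℝ) -
      (if Nat.Coprime q l then Nat.totient q * (volume J).toReal / l else 0)| ≤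
      q.divisors.card := by
  have hq' : (0 : ℝ) < q := by exact_mod_cast hq
  have hl' : (0 : ℝ) < l := by exact_mod_cast hl
  split_ifs with hcop
  · have hS : ∀ d ∈ q.divisors, |(((Finset.Icc (1 : ℤ) q).filter fun a : ℤ => (a : ℝ) / q ∈ J ∧
        (l : ℤ) ∣ a - q ∧ (d : ℤ) ∣ a).card : ℝ) - q * (volume J).toReal / ((d * l : ℕ) : ℝ)| ≤ 1 := by
      intro d hd
      have hdq := Nat.dvd_of_mem_divisors hd
      have hd0 := Nat.pos_of_mem_divisors hd
      have hdl : Nat.Coprime d l := Nat.Coprime.of_dvd_left hdq hcop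
      refine abs_card_progression_sub_le hJ hq (by positivity) (q : ℤ) _ fun a => ?_
      rw [Finset.mem_filter, Finset.mem_Icc]
      constructor
      · rintro ⟨_, h1, h2, h3⟩
        refine ⟨h1, ?_⟩
        push_cast
        refine IsCoprime.mul_dvd (by exact_mod_cast (Nat.isCoprime_iff_coprime.mpr hdl)) ?_ h2
        exact dvd_sub h3 (by exact_mod_cast hdq)
      · rintro ⟨h1, h2⟩
        push_cast at h2
        have h3 := hJs h1
        have h4 := h3.1
        have h5 := h3.2
        rw [div_pos_iff_of_pos_right hq'] at h4
        rw [div_le_one hq'] at h5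
        have h4' : 0 < a := by exact_mod_cast h4
        have h5' : a ≤ q := by exact_mod_cast h5
        refine ⟨⟨h4', h5'⟩, h1, (Dvd.intro_left _ rfl).trans h2, ?_⟩
        have h6 : (d : ℤ) ∣ a - q := (Dvd.intro _ rfl).trans h2
        have h7 : (d : ℤ) ∣ q := by exact_mod_cast hdq
        simpa using dvd_add h6 h7
    have hcount : (((Finset.Icc (1 : ℤ) q).filter fun a : ℤ => (a : ℝ) / q ∈ J ∧ (l : ℤ) ∣ a - q ∧
        Int.gcd a q = 1).card : ℝ) = ∑ d ∈ q.divisors, (ArithmeticFunction.moebius d : ℝ) *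
          (((Finset.Icc (1 : ℤ) q).filter fun a : ℤ => (a : ℝ) / q ∈ J ∧
        (l : ℤ) ∣ a - q ∧ (d : ℤ) ∣ a).card : ℝ) := by
      have h1 : ∀ a ∈ Finset.Icc (1 : ℤ) q, (if ((a : ℝ) / q ∈ J ∧ (l : ℤ) ∣ a - q ∧
          Int.gcd a q = 1) then (1 : ℝ) else 0) = ∑ d ∈ q.divisors,
            (ArithmeticFunction.moebius d : ℝ) * (if ((a : ℝ) / q ∈ J ∧
        (l : ℤ) ∣ a - q ∧ (d : ℤ) ∣ a) then (1 : ℝ) else 0) := by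
        intro a ha
        by_cases h : (a : ℝ) / q ∈ J ∧ (l : ℤ) ∣ a - q
        · simp only [h, true_and]
          have hg : Int.gcd a q ≠ 0 := by
            intro h0
            have := (Int.gcd_eq_zero_iff.mp h0).2
            exact hq.ne' (by exact_mod_cast this)
          rw [← sum_divisors_moebius_eq_ite]
          simp only [mul_ite, mul_one, mul_zero]
          rw [← Finset.sum_filter]
          refine Finset.sum_congr ?_ fun _ _ => rfl
          ext d
          simp only [Nat.mem_divisors, Finset.mem_filter]
          rw [Int.dvd_gcd_iff]
          constructor
          · rintro ⟨⟨g1, g2⟩, g3⟩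
            exact ⟨⟨by exact_mod_cast g2, hq.ne'⟩, g1⟩
          · rintro ⟨⟨g1, g2⟩, g3⟩
            exact ⟨⟨g3, by exact_mod_cast g1⟩, hg⟩
        · have e1 : ¬ ((a : ℝ) / q ∈ J ∧ (l : ℤ) ∣ a - q ∧ Int.gcd a q = 1) :=
            fun g => h ⟨g.1, g.2.1⟩
          have e2 : ∀ d : ℕ, ¬ ((a : ℝ) / q ∈ J ∧ (l : ℤ) ∣ a - q ∧ (d : ℤ) ∣ a) :=
            fun d g => h ⟨g.1, g.2.1⟩
          simp [e1, e2]
      rw [Finset.card_filter, Nat.cast_sum]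
      simp only [Nat.cast_ite, Nat.cast_one, Nat.cast_zero]
      rw [Finset.sum_congr rfl h1, Finset.sum_comm]
      refine Finset.sum_congr rfl fun d _ => ?_
      rw [← Finset.mul_sum, Finset.card_filter, Nat.cast_sum]
      simp
    rw [hcount, totient_div_eq_sum hq]
    have : (q : ℝ) * (∑ d ∈ q.divisors, (ArithmeticFunction.moebius d : ℝ) / d) *
        (volume J).toReal / l = ∑ d ∈ q.divisors, (ArithmeticFunction.moebius d : ℝ) *
          (q * (volume J).toReal / ((d * l : ℕ) : ℝ)) := by
      rw [Finset.mul_sum, Finset.sum_mul, Finset.sum_div]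
      refine Finset.sum_congr rfl fun d hd => ?_
      have hd0 : (d : ℝ) ≠ 0 := by
        have := Nat.pos_of_mem_divisors hd
        positivity
      push_cast
      field_simp
    rw [this, ← Finset.sum_sub_distrib]
    refine (Finset.abs_sum_le_sum_abs _ _).trans ?_
    rw [Finset.card_eq_sum_ones, Nat.cast_sum]
    refine Finset.sum_le_sum fun d hd => ?_
    rw [← mul_sub, abs_mul, Nat.cast_one]
    have hmu : |(ArithmeticFunction.moebius d : ℝ)| ≤ 1 := by
      exact_mod_cast ArithmeticFunction.abs_moebius_le_one (n := d)
    exact mul_le_one₀ hmu (abs_nonneg _) (hS d hd)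
  · have : ((Finset.Icc (1 : ℤ) q).filter fun a : ℤ => (a : ℝ) / q ∈ J ∧ (l : ℤ) ∣ a - q ∧
        Int.gcd a q = 1) = ∅ := by
      rw [Finset.filter_eq_empty_iff]
      rintro a _ ⟨_, h1, h2⟩
      apply hcop
      have hg1 : ((Nat.gcd q l : ℕ) : ℤ) ∣ q := by exact_mod_cast Nat.gcd_dvd_left q l
      have hg2 : ((Nat.gcd q l : ℕ) : ℤ) ∣ l := by exact_mod_cast Nat.gcd_dvd_right q l
      have hg3 : ((Nat.gcd q l : ℕ) : ℤ) ∣ a := by simpa using dvd_add (hg2.trans h1) hg1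
      have := Int.dvd_gcd_iff.mpr ⟨hg3, hg1⟩
      rw [h2] at this
      exact Nat.dvd_one.mp (by exact_mod_cast this)
    rw [this]
    simp

theorem AntitoneOn.intervalIntegrable_of_nonneg {g : ℝ → ℝ} (hg : AntitoneOn g (Set.Ici 0))
    {x y : ℝ} (hx : 0 ≤ x) (hy : 0 ≤ y) : IntervalIntegrable g volume x y := by
  refine AntitoneOn.intervalIntegrable (hg.mono fun t ht => ?_)
  rw [Set.mem_uIcc] at ht
  rw [Set.mem_Ici]
  rcases ht with h | h <;> linarith

theorem AntitoneOn.abs_sum_progression_sub_integral_le {g : ℝ → ℝ} {Q : ℝ} (hQ : 0 ≤ Q)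
    (hg : AntitoneOn g (Set.Ici 0)) (hg0 : ∀ x, 0 ≤ x → 0 ≤ g x) (hgQ : ∀ x, Q < x → g x = 0)
    {d l b T : ℕ} (hd : 0 < d) (hb : b < l) (hT : Q ≤ T) :
    |∑ t ∈ Finset.range T, g ((d : ℝ) * ((b : ℝ) + l * t)) - 1 / ((d : ℝ) * l) * ∫ x in (0 : ℝ)..Q, g x|
      ≤ g 0 := by
  have hl : (1 : ℝ) ≤ l := by exact_mod_cast (by omega : 1 ≤ l)
  have hd1 : (1 : ℝ) ≤ d := by exact_mod_cast hd
  have hb' : (b : ℝ) ≤ l := by exact_mod_cast hb.le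
  have hb0 : (0 : ℝ) ≤ b := Nat.cast_nonneg b
  have hT0 : (0 : ℝ) ≤ T := Nat.cast_nonneg T
  have hdl : 1 ≤ (d : ℝ) * l := by nlinarith
  set W : ℝ := d * l * T + d * b with hW
  have hWQ : Q ≤ W := by
    have : (T : ℝ) ≤ d * l * T := by nlinarith
    have : 0 ≤ (d : ℝ) * b := by positivity
    linarith
  have hdb : 0 ≤ (d : ℝ) * b := by positivity
  have hF : AntitoneOn (fun t : ℝ => g ((d : ℝ) * l * t + d * b)) (Set.Ici 0) := by
    intro s hs t ht hst
    rw [Set.mem_Ici] at hs ht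
    apply hg
    · rw [Set.mem_Ici]; positivity
    · rw [Set.mem_Ici]; positivity
    · have := mul_le_mul_of_nonneg_left hst (by positivity : 0 ≤ (d : ℝ) * l)
      linarith
  have h0 : ∫ t in (0 : ℝ)..T, g ((d : ℝ) * l * t + d * b)
      = 1 / ((d : ℝ) * l) * ((∫ x in (0 : ℝ)..Q, g x) - ∫ x in (0 : ℝ)..(d * b), g x) := by
    rw [intervalIntegral.integral_comp_mul_add _ (by positivity)]
    have h1 : ∫ x in Q..W, g x = 0 := by
      rw [intervalIntegral.integral_of_le hWQ]
      exact setIntegral_eq_zero_of_forall_eq_zero fun x hx => hgQ x hx.1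
    have h2 := intervalIntegral.integral_add_adjacent_intervals
      (hg.intervalIntegrable_of_nonneg le_rfl hQ) (hg.intervalIntegrable_of_nonneg hQ (hQ.trans hWQ))
    have h3 := intervalIntegral.integral_add_adjacent_intervals
      (hg.intervalIntegrable_of_nonneg le_rfl hdb) (hg.intervalIntegrable_of_nonneg hdb (hQ.trans hWQ))
    rw [mul_zero, zero_add, smul_eq_mul, one_div, ← hW]
    congr 1
    linarith
  have h4 : ∫ x in (0 : ℝ)..(d * b), g x ≤ d * b * g 0 := by
    have := intervalIntegral.integral_mono_on hdb (hg.intervalIntegrable_of_nonneg le_rfl hdb)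
      (intervalIntegrable_const (c := g 0)) fun x hx => hg (Set.mem_Ici.mpr le_rfl) hx.1 hx.1
    simpa using this
  have h5 : 0 ≤ ∫ x in (0 : ℝ)..(d * b), g x :=
    intervalIntegral.integral_nonneg hdb fun x hx => hg0 x hx.1
  have h6 := AntitoneOn.integral_le_sum (x₀ := 0) (a := T)
    (hF.mono (by rw [zero_add]; exact Set.Icc_subset_Ici_self))
  have h7 := AntitoneOn.sum_le_integral (x₀ := 0) (a := T)
    (hF.mono (by rw [zero_add]; exact Set.Icc_subset_Ici_self))
  simp only [zero_add] at h6 h7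
  rw [h0] at h6 h7
  have h8 : ∑ t ∈ Finset.range T, g ((d : ℝ) * ((b : ℝ) + l * t))
      = ∑ t ∈ Finset.range T, g ((d : ℝ) * l * t + d * b) :=
    Finset.sum_congr rfl fun t _ => by congr 1; ring
  have h9 : ∑ t ∈ Finset.range T, g ((d : ℝ) * l * t + d * b)
      ≤ g 0 + ∑ t ∈ Finset.range T, g ((d : ℝ) * l * ((t + 1 : ℕ) : ℝ) + d * b) := by
    have e1 := Finset.sum_range_succ (fun t : ℕ => g ((d : ℝ) * l * t + d * b)) T
    have e2 := Finset.sum_range_succ' (fun t : ℕ => g ((d : ℝ) * l * t + d * b)) T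
    have e3 : 0 ≤ g ((d : ℝ) * l * T + d * b) := hg0 _ (by positivity)
    have e4 : g ((d : ℝ) * l * ((0 : ℕ) : ℝ) + d * b) ≤ g 0 :=
      hg (Set.mem_Ici.mpr le_rfl) (Set.mem_Ici.mpr (by positivity)) (by positivity)
    linarith
  have h10 : 1 / ((d : ℝ) * l) * (∫ x in (0 : ℝ)..(d * b), g x) ≤ g 0 := by
    rw [one_div, inv_mul_le_iff₀ (by positivity)]
    refine h4.trans ?_
    exact mul_le_mul_of_nonneg_right (by nlinarith) (hg0 0 le_rfl)
  have h11 : 0 ≤ 1 / ((d : ℝ) * l) * (∫ x in (0 : ℝ)..(d * b), g x) := by positivity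
  rw [h8, abs_le]
  rw [mul_sub] at h6 h7
  constructor <;> linarith

theorem sum_range_mul_eq {M : Type*} [AddCommMonoid M] (f : ℕ → M) (l T : ℕ) :
    ∑ e ∈ Finset.range (l * T), f e = ∑ b ∈ Finset.range l, ∑ t ∈ Finset.range T, f (b + l * t) := by
  induction T with
  | zero => simp
  | succ T ih =>
    simp only [Finset.sum_range_succ, Finset.sum_add_distrib, Nat.mul_succ, Finset.sum_range_add, ih]
    congr 1
    exact Finset.sum_congr rfl fun b _ => by rw [add_comm]

theorem AntitoneOn.abs_sum_coprime_sub_integral_le {g : ℝ → ℝ} {Q : ℕ}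
    (hg : AntitoneOn g (Set.Ici 0)) (hg0 : ∀ x, 0 ≤ x → 0 ≤ g x) (hgQ : ∀ x, (Q : ℝ) < x → g x = 0)
    {d l : ℕ} (hd : 0 < d) (hl : 2 ≤ l) :
    |∑ e ∈ (Finset.Icc 1 Q).filter (fun e => e.Coprime l), g ((d : ℝ) * e)
      - (Nat.totient l : ℝ) / ((d : ℝ) * l) * ∫ x in (0 : ℝ)..Q, g x| ≤ l * g 0 := by
  have h1 : ∑ e ∈ (Finset.Icc 1 Q).filter (fun e => e.Coprime l), g ((d : ℝ) * e)
      = ∑ e ∈ Finset.range (l * (Q + 1)), if e.Coprime l then g ((d : ℝ) * e) else 0 := by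
    rw [← Finset.sum_filter]
    refine Finset.sum_subset ?_ ?_
    · intro e he
      rw [Finset.mem_filter, Finset.mem_Icc] at he
      rw [Finset.mem_filter, Finset.mem_range]
      exact ⟨by nlinarith [he.1.2], he.2⟩
    · intro e he hne
      rw [Finset.mem_filter, Finset.mem_range] at he
      rw [Finset.mem_filter, Finset.mem_Icc] at hne
      apply hgQ
      have he0 : e ≠ 0 := by
        rintro rfl
        have := he.2
        simp at this
        omega
      have : Q < e := by
        by_contra h
        exact hne ⟨⟨by omega, by omega⟩, he.2⟩
      have h2 : (Q : ℝ) < e := by exact_mod_cast this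
      have h3 : (1 : ℝ) ≤ d := by exact_mod_cast hd
      nlinarith [Nat.cast_nonneg (α := ℝ) e]
  have h2 : (Nat.totient l : ℝ) / ((d : ℝ) * l) * ∫ x in (0 : ℝ)..Q, g x
      = ∑ b ∈ Finset.range l, if b.Coprime l then 1 / ((d : ℝ) * l) * ∫ x in (0 : ℝ)..Q, g x else 0 := by
    rw [← Finset.sum_filter, Finset.sum_const, nsmul_eq_mul, Nat.totient]
    simp only [Nat.coprime_comm]
    ring
  rw [h1, h2, sum_range_mul_eq, ← Finset.sum_sub_distrib]
  refine (Finset.abs_sum_le_sum_abs _ _).trans ?_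
  have h3 : (l : ℝ) * g 0 = ∑ b ∈ Finset.range l, g 0 := by simp
  rw [h3]
  refine Finset.sum_le_sum fun b hb => ?_
  have hcop : ∀ t, Nat.Coprime (b + l * t) l ↔ b.Coprime l := fun t => by simp
  by_cases hbl : b.Coprime l
  · simp only [hcop, if_pos hbl]
    have := hg.abs_sum_progression_sub_integral_le (Nat.cast_nonneg Q) hg0 hgQ (T := Q + 1) hd
      (Finset.mem_range.mp hb) (by push_cast; linarith)
    push_cast
    exact this
  · simp only [hcop, if_neg hbl]
    simpa using hg0 0 le_rfl

noncomputable def coprimeMoebius (l d : ℕ) : ℝ :=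
  if d.Coprime l then (ArithmeticFunction.moebius d : ℝ) / (d : ℝ) ^ 2 else 0

theorem abs_moebius_le_one_real (d : ℕ) : |(ArithmeticFunction.moebius d : ℝ)| ≤ 1 := by
  exact_mod_cast ArithmeticFunction.abs_moebius_le_one (n := d)

theorem abs_coprimeMoebius_le (l d : ℕ) : |coprimeMoebius l d| ≤ ((d : ℝ) ^ 2)⁻¹ := by
  unfold coprimeMoebius
  split_ifs
  · rw [abs_div, abs_of_nonneg (by positivity : 0 ≤ (d : ℝ) ^ 2), div_eq_mul_inv]
    exact mul_le_of_le_one_left (by positivity) (abs_moebius_le_one_real d)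
  · simp

theorem coprimeMoebius_tsum_prime_pow (l : ℕ) {p : ℕ} (hp : p.Prime) :
    ∑' e, coprimeMoebius l (p ^ e) = if p ∣ l then 1 else 1 - 1 / (p : ℝ) ^ 2 := by
  rw [tsum_eq_sum (s := Finset.range 2)]
  · rw [Finset.sum_range_succ, Finset.sum_range_one]
    unfold coprimeMoebius
    simp only [pow_zero, pow_one, Nat.coprime_one_left_eq_true, if_true,
      ArithmeticFunction.moebius_apply_one, ArithmeticFunction.moebius_apply_prime hp,
      Nat.Prime.coprime_iff_not_dvd hp]
    split_ifs <;> simp <;> ring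
  · intro e he
    rw [Finset.mem_range, not_lt] at he
    unfold coprimeMoebius
    rw [ArithmeticFunction.moebius_apply_prime_pow hp (by omega)]
    rw [if_neg (by omega : ¬ e = 1)]
    simp

theorem tsum_coprimeMoebius (l : ℕ) :
    HasProd (fun p : {p : ℕ // p.Prime ∧ ¬ p ∣ l} => (1 - 1 / (p.1 : ℝ) ^ 2))
      (∑' d, coprimeMoebius l d) := by
  have hsum : Summable (fun d => ‖coprimeMoebius l d‖) := by
    refine Summable.of_nonneg_of_le (fun _ => norm_nonneg _) (fun d => abs_coprimeMoebius_le l d) ?_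
    exact Real.summable_nat_pow_inv.mpr one_lt_two
  have h := EulerProduct.eulerProduct_hasProd_mulIndicator (f := coprimeMoebius l)
    (by simp [coprimeMoebius]) ?_ hsum (by simp [coprimeMoebius])
  · have h2 := (hasProd_subtype_iff_mulIndicator (f := fun p : ℕ => (1 - 1 / (p : ℝ) ^ 2))
      (s := {p : ℕ | p.Prime ∧ ¬ p ∣ l}) (a := ∑' d, coprimeMoebius l d)).mpr ?_
    · exact h2
    · have he : Set.mulIndicator {p : ℕ | p.Prime ∧ ¬ p ∣ l} (fun p : ℕ => (1 - 1 / (p : ℝ) ^ 2))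
          = Set.mulIndicator {p | Nat.Prime p} (fun p => ∑' e, coprimeMoebius l (p ^ e)) := ?_
      · rw [he]; exact h
      funext p
      by_cases hp : p.Prime
      · rw [Set.mulIndicator_of_mem (s := {p : ℕ | p.Prime}) hp, coprimeMoebius_tsum_prime_pow l hp]
        by_cases hpl : p ∣ l
        · rw [Set.mulIndicator_of_notMem (fun h => h.2 hpl), if_pos hpl]
        · rw [Set.mulIndicator_of_mem (s := {p : ℕ | p.Prime ∧ ¬ p ∣ l}) ⟨hp, hpl⟩, if_neg hpl]
      · rw [Set.mulIndicator_of_notMem (s := {p : ℕ | p.Prime}) hp,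
          Set.mulIndicator_of_notMem (fun h => hp h.1)]
  · intro m n hmn
    unfold coprimeMoebius
    simp only [Nat.coprime_mul_iff_left, Nat.cast_mul]
    rw [ArithmeticFunction.isMultiplicative_moebius.map_mul_of_coprime hmn]
    by_cases h1 : m.Coprime l
    · by_cases h2 : n.Coprime l
      · rw [if_pos ⟨h1, h2⟩, if_pos h1, if_pos h2]
        push_cast
        ring
      · rw [if_neg (fun h => h2 h.2), if_neg h2, mul_zero]
    · rw [if_neg (fun h => h1 h.1), if_neg h1, zero_mul]

theorem Cconst_eq (l : ℕ) :
    Cconst l = (Nat.totient l : ℝ) / l * ∑' d, coprimeMoebius l d := by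
  rw [Cconst, (tsum_coprimeMoebius l).tprod_eq]

theorem abs_sum_coprimeMoebius_sub_tsum_le (l : ℕ) {Q : ℕ} (hQ : 0 < Q) :
    |∑ d ∈ (Finset.Icc 1 Q).filter (fun d => d.Coprime l),
        (ArithmeticFunction.moebius d : ℝ) / (d : ℝ) ^ 2 - ∑' d, coprimeMoebius l d| ≤ 1 / Q := by
  have hsum : Summable (coprimeMoebius l) := by
    refine Summable.of_norm_bounded (g := fun d : ℕ => ((d : ℝ) ^ 2)⁻¹)
      (Real.summable_nat_pow_inv.mpr one_lt_two) (fun d => abs_coprimeMoebius_le l d)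
  have h1 : ∑ d ∈ (Finset.Icc 1 Q).filter (fun d => d.Coprime l),
      (ArithmeticFunction.moebius d : ℝ) / (d : ℝ) ^ 2
      = ∑ d ∈ Finset.range (Q + 1), coprimeMoebius l d := by
    rw [Finset.sum_filter]
    change ∑ d ∈ Finset.Icc 1 Q, coprimeMoebius l d = _
    refine Finset.sum_subset (fun d hd => ?_) (fun d hd hne => ?_)
    · rw [Finset.mem_Icc] at hd; rw [Finset.mem_range]; omega
    · rw [Finset.mem_range] at hd; rw [Finset.mem_Icc] at hne
      have : d = 0 := by omega
      subst this
      simp [coprimeMoebius]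
  rw [h1, abs_sub_comm]
  have ht : Tendsto (fun n => |∑ d ∈ Finset.range n, coprimeMoebius l d
      - ∑ d ∈ Finset.range (Q + 1), coprimeMoebius l d|) atTop
      (nhds |∑' d, coprimeMoebius l d - ∑ d ∈ Finset.range (Q + 1), coprimeMoebius l d|) :=
    ((hsum.hasSum.tendsto_sum_nat).sub_const _).abs
  refine le_of_tendsto ht ?_
  filter_upwards [eventually_ge_atTop (Q + 1)] with n hn
  obtain ⟨k, rfl⟩ : ∃ k, n = k + 1 := ⟨n - 1, by omega⟩
  have h2 : ∑ d ∈ Finset.range (k + 1), coprimeMoebius l d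
      - ∑ d ∈ Finset.range (Q + 1), coprimeMoebius l d = ∑ d ∈ Finset.Ioc Q k, coprimeMoebius l d := by
    rw [← Finset.sum_Ico_eq_sub _ hn]
    refine Finset.sum_congr ?_ fun _ _ => rfl
    ext x
    rw [Finset.mem_Ico, Finset.mem_Ioc]
    omega
  rw [h2]
  refine (Finset.abs_sum_le_sum_abs _ _).trans ?_
  refine (Finset.sum_le_sum fun d _ => abs_coprimeMoebius_le l d).trans ?_
  refine (sum_Ioc_inv_sq_le_sub (α := ℝ) hQ.ne' (by omega)).trans ?_
  rw [one_div]
  have : (0 : ℝ) ≤ (k : ℝ)⁻¹ := by positivity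
  linarith

theorem sum_totient_div_mul_eq {l Q : ℕ} {g : ℝ → ℝ} (hgQ : ∀ x, (Q : ℝ) < x → g x = 0) :
    ∑ q ∈ (Finset.Icc 1 Q).filter (fun q => q.Coprime l), (Nat.totient q : ℝ) / q * g q
      = ∑ d ∈ (Finset.Icc 1 Q).filter (fun q => q.Coprime l), (ArithmeticFunction.moebius d : ℝ) / d *
          ∑ e ∈ (Finset.Icc 1 Q).filter (fun q => q.Coprime l), g ((d : ℝ) * e) := by
  set A := (Finset.Icc 1 Q).filter (fun q => q.Coprime l) with hA
  have hmem : ∀ q, q ∈ A ↔ (1 ≤ q ∧ q ≤ Q) ∧ q.Coprime l := fun q => by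
    rw [hA, Finset.mem_filter, Finset.mem_Icc]
  have h1 : ∀ q ∈ A, (Nat.totient q : ℝ) / q * g q
      = ∑ d ∈ A, if d ∣ q then (ArithmeticFunction.moebius d : ℝ) / d * g q else 0 := by
    intro q hq
    rw [hmem] at hq
    have hq0 : (q : ℝ) ≠ 0 := by have := hq.1.1; positivity
    rw [totient_div_eq_sum (by omega), mul_div_cancel_left₀ _ hq0, Finset.sum_mul, ← Finset.sum_filter]
    refine Finset.sum_congr ?_ fun _ _ => rfl
    ext d
    rw [Finset.mem_filter, hmem, Nat.mem_divisors]
    constructor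
    · rintro ⟨h, _⟩
      exact ⟨⟨⟨Nat.pos_of_dvd_of_pos h (by omega), (Nat.le_of_dvd (by omega) h).trans hq.1.2⟩,
        Nat.Coprime.coprime_dvd_left h hq.2⟩, h⟩
    · rintro ⟨_, h⟩
      exact ⟨h, by omega⟩
  rw [Finset.sum_congr rfl h1, Finset.sum_comm]
  refine Finset.sum_congr rfl fun d hd => ?_
  rw [hmem] at hd
  rw [← Finset.sum_filter, ← Finset.mul_sum]
  congr 1
  have h2 : ∑ e ∈ A, g ((d : ℝ) * e) = ∑ e ∈ A.filter (fun e => d * e ≤ Q), g ((d : ℝ) * e) := by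
    symm
    refine Finset.sum_subset (Finset.filter_subset _ _) fun e he hne => ?_
    rw [Finset.mem_filter, not_and, not_le] at hne
    exact hgQ _ (by exact_mod_cast hne he)
  rw [h2]
  refine Finset.sum_nbij' (fun q => q / d) (fun e => d * e) ?_ ?_ ?_ ?_ ?_
  · intro q hq
    rw [Finset.mem_filter, hmem] at hq
    obtain ⟨e, rfl⟩ := hq.2
    have hde : d * e / d = e := Nat.mul_div_cancel_left e (by omega)
    rw [hde, Finset.mem_filter, hmem]
    have he0 : 1 ≤ e := Nat.pos_of_ne_zero (by rintro rfl; simp at hq)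
    exact ⟨⟨⟨he0, by nlinarith [hq.1.1.2, hd.1.1]⟩, (Nat.coprime_mul_iff_left.mp hq.1.2).2⟩, hq.1.1.2⟩
  · intro e he
    rw [Finset.mem_filter, hmem] at he
    rw [Finset.mem_filter, hmem]
    exact ⟨⟨⟨Nat.mul_pos (by omega) (by omega), he.2⟩, Nat.coprime_mul_iff_left.mpr ⟨hd.2, he.1.2⟩⟩,
      Dvd.intro _ rfl⟩
  · intro q hq
    rw [Finset.mem_filter] at hq
    exact Nat.mul_div_cancel' hq.2
  · intro e _
    exact Nat.mul_div_cancel_left e (by omega)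
  · intro q hq
    rw [Finset.mem_filter] at hq
    rw [← Nat.cast_mul, Nat.mul_div_cancel' hq.2]

theorem abs_sum_totient_div_mul_sub_le {l Q : ℕ} (hl : 2 ≤ l) (hQ : 0 < Q) {g : ℝ → ℝ}
    (hg : AntitoneOn g (Set.Ici 0)) (hg0 : ∀ x, 0 ≤ x → 0 ≤ g x) (hgQ : ∀ x, (Q : ℝ) < x → g x = 0) :
    |∑ q ∈ (Finset.Icc 1 Q).filter (fun q => q.Coprime l), (Nat.totient q : ℝ) / q * g q
      - Cconst l * ∫ x in (0 : ℝ)..Q, g x| ≤ g 0 * (l * (1 + Real.log Q) + 1) := by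
  rw [sum_totient_div_mul_eq hgQ]
  set A := (Finset.Icc 1 Q).filter (fun q => q.Coprime l) with hA
  set W := ∫ x in (0 : ℝ)..Q, g x with hW
  have hl0 : (0 : ℝ) < l := by positivity
  have hQ0 : (0 : ℝ) < Q := by positivity
  have hgz := hg0 0 le_rfl
  have hW0 : 0 ≤ W := intervalIntegral.integral_nonneg hQ0.le fun x hx => hg0 x hx.1
  have hW1 : W ≤ Q * g 0 := by
    have := intervalIntegral.integral_mono_on hQ0.le (hg.intervalIntegrable_of_nonneg le_rfl hQ0.le)
      (intervalIntegrable_const (c := g 0)) fun x hx => hg (Set.mem_Ici.mpr le_rfl) hx.1 hx.1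
    simpa using this
  have h1 : |∑ d ∈ A, (ArithmeticFunction.moebius d : ℝ) / d * ∑ e ∈ A, g ((d : ℝ) * e)
      - (Nat.totient l : ℝ) / l * (∑ d ∈ A, (ArithmeticFunction.moebius d : ℝ) / (d : ℝ) ^ 2) * W|
      ≤ g 0 * (l * (1 + Real.log Q)) := by
    rw [Finset.mul_sum, Finset.sum_mul, ← Finset.sum_sub_distrib]
    refine (Finset.abs_sum_le_sum_abs _ _).trans ?_
    have h2 : ∀ d ∈ A, |(ArithmeticFunction.moebius d : ℝ) / d * ∑ e ∈ A, g ((d : ℝ) * e)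
        - (Nat.totient l : ℝ) / l * ((ArithmeticFunction.moebius d : ℝ) / (d : ℝ) ^ 2) * W|
        ≤ 1 / (d : ℝ) * (l * g 0) := by
      intro d hd
      rw [hA, Finset.mem_filter, Finset.mem_Icc] at hd
      have hd0 : (0 : ℝ) < d := by exact_mod_cast hd.1.1
      have h3 := hg.abs_sum_coprime_sub_integral_le hg0 hgQ (d := d) hd.1.1 hl
      have h4 : (ArithmeticFunction.moebius d : ℝ) / d * ∑ e ∈ A, g ((d : ℝ) * e)
        - (Nat.totient l : ℝ) / l * ((ArithmeticFunction.moebius d : ℝ) / (d : ℝ) ^ 2) * W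
        = (ArithmeticFunction.moebius d : ℝ) / d * (∑ e ∈ A, g ((d : ℝ) * e)
          - (Nat.totient l : ℝ) / ((d : ℝ) * l) * W) := by
        field_simp
      rw [h4, abs_mul, abs_div, abs_of_pos hd0]
      have := abs_moebius_le_one_real d
      gcongr
    refine (Finset.sum_le_sum h2).trans ?_
    rw [← Finset.sum_mul]
    have h5 : ∑ d ∈ A, 1 / (d : ℝ) ≤ 1 + Real.log Q := by
      have h6 : ∑ d ∈ A, 1 / (d : ℝ) ≤ ∑ d ∈ Finset.Icc 1 Q, 1 / (d : ℝ) :=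
        Finset.sum_le_sum_of_subset_of_nonneg (Finset.filter_subset _ _) fun _ _ _ => by positivity
      refine h6.trans ?_
      have h7 := harmonic_le_one_add_log Q
      rw [harmonic_eq_sum_Icc] at h7
      push_cast at h7
      simpa using h7
    calc (∑ d ∈ A, 1 / (d : ℝ)) * (l * g 0) ≤ (1 + Real.log Q) * (l * g 0) := by gcongr
      _ = _ := by ring
  have h8 := abs_sum_coprimeMoebius_sub_tsum_le l hQ
  rw [← hA] at h8
  have h9 : |(Nat.totient l : ℝ) / l * (∑ d ∈ A, (ArithmeticFunction.moebius d : ℝ) / (d : ℝ) ^ 2) * W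
      - Cconst l * W| ≤ g 0 := by
    rw [Cconst_eq, ← sub_mul, ← mul_sub, abs_mul, abs_mul, abs_of_nonneg hW0,
      abs_of_nonneg (by positivity : (0 : ℝ) ≤ (Nat.totient l : ℝ) / l)]
    have h10 : (Nat.totient l : ℝ) / l ≤ 1 := by
      rw [div_le_one hl0]; exact_mod_cast Nat.totient_le l
    calc _ ≤ 1 * (1 / (Q : ℝ)) * (Q * g 0) := by gcongr
      _ = g 0 := by field_simp
  refine (abs_sub_le _ _ _).trans ((add_le_add h1 h9).trans (le_of_eq ?_))
  ring

noncomputable def gapMean (lam u : ℝ) : ℝ := (1 - u) * ∫ ζ in (0 : ℝ)..1, 1 / (lam - u * ζ)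

theorem intervalIntegrable_one_div_sub {lam u : ℝ} (hlam : 1 < lam) (hu1 : u ≤ 1) :
    IntervalIntegrable (fun ζ => 1 / (lam - u * ζ)) volume 0 1 := by
  refine ContinuousOn.intervalIntegrable fun ζ hζ => ContinuousAt.continuousWithinAt ?_
  rw [Set.uIcc_of_le zero_le_one] at hζ
  have : lam - u * ζ ≠ 0 := by nlinarith [hζ.1, hζ.2]
  fun_prop (disch := assumption)

theorem gapMean_nonneg {lam u : ℝ} (hlam : 1 < lam) (hu1 : u ≤ 1) : 0 ≤ gapMean lam u := by
  refine mul_nonneg (by linarith) (intervalIntegral.integral_nonneg zero_le_one fun ζ hζ => ?_)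
  have : 0 < lam - u * ζ := by nlinarith [hζ.1, hζ.2]
  positivity

theorem gapMean_antitone {lam u v : ℝ} (hlam : 1 < lam) (huv : u ≤ v) (hv : v ≤ 1) :
    gapMean lam v ≤ gapMean lam u := by
  unfold gapMean
  rw [← intervalIntegral.integral_const_mul, ← intervalIntegral.integral_const_mul]
  refine intervalIntegral.integral_mono_on zero_le_one
    ((intervalIntegrable_one_div_sub hlam hv).const_mul _)
    ((intervalIntegrable_one_div_sub hlam (huv.trans hv)).const_mul _) fun ζ hζ => ?_
  have h1 : 0 < lam - u * ζ := by nlinarith [hζ.1, hζ.2]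
  have h2 : 0 < lam - v * ζ := by nlinarith [hζ.1, hζ.2]
  rw [mul_one_div, mul_one_div, div_le_div_iff₀ h2 h1]
  nlinarith [mul_nonneg (sub_nonneg.mpr huv) (by linarith [hζ.2] : 0 ≤ lam - ζ)]

theorem gapMean_zero {lam : ℝ} : gapMean lam 0 = 1 / lam := by
  simp [gapMean]

theorem integral_gapMean {lam : ℝ} (hlam : 1 < lam) :
    ∫ u in (0 : ℝ)..1, gapMean lam u
      = ∫ u in (0 : ℝ)..1, ((1 - u) / u) * Real.log (lam / (lam - u)) := by
  refine intervalIntegral.integral_congr_ae (ae_of_all _ fun u hu => ?_)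
  rw [Set.uIoc_of_le zero_le_one] at hu
  have hu0 := hu.1
  have hu1 := hu.2
  have hd : ∀ ζ ∈ Set.uIcc (0 : ℝ) 1, HasDerivAt (fun ζ => -(1 / u) * Real.log (lam - u * ζ))
      (1 / (lam - u * ζ)) ζ := by
    intro ζ hζ
    rw [Set.uIcc_of_le zero_le_one] at hζ
    have hne : lam - u * ζ ≠ 0 := by nlinarith [hζ.1, hζ.2]
    have h1 : HasDerivAt (fun ζ => lam - u * ζ) (-u) ζ := by
      simpa using ((hasDerivAt_id ζ).const_mul u).const_sub lam
    have h2 := (h1.log hne).const_mul (-(1 / u))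
    exact h2.congr_deriv (by field_simp)
  have h3 := intervalIntegral.integral_eq_sub_of_hasDerivAt hd (intervalIntegrable_one_div_sub hlam hu1)
  rw [gapMean, h3, Real.log_div (by linarith) (by linarith)]
  simp only [mul_one, mul_zero, sub_zero]
  field_simp
  ring

noncomputable def gapWeight (lam : ℝ) (Q : ℕ) (x : ℝ) : ℝ :=
  if x ≤ Q then gapMean lam (x / Q) / Q else 0

theorem gapWeight_antitoneOn {lam : ℝ} (hlam : 1 < lam) (Q : ℕ) :
    AntitoneOn (gapWeight lam Q) (Set.Ici 0) := by
  intro x hx y hy hxy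
  have hQ : (0 : ℝ) ≤ Q := Nat.cast_nonneg Q
  unfold gapWeight
  have key : ∀ z : ℝ, z ≤ Q → z / Q ≤ 1 := fun z hz => div_le_one_of_le₀ hz hQ
  split_ifs with h1 h2 h2
  · exact div_le_div_of_nonneg_right
      (gapMean_antitone hlam (div_le_div_of_nonneg_right hxy hQ) (key y h1)) hQ
  · linarith
  · exact div_nonneg (gapMean_nonneg hlam (key x h2)) hQ
  · exact le_rfl

theorem gapWeight_nonneg {lam : ℝ} (hlam : 1 < lam) (Q : ℕ) (x : ℝ) : 0 ≤ gapWeight lam Q x := by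
  have hQ : (0 : ℝ) ≤ Q := Nat.cast_nonneg Q
  unfold gapWeight
  split_ifs with h
  · exact div_nonneg (gapMean_nonneg hlam (div_le_one_of_le₀ h hQ)) hQ
  · exact le_rfl

theorem gapWeight_zero_le {lam : ℝ} (hlam : 1 < lam) (Q : ℕ) : gapWeight lam Q 0 ≤ 1 / Q := by
  unfold gapWeight
  rw [if_pos (Nat.cast_nonneg Q), zero_div, gapMean_zero]
  gcongr
  rw [div_le_one (by linarith)]
  exact hlam.le

theorem integral_gapWeight {lam : ℝ} {Q : ℕ} (hQ : 0 < Q) :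
    ∫ x in (0 : ℝ)..Q, gapWeight lam Q x = ∫ u in (0 : ℝ)..1, gapMean lam u := by
  have hQ0 : (0 : ℝ) < Q := by positivity
  have h1 : ∫ x in (0 : ℝ)..Q, gapWeight lam Q x = ∫ x in (0 : ℝ)..Q, gapMean lam (x / Q) / Q := by
    refine intervalIntegral.integral_congr fun x hx => ?_
    rw [Set.uIcc_of_le hQ0.le] at hx
    exact if_pos hx.2
  rw [h1, intervalIntegral.integral_div, intervalIntegral.integral_comp_div _ hQ0.ne']
  rw [zero_div, div_self hQ0.ne', smul_eq_mul, mul_div_cancel_left₀ _ hQ0.ne']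

theorem gapWeight_div_eq {lam : ℝ} {Q q : ℕ} (hq : 0 < q) (hqQ : q ≤ Q) :
    gapWeight lam Q q / q
      = (1 - (q : ℝ) / Q) * ∫ ζ in (0 : ℝ)..1, 1 / ((q : ℝ) * (lam * Q - q * ζ)) := by
  have hq0 : (0 : ℝ) < q := by positivity
  have hQ0 : (0 : ℝ) < Q := by have := hq.trans_le hqQ; positivity
  unfold gapWeight gapMean
  rw [if_pos (by exact_mod_cast hqQ)]
  have h1 : ∫ ζ in (0 : ℝ)..1, 1 / ((q : ℝ) * (lam * Q - q * ζ))
      = 1 / (q * Q) * ∫ ζ in (0 : ℝ)..1, 1 / (lam - q / Q * ζ) := by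
    rw [← intervalIntegral.integral_const_mul]
    congr 1
    funext ζ
    rw [one_div_mul_one_div]
    congr 1
    field_simp
  rw [h1]
  field_simp

theorem intervalIntegral_one_div_le {lam : ℝ} (hlam : 1 < lam) {Q q : ℕ} (hq : 0 < q) (hqQ : q ≤ Q) :
    0 ≤ (q : ℝ) * (∫ ζ in (0 : ℝ)..1, 1 / ((q : ℝ) * (lam * Q - q * ζ))) ∧
    (q : ℝ) * (∫ ζ in (0 : ℝ)..1, 1 / ((q : ℝ) * (lam * Q - q * ζ))) ≤ 1 / ((lam - 1) * Q) := by
  have hq0 : (0 : ℝ) < q := by positivity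
  have hQ0 : (0 : ℝ) < Q := by have := hq.trans_le hqQ; positivity
  have hqQ' : (q : ℝ) ≤ Q := by exact_mod_cast hqQ
  have hpos : ∀ ζ ∈ Set.Icc (0 : ℝ) 1, (lam - 1) * Q ≤ lam * Q - q * ζ := fun ζ hζ => by
    nlinarith [hζ.1, hζ.2]
  have hl : 0 < (lam - 1) * Q := mul_pos (by linarith) hQ0
  rw [← intervalIntegral.integral_const_mul]
  have heq : ∀ ζ ∈ Set.Icc (0 : ℝ) 1, (q : ℝ) * (1 / ((q : ℝ) * (lam * Q - q * ζ))) = 1 / (lam * Q - q * ζ) := by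
    intro ζ hζ
    have := hpos ζ hζ
    have : lam * Q - q * ζ ≠ 0 := by linarith
    field_simp
  rw [intervalIntegral.integral_congr (g := fun ζ => 1 / (lam * Q - q * ζ))
    (by rw [Set.uIcc_of_le zero_le_one]; exact heq)]
  constructor
  · refine intervalIntegral.integral_nonneg zero_le_one fun ζ hζ => ?_
    exact one_div_nonneg.mpr (hl.le.trans (hpos ζ hζ))
  · have h2 := intervalIntegral.integral_mono_on (f := fun ζ => 1 / (lam * Q - q * ζ))
      (g := fun _ => 1 / ((lam - 1) * Q)) (μ := volume) zero_le_one ?_ intervalIntegrable_const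
      (fun ζ hζ => one_div_le_one_div_of_le hl (hpos ζ hζ))
    · simpa using h2
    · refine ContinuousOn.intervalIntegrable fun ζ hζ => ContinuousAt.continuousWithinAt ?_
      rw [Set.uIcc_of_le zero_le_one] at hζ
      have : lam * Q - q * ζ ≠ 0 := by linarith [hpos ζ hζ]
      fun_prop (disch := assumption)

theorem abs_sum_fareyPts_sub_le {J : Set ℝ} (hJ : J.OrdConnected) (hJs : J ⊆ Set.Ioc 0 1)
    {l : ℕ} (hl : 0 < l) (Q : ℕ) {f : ℕ → ℝ} (hf : ∀ q, 0 ≤ f q) :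
    |∑ p ∈ fareyPts l Q J, f p.2.toNat - (volume J).toReal / l *
      ∑ q ∈ (Finset.Icc 1 Q).filter (fun q => q.Coprime l), (Nat.totient q : ℝ) * f q|
      ≤ ∑ q ∈ Finset.Icc 1 Q, (q.divisors.card : ℝ) * f q := by
  classical
  have hmaps : ∀ p ∈ fareyPts l Q J, p.2.toNat ∈ Finset.Icc 1 Q := by
    intro p hp
    rw [mem_fareyPts] at hp
    rw [Finset.mem_Icc]
    omega
  rw [← Finset.sum_fiberwise_of_maps_to hmaps, Finset.sum_filter, Finset.mul_sum,
    ← Finset.sum_sub_distrib]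
  refine (Finset.abs_sum_le_sum_abs _ _).trans (Finset.sum_le_sum fun q hq => ?_)
  rw [Finset.mem_Icc] at hq
  have h1 : ∑ p ∈ (fareyPts l Q J).filter (fun p => p.2.toNat = q), f p.2.toNat
      = (((Finset.Icc (1 : ℤ) q).filter fun a : ℤ =>
          (a : ℝ) / q ∈ J ∧ (l : ℤ) ∣ a - q ∧ Int.gcd a q = 1).card : ℝ) * f q := by
    rw [Finset.sum_congr rfl (g := fun _ => f q)
      (fun p hp => by rw [(Finset.mem_filter.mp hp).2]), Finset.sum_const, nsmul_eq_mul]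
    congr 2
    refine Finset.card_nbij' (fun p => p.1) (fun a => (a, (q : ℤ))) ?_ ?_ ?_ ?_
    · intro p hp
      rw [Finset.mem_coe, Finset.mem_filter, mem_fareyPts] at hp
      have hp2 : p.2 = q := by omega
      rw [hp2] at hp
      have hq0 : (0 : ℝ) < q := by exact_mod_cast hq.1
      have hle : (p.1 : ℝ) ≤ q := by
        have := (hJs hp.1.2.1).2
        rw [Int.cast_natCast, div_le_one hq0] at this
        exact this
      simp only [Finset.coe_filter, Finset.mem_Icc, Set.mem_ofPred_eq]
      refine ⟨⟨hp.1.1.1.1, by exact_mod_cast hle⟩, ?_, hp.1.2.2.1, hp.1.2.2.2⟩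
      simpa using hp.1.2.1
    · intro a ha
      simp only [Finset.coe_filter, Finset.mem_Icc, Set.mem_ofPred_eq] at ha
      simp only [Finset.coe_filter, mem_fareyPts, Set.mem_ofPred_eq]
      refine ⟨⟨⟨⟨ha.1.1, by omega⟩, by omega, by omega⟩, ?_, ha.2.2.1, ha.2.2.2⟩, by simp⟩
      simpa using ha.2.1
    · intro p hp
      rw [Finset.mem_coe, Finset.mem_filter, mem_fareyPts] at hp
      ext <;> simp
      omega
    · intro a _
      rfl
  rw [h1]
  have h2 := card_fibre_sub_le hJ hJs hl hq.1 (q := q)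
  set k : ℝ := (((Finset.Icc (1 : ℤ) q).filter fun a : ℤ =>
          (a : ℝ) / q ∈ J ∧ (l : ℤ) ∣ a - q ∧ Int.gcd a q = 1).card : ℝ)
  have h3 : k * f q - (volume J).toReal / l * (if q.Coprime l then (Nat.totient q : ℝ) * f q else 0)
      = (k - (if q.Coprime l then Nat.totient q * (volume J).toReal / l else 0)) * f q := by
    split_ifs <;> ring
  rw [h3, abs_mul, abs_of_nonneg (hf q)]
  refine mul_le_mul_of_nonneg_right ?_ (hf q)
  convert h2

theorem toReal_volume_le_one {J : Set ℝ} (hJs : J ⊆ Set.Ioc 0 1) : (volume J).toReal ≤ 1 := by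
  have h := measure_mono (μ := volume) hJs
  rw [Real.volume_Ioc, sub_zero, ENNReal.ofReal_one] at h
  exact ENNReal.toReal_le_of_le_ofReal zero_le_one (by simpa using h)

theorem card_fareyPts_le : ∃ C : ℝ, 1 ≤ C ∧ ∀ J : Set ℝ, J.OrdConnected → J ⊆ Set.Ioc 0 1 →
    ∀ l : ℕ, 0 < l → ∀ Q : ℕ, 0 < Q →
    ((fareyPts l Q J).card : ℝ) ≤ (volume J).toReal * (Q : ℝ) ^ 2 + C * (Q : ℝ) ^ (3 / 2 : ℝ) := by
  obtain ⟨C, hC, hdiv⟩ := card_divisors_le_rpow (δ := 1 / 2) (by norm_num)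
  refine ⟨C, hC, fun J hJ hJs l hl Q hQ => ?_⟩
  have hQ0 : (0 : ℝ) < Q := by positivity
  have hl1 : (1 : ℝ) ≤ l := by exact_mod_cast hl
  have hv : 0 ≤ (volume J).toReal := ENNReal.toReal_nonneg
  have h := abs_sum_fareyPts_sub_le hJ hJs hl Q (f := fun _ => 1) (fun _ => zero_le_one)
  have h1 := (abs_le.mp h).2
  simp only [Finset.sum_const, nsmul_eq_mul, mul_one] at h1
  have h2 : ∑ q ∈ (Finset.Icc 1 Q).filter (fun q => q.Coprime l), (Nat.totient q : ℝ) ≤ (Q : ℝ) ^ 2 := by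
    calc ∑ q ∈ (Finset.Icc 1 Q).filter (fun q => q.Coprime l), (Nat.totient q : ℝ)
        ≤ ∑ q ∈ Finset.Icc 1 Q, (Nat.totient q : ℝ) :=
          Finset.sum_le_sum_of_subset_of_nonneg (Finset.filter_subset _ _) fun _ _ _ => by positivity
      _ ≤ ∑ q ∈ Finset.Icc 1 Q, (Q : ℝ) := Finset.sum_le_sum fun q hq => by
          rw [Finset.mem_Icc] at hq
          exact_mod_cast (Nat.totient_le q).trans hq.2
      _ = (Q : ℝ) ^ 2 := by simp; ring
  have h3 : ∑ q ∈ Finset.Icc 1 Q, (q.divisors.card : ℝ) ≤ C * (Q : ℝ) ^ (3 / 2 : ℝ) := by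
    calc ∑ q ∈ Finset.Icc 1 Q, (q.divisors.card : ℝ) ≤ ∑ q ∈ Finset.Icc 1 Q, C * (Q : ℝ) ^ (1 / 2 : ℝ) :=
          Finset.sum_le_sum fun q hq => by
            rw [Finset.mem_Icc] at hq
            refine (hdiv q (by omega)).trans ?_
            have : (q : ℝ) ≤ Q := by exact_mod_cast hq.2
            gcongr
      _ = C * (Q : ℝ) ^ (3 / 2 : ℝ) := by
          have : (Q : ℝ) ^ (3 / 2 : ℝ) = Q * (Q : ℝ) ^ (1 / 2 : ℝ) := by
            rw [← Real.rpow_one_add' hQ0.le (by norm_num)]; norm_num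
          rw [this]
          simp
          ring
  have h4 : (volume J).toReal / l * ∑ q ∈ (Finset.Icc 1 Q).filter (fun q => q.Coprime l), (Nat.totient q : ℝ)
      ≤ (volume J).toReal * (Q : ℝ) ^ 2 := by
    have : (volume J).toReal / l ≤ (volume J).toReal := div_le_self hv hl1
    gcongr
  linarith

theorem main_sum_le (l : ℕ) (hl : 2 ≤ l) {lam₀ : ℝ} (hlam₀ : 1 < lam₀) :
    ∃ C : ℝ, 1 ≤ C ∧ ∀ lam : ℝ, lam₀ ≤ lam → ∀ (Q : ℕ) (ε : ℝ), 0 < Q → ε * Q ≤ 1 → 1 ≤ ε * (Q + 1) →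
      ∀ J : Set ℝ, J.OrdConnected → J ⊆ Set.Ioc 0 1 →
      |∑ p ∈ fareyPts l Q J, (1 - ε * p.2) *
          (∫ ζ in (0 : ℝ)..1, 1 / ((p.2 : ℝ) * (lam * Q - p.2 * ζ))) -
        Cconst l / l * (∫ u in (0 : ℝ)..1, ((1 - u) / u) * Real.log (lam / (lam - u))) *
          (volume J).toReal| ≤ C * (Q : ℝ) ^ (-(1 / 2) : ℝ) := by
  obtain ⟨C, hC, hdiv⟩ := card_divisors_le_rpow (δ := 1 / 4) (by norm_num)
  have hl0 : (0 : ℝ) < l := by positivity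
  have hm : 0 < lam₀ - 1 := by linarith
  refine ⟨1 / (lam₀ - 1) + C * 5 + (5 * l + 1) + 1, ?_, ?_⟩
  · have : 0 < 1 / (lam₀ - 1) := by positivity
    nlinarith
  intro lam hlam Q ε hQ hε1 hε2 J hJ hJs
  have hlam1 : 1 < lam := by linarith
  have hQ0 : (0 : ℝ) < Q := by positivity
  have hQ1 : (1 : ℝ) ≤ Q := by exact_mod_cast hQ
  have hv0 : 0 ≤ (volume J).toReal := ENNReal.toReal_nonneg
  have hv1 := toReal_volume_le_one hJs
  set I : ℤ → ℝ := fun q => ∫ ζ in (0 : ℝ)..1, 1 / ((q : ℝ) * (lam * Q - q * ζ)) with hI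
  have hlog : 1 + Real.log Q ≤ 5 * (Q : ℝ) ^ (1 / 4 : ℝ) := by
    have := one_add_log_le_rpow (δ := 1 / 4) (by norm_num) hQ1
    norm_num at this ⊢
    exact this
  have hQrel : (Q : ℝ) ^ (-(1 / 2) : ℝ) = (Q : ℝ) ^ (1 / 4 : ℝ) * (Q : ℝ) ^ (1 / 4 : ℝ) / Q := by
    rw [← Real.rpow_add hQ0, ← Real.rpow_sub_one hQ0.ne']; norm_num
  have hQq1 : 1 ≤ (Q : ℝ) ^ (1 / 4 : ℝ) := Real.one_le_rpow hQ1 (by norm_num)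
  have hinv : 1 / (Q : ℝ) ≤ (Q : ℝ) ^ (-(1 / 2) : ℝ) := by
    rw [hQrel]; gcongr; nlinarith
  have hA : |∑ p ∈ fareyPts l Q J, (1 - ε * p.2) * I p.2
      - ∑ p ∈ fareyPts l Q J, gapWeight lam Q (p.2.toNat : ℝ) / (p.2.toNat : ℝ)|
      ≤ 1 / (lam₀ - 1) * (1 / Q) := by
    rw [← Finset.sum_sub_distrib]
    refine (Finset.abs_sum_le_sum_abs _ _).trans ?_
    have hcard : ((fareyPts l Q J).card : ℝ) ≤ (Q : ℝ) ^ 2 := by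
      have : (fareyPts l Q J).card ≤ Q * Q := by
        classical
        unfold fareyPts
        refine (Finset.card_filter_le _ _).trans ?_
        simp
      rw [pow_two]
      exact_mod_cast this
    have hterm : ∀ p ∈ fareyPts l Q J, |(1 - ε * p.2) * I p.2
        - gapWeight lam Q (p.2.toNat : ℝ) / (p.2.toNat : ℝ)| ≤ 1 / (Q : ℝ) ^ 2 * (1 / ((lam₀ - 1) * Q)) := by
      intro p hp
      rw [mem_fareyPts] at hp
      obtain ⟨q, hq⟩ : ∃ q : ℕ, p.2 = q := ⟨p.2.toNat, by omega⟩
      have hq1 : 0 < q := by omega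
      have hqQ : q ≤ Q := by omega
      have h2 := intervalIntegral_one_div_le hlam1 hq1 hqQ
      rw [hq, Int.toNat_natCast, gapWeight_div_eq hq1 hqQ]
      simp only [hI, Int.cast_natCast]
      have h3 : (1 - ε * (q : ℝ)) * (∫ ζ in (0 : ℝ)..1, 1 / ((q : ℝ) * (lam * Q - q * ζ)))
          - (1 - (q : ℝ) / Q) * (∫ ζ in (0 : ℝ)..1, 1 / ((q : ℝ) * (lam * Q - q * ζ)))
          = (1 / Q - ε) * ((q : ℝ) * (∫ ζ in (0 : ℝ)..1, 1 / ((q : ℝ) * (lam * Q - q * ζ)))) := by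
        ring
      rw [h3, abs_mul, abs_of_nonneg h2.1]
      have h4 : |1 / (Q : ℝ) - ε| ≤ 1 / (Q : ℝ) ^ 2 := by
        have h5 : ε ≤ 1 / Q := by rw [le_div_iff₀ hQ0]; exact hε1
        rw [abs_of_nonneg (by linarith)]
        have h6 : 1 / ((Q : ℝ) + 1) ≤ ε := by rw [div_le_iff₀ (by linarith)]; exact hε2
        have h7 : 1 / (Q : ℝ) - 1 / (Q + 1) ≤ 1 / (Q : ℝ) ^ 2 := by
          rw [div_sub_div _ _ hQ0.ne' (by positivity), div_le_div_iff₀ (by positivity) (by positivity)]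
          nlinarith
        linarith
      have h8 : 1 / ((lam - 1) * Q) ≤ 1 / ((lam₀ - 1) * Q) := by gcongr
      exact mul_le_mul h4 (h2.2.trans h8) h2.1 (by positivity)
    refine (Finset.sum_le_card_nsmul _ _ _ hterm).trans ?_
    rw [nsmul_eq_mul]
    calc ((fareyPts l Q J).card : ℝ) * (1 / (Q : ℝ) ^ 2 * (1 / ((lam₀ - 1) * Q)))
        ≤ (Q : ℝ) ^ 2 * (1 / (Q : ℝ) ^ 2 * (1 / ((lam₀ - 1) * Q))) := by gcongr
      _ = 1 / (lam₀ - 1) * (1 / Q) := by field_simp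
  have hf0 : ∀ q : ℕ, 0 ≤ gapWeight lam Q q / q := fun q =>
    div_nonneg (gapWeight_nonneg hlam1 Q q) (Nat.cast_nonneg q)
  have hB := abs_sum_fareyPts_sub_le hJ hJs (by omega : 0 < l) Q (f := fun q => gapWeight lam Q q / q) hf0
  have hgle : ∀ q : ℕ, gapWeight lam Q q ≤ 1 / Q := fun q =>
    (gapWeight_antitoneOn hlam1 Q (Set.mem_Ici.mpr le_rfl) (Set.mem_Ici.mpr (Nat.cast_nonneg q))
      (Nat.cast_nonneg q)).trans (gapWeight_zero_le hlam1 Q)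
  have hB2 : ∑ q ∈ Finset.Icc 1 Q, (q.divisors.card : ℝ) * (gapWeight lam Q q / q)
      ≤ C * 5 * (Q : ℝ) ^ (-(1 / 2) : ℝ) := by
    have h1 : ∀ q ∈ Finset.Icc 1 Q, (q.divisors.card : ℝ) * (gapWeight lam Q q / q)
        ≤ C * (Q : ℝ) ^ (1 / 4 : ℝ) * (1 / Q) * (1 / q) := by
      intro q hq
      rw [Finset.mem_Icc] at hq
      have hq0 : (0 : ℝ) < q := by exact_mod_cast hq.1
      have hqQ : (q : ℝ) ≤ Q := by exact_mod_cast hq.2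
      have h2 : (q.divisors.card : ℝ) ≤ C * (Q : ℝ) ^ (1 / 4 : ℝ) :=
        (hdiv q (by omega)).trans (by gcongr)
      have h3 : gapWeight lam Q q / q ≤ (1 / Q) * (1 / q) := by
        rw [div_eq_mul_one_div]
        exact mul_le_mul_of_nonneg_right (hgle q) (by positivity)
      calc (q.divisors.card : ℝ) * (gapWeight lam Q q / q)
          ≤ C * (Q : ℝ) ^ (1 / 4 : ℝ) * ((1 / Q) * (1 / q)) :=
            mul_le_mul h2 h3 (hf0 q) (by positivity)
        _ = _ := by ring
    refine (Finset.sum_le_sum h1).trans ?_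
    rw [← Finset.mul_sum]
    have h7 := harmonic_le_one_add_log Q
    rw [harmonic_eq_sum_Icc] at h7
    push_cast at h7
    have h8 : ∑ q ∈ Finset.Icc 1 Q, 1 / (q : ℝ) ≤ 5 * (Q : ℝ) ^ (1 / 4 : ℝ) := by
      refine le_trans ?_ hlog
      simpa using h7
    calc C * (Q : ℝ) ^ (1 / 4 : ℝ) * (1 / Q) * ∑ q ∈ Finset.Icc 1 Q, 1 / (q : ℝ)
        ≤ C * (Q : ℝ) ^ (1 / 4 : ℝ) * (1 / Q) * (5 * (Q : ℝ) ^ (1 / 4 : ℝ)) := by gcongr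
      _ = C * 5 * (Q : ℝ) ^ (-(1 / 2) : ℝ) := by rw [hQrel]; ring
  have hC1 := abs_sum_totient_div_mul_sub_le hl hQ (gapWeight_antitoneOn hlam1 Q)
    (fun x _ => gapWeight_nonneg hlam1 Q x) (fun x hx => if_neg (not_le.mpr hx))
  rw [integral_gapWeight hQ, integral_gapMean hlam1] at hC1
  have hC2 : gapWeight lam Q 0 * (l * (1 + Real.log Q) + 1) ≤ (5 * l + 1) * (Q : ℝ) ^ (-(1 / 2) : ℝ) := by
    have hlog0 : 0 ≤ Real.log Q := Real.log_nonneg hQ1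
    calc gapWeight lam Q 0 * (l * (1 + Real.log Q) + 1)
        ≤ 1 / Q * (l * (5 * (Q : ℝ) ^ (1 / 4 : ℝ)) + 1) :=
          mul_le_mul (gapWeight_zero_le hlam1 Q) (by gcongr) (by positivity) (by positivity)
      _ ≤ 1 / Q * (l * (5 * ((Q : ℝ) ^ (1 / 4 : ℝ) * (Q : ℝ) ^ (1 / 4 : ℝ)))
          + 1 * ((Q : ℝ) ^ (1 / 4 : ℝ) * (Q : ℝ) ^ (1 / 4 : ℝ))) := by
          have : 1 ≤ (Q : ℝ) ^ (1 / 4 : ℝ) * (Q : ℝ) ^ (1 / 4 : ℝ) := by nlinarith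
          gcongr
          · nlinarith
          · linarith
      _ = _ := by rw [hQrel]; ring
  have hC3 : |(volume J).toReal / l * ∑ q ∈ (Finset.Icc 1 Q).filter (fun q => q.Coprime l),
      (Nat.totient q : ℝ) * (gapWeight lam Q q / q)
      - Cconst l / l * (∫ u in (0 : ℝ)..1, ((1 - u) / u) * Real.log (lam / (lam - u))) *
          (volume J).toReal| ≤ (5 * l + 1) * (Q : ℝ) ^ (-(1 / 2) : ℝ) := by
    have h1 : ∑ q ∈ (Finset.Icc 1 Q).filter (fun q => q.Coprime l),
      (Nat.totient q : ℝ) * (gapWeight lam Q q / q) = ∑ q ∈ (Finset.Icc 1 Q).filter (fun q => q.Coprime l),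
      (Nat.totient q : ℝ) / q * gapWeight lam Q q := Finset.sum_congr rfl fun _ _ => by ring
    rw [h1]
    have h2 := hC1.trans hC2
    set S := ∑ q ∈ (Finset.Icc 1 Q).filter (fun q => q.Coprime l), (Nat.totient q : ℝ) / q * gapWeight lam Q q
    set L := ∫ u in (0 : ℝ)..1, ((1 - u) / u) * Real.log (lam / (lam - u))
    have h3 : (volume J).toReal / l * S - Cconst l / l * L * (volume J).toReal
        = (volume J).toReal / l * (S - Cconst l * L) := by ring
    rw [h3, abs_mul, abs_of_nonneg (by positivity)]
    have h4 : (volume J).toReal / l ≤ 1 := by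
      refine (div_le_self hv0 ?_).trans hv1
      exact_mod_cast (by omega : 1 ≤ l)
    calc _ ≤ 1 * |S - Cconst l * L| := by gcongr
      _ ≤ _ := by rw [one_mul]; exact h2
  have hA2 : 1 / (lam₀ - 1) * (1 / (Q : ℝ)) ≤ 1 / (lam₀ - 1) * (Q : ℝ) ^ (-(1 / 2) : ℝ) := by gcongr
  have hpos : 0 ≤ (Q : ℝ) ^ (-(1 / 2) : ℝ) := by positivity
  have hB3 := hB.trans hB2
  rw [abs_le] at hA hB3 hC3 ⊢
  constructor <;> linarith [hA.1, hA.2, hB3.1, hB3.2, hC3.1, hC3.2]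

theorem rpow_add_le_four_mul {a b : ℝ} (ha : 0 ≤ a) (hb : 0 ≤ b) :
    (a + b) ^ (7 / 4 : ℝ) ≤ 4 * (a ^ (7 / 4 : ℝ) + b ^ (7 / 4 : ℝ)) := by
  have h4 : (2 : ℝ) ^ (7 / 4 : ℝ) ≤ 4 := by
    have h := Real.rpow_le_rpow_of_exponent_le (x := 2) one_le_two (by norm_num : (7 / 4 : ℝ) ≤ 2)
    norm_num at h ⊢
    exact h
  have key : ∀ x y : ℝ, 0 ≤ x → x ≤ y → (x + y) ^ (7 / 4 : ℝ) ≤ 4 * y ^ (7 / 4 : ℝ) := by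
    intro x y hx hxy
    calc (x + y) ^ (7 / 4 : ℝ) ≤ (2 * y) ^ (7 / 4 : ℝ) :=
          Real.rpow_le_rpow (by linarith) (by linarith) (by norm_num)
      _ = 2 ^ (7 / 4 : ℝ) * y ^ (7 / 4 : ℝ) := Real.mul_rpow (by norm_num) (hx.trans hxy)
      _ ≤ _ := by have := hx.trans hxy; gcongr
  have h1 : 0 ≤ a ^ (7 / 4 : ℝ) := by positivity
  have h2 : 0 ≤ b ^ (7 / 4 : ℝ) := by positivity
  rcases le_total a b with h | h
  · linarith [key a b ha h]
  · rw [add_comm a b]; linarith [key b a hb h]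

theorem dirichlet_error_le {Q c κ K s D T N w : ℝ} (hQ : 1 ≤ Q) (hc : 1 / 8 ≤ c) (hc2 : c ≤ 1 / 2)
    (hκ : κ = (8 * c - 1) / 9) (hK : 1 ≤ K) (hs : 1 ≤ s) (hsκ : s ≤ Q ^ κ)
    (hD : D = Q ^ (-κ) + K * s * Q ^ (-c)) (hT : T = Q ^ (1 / 6 - c / 3)) (hN : 0 ≤ N) (hNQ : N ≤ 2 * Q)
    (hw : w = K * Q ^ (-c)) :
    (Q * D) ^ (7 / 4 : ℝ) + (Q * D) ^ (3 / 4 : ℝ) * (T * ((N + s) * s * w) + (1 + Q / s))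
      ≤ 18 * K ^ 2 * Q ^ (11 / 6 - 2 * c / 3) := by
  have hQ0 : 0 < Q := by linarith
  have hK0 : 0 < K := by linarith
  have hs0 : 0 < s := by linarith
  have mon : ∀ {x y : ℝ}, x ≤ y → Q ^ x ≤ Q ^ y := fun h => Real.rpow_le_rpow_of_exponent_le hQ h
  have hKK : K ≤ K ^ 2 := by nlinarith
  set X := Q ^ (11 / 6 - 2 * c / 3) with hX
  have hX0 : 0 < X := by positivity
  have hsQ : s ≤ Q := by
    refine hsκ.trans ((mon (by rw [hκ]; linarith : κ ≤ 1)).trans (le_of_eq (Real.rpow_one Q)))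
  have hQD : Q * D = Q ^ (1 - κ) + K * s * Q ^ (1 - c) := by
    rw [hD, sub_eq_add_neg 1 κ, sub_eq_add_neg 1 c, Real.rpow_one_add' hQ0.le, Real.rpow_one_add' hQ0.le]
    · ring
    · linarith
    · rw [hκ]; linarith
  have hQD2 : Q * D ≤ Q ^ (1 - κ) + K * Q ^ (1 + κ - c) := by
    have h1 : Q ^ (1 + κ - c) = Q ^ κ * Q ^ (1 - c) := by rw [← Real.rpow_add hQ0]; ring_nf
    rw [hQD, h1, mul_assoc]
    gcongr
  have hQD0 : 0 ≤ Q * D := by rw [hQD]; positivity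
  have hK74 : K ^ (7 / 4 : ℝ) ≤ K ^ 2 := by
    rw [← Real.rpow_two]
    exact Real.rpow_le_rpow_of_exponent_le hK (by norm_num)
  have hK34 : K ^ (3 / 4 : ℝ) ≤ K := by
    have := Real.rpow_le_rpow_of_exponent_le hK (by norm_num : (3 / 4 : ℝ) ≤ 1)
    rwa [Real.rpow_one] at this
  have h1 : (Q * D) ^ (7 / 4 : ℝ) ≤ 8 * K ^ 2 * X := by
    calc (Q * D) ^ (7 / 4 : ℝ) ≤ (Q ^ (1 - κ) + K * Q ^ (1 + κ - c)) ^ (7 / 4 : ℝ) := by gcongr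
      _ ≤ 4 * ((Q ^ (1 - κ)) ^ (7 / 4 : ℝ) + (K * Q ^ (1 + κ - c)) ^ (7 / 4 : ℝ)) :=
          rpow_add_le_four_mul (by positivity) (by positivity)
      _ ≤ 4 * (K ^ 2 * X + K ^ 2 * X) := by
          rw [Real.mul_rpow hK0.le (by positivity), ← Real.rpow_mul hQ0.le, ← Real.rpow_mul hQ0.le]
          have e1 : Q ^ ((1 - κ) * (7 / 4)) ≤ 1 * X := by
            rw [one_mul]; exact mon (by rw [hκ]; linarith)
          have e2 : Q ^ ((1 + κ - c) * (7 / 4)) ≤ X := mon (by rw [hκ]; linarith)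
          have e3 : 1 * X ≤ K ^ 2 * X := by gcongr; nlinarith
          have e4 := mul_le_mul hK74 e2 (by positivity) (by positivity)
          linarith
      _ = _ := by ring
  have h2 : T * ((N + s) * s * w) ≤ 3 * K * Q ^ (7 / 6 - 4 * c / 3 + κ) := by
    have e : Q ^ (7 / 6 - 4 * c / 3 + κ) = Q ^ (1 / 6 - c / 3) * (Q * Q ^ κ * Q ^ (-c)) := by
      rw [← Real.rpow_one_add' hQ0.le, ← Real.rpow_add hQ0, ← Real.rpow_add hQ0]
      · ring_nf
      · rw [hκ]; linarith
    rw [hT, hw, e]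
    calc Q ^ (1 / 6 - c / 3) * ((N + s) * s * (K * Q ^ (-c)))
        ≤ Q ^ (1 / 6 - c / 3) * ((3 * Q) * Q ^ κ * (K * Q ^ (-c))) := by
          gcongr
          linarith
      _ = _ := by ring
  have h3 : (Q * D) ^ (3 / 4 : ℝ) ≤ Q ^ ((1 - κ) * (3 / 4)) + K * Q ^ ((1 + κ - c) * (3 / 4)) := by
    calc (Q * D) ^ (3 / 4 : ℝ) ≤ (Q ^ (1 - κ) + K * Q ^ (1 + κ - c)) ^ (3 / 4 : ℝ) := by gcongr
      _ ≤ (Q ^ (1 - κ)) ^ (3 / 4 : ℝ) + (K * Q ^ (1 + κ - c)) ^ (3 / 4 : ℝ) :=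
          Real.rpow_add_le_add_rpow (by positivity) (by positivity) (by norm_num) (by norm_num)
      _ ≤ _ := by
          rw [Real.mul_rpow hK0.le (by positivity), ← Real.rpow_mul hQ0.le, ← Real.rpow_mul hQ0.le]
          gcongr
  have h4 : (Q * D) ^ (3 / 4 : ℝ) ≤ Q ^ ((1 - κ) * (3 / 4)) + K * s * Q ^ ((1 - c) * (3 / 4)) := by
    calc (Q * D) ^ (3 / 4 : ℝ) = (Q ^ (1 - κ) + K * s * Q ^ (1 - c)) ^ (3 / 4 : ℝ) := by rw [hQD]
      _ ≤ (Q ^ (1 - κ)) ^ (3 / 4 : ℝ) + (K * s * Q ^ (1 - c)) ^ (3 / 4 : ℝ) :=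
          Real.rpow_add_le_add_rpow (by positivity) (by positivity) (by norm_num) (by norm_num)
      _ ≤ _ := by
          have hs34 : s ^ (3 / 4 : ℝ) ≤ s := by
            have := Real.rpow_le_rpow_of_exponent_le hs (by norm_num : (3 / 4 : ℝ) ≤ 1)
            rwa [Real.rpow_one] at this
          rw [Real.mul_rpow (by positivity) (by positivity), Real.mul_rpow hK0.le (by positivity),
            ← Real.rpow_mul hQ0.le, ← Real.rpow_mul hQ0.le]
          gcongr
  have h5 : (Q * D) ^ (3 / 4 : ℝ) * (T * ((N + s) * s * w)) ≤ 6 * K ^ 2 * X := by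
    calc (Q * D) ^ (3 / 4 : ℝ) * (T * ((N + s) * s * w))
        ≤ (Q ^ ((1 - κ) * (3 / 4)) + K * Q ^ ((1 + κ - c) * (3 / 4))) *
          (3 * K * Q ^ (7 / 6 - 4 * c / 3 + κ)) := by
          refine mul_le_mul h3 h2 ?_ (by positivity)
          rw [hT, hw]; positivity
      _ = 3 * K * (Q ^ ((1 - κ) * (3 / 4) + (7 / 6 - 4 * c / 3 + κ)) +
          K * Q ^ ((1 + κ - c) * (3 / 4) + (7 / 6 - 4 * c / 3 + κ))) := by
          rw [Real.rpow_add hQ0 ((1 - κ) * (3 / 4)), Real.rpow_add hQ0 ((1 + κ - c) * (3 / 4))]; ring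
      _ ≤ 3 * K * (K * X + K * X) := by
          have e1 : Q ^ ((1 - κ) * (3 / 4) + (7 / 6 - 4 * c / 3 + κ)) ≤ X :=
            mon (by rw [hκ]; linarith)
          have e2 : Q ^ ((1 + κ - c) * (3 / 4) + (7 / 6 - 4 * c / 3 + κ)) ≤ X :=
            mon (by rw [hκ]; linarith)
          gcongr
          nlinarith
      _ = _ := by ring
  have h6 : (Q * D) ^ (3 / 4 : ℝ) * (1 + Q / s) ≤ 4 * K * X := by
    have e0 : 1 + Q / s ≤ 2 * (Q / s) := by
      have : 1 ≤ Q / s := by rw [le_div_iff₀ hs0]; linarith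
      linarith
    have e1 : Q ^ (1 + (1 - κ) * (3 / 4)) ≤ X := mon (by rw [hκ]; linarith)
    have e2 : Q ^ (1 + (1 - c) * (3 / 4)) ≤ X := mon (by linarith)
    have e3 : Q / s ≤ Q := div_le_self hQ0.le hs
    calc (Q * D) ^ (3 / 4 : ℝ) * (1 + Q / s)
        ≤ (Q ^ ((1 - κ) * (3 / 4)) + K * s * Q ^ ((1 - c) * (3 / 4))) * (2 * (Q / s)) := by gcongr
      _ = 2 * (Q ^ ((1 - κ) * (3 / 4)) * (Q / s) + K * (Q * Q ^ ((1 - c) * (3 / 4)))) := by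
          field_simp
      _ ≤ 2 * (Q ^ ((1 - κ) * (3 / 4)) * Q + K * (Q * Q ^ ((1 - c) * (3 / 4)))) := by gcongr
      _ = 2 * (Q ^ (1 + (1 - κ) * (3 / 4)) + K * Q ^ (1 + (1 - c) * (3 / 4))) := by
          rw [Real.rpow_add hQ0, Real.rpow_add hQ0, Real.rpow_one]; ring
      _ ≤ 2 * (K * X + K * X) := by
          gcongr
          nlinarith
      _ = _ := by ring
  rw [mul_add ((Q * D) ^ (3 / 4 : ℝ))]
  have : K * X ≤ K ^ 2 * X := by gcongr
  linarith

theorem Set.OrdConnected.sub_le_volume {J : Set ℝ} (hJ : J.OrdConnected) (h2 : volume J ≠ ⊤)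
    {x y : ℝ} (hx : x ∈ J) (hy : y ∈ J) : x - y ≤ (volume J).toReal := by
  rcases le_total x y with h | h
  · linarith [ENNReal.toReal_nonneg (a := volume J)]
  · have h1 := measure_mono (μ := volume) (hJ.out hy hx)
    have h3 := ENNReal.toReal_mono h2 h1
    rwa [Real.volume_Icc, ENNReal.toReal_ofReal (by linarith)] at h3

theorem fareyPts_disc_major (l : ℕ) (hl : 0 < l) {c δ : ℝ} (hc8 : c ≤ 1 / 8) (hδ : 0 < δ) :
    ∃ C : ℝ, 1 ≤ C ∧ ∀ σ : ℤ, IsUnit σ → ∀ (Q : ℕ), 0 < Q → ∀ N : ℝ, 0 ≤ N →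
      ∀ J : Set ℝ, J.OrdConnected → J ⊆ Set.Ioc 0 1 → ∀ k : ℕ, k ≤ Q → ∀ ζ : ℝ, 0 ≤ ζ → ζ ≤ 1 →
      |(((fareyPts l k J).filter fun p => zcoord N σ p.1 p.2 < ζ).card : ℝ) -
        ζ * (fareyPts l k J).card| ≤ C * (Q : ℝ) ^ (11 / 6 - 2 * c / 3 + δ) := by
  obtain ⟨C, hC, hdisc⟩ := zcoord_disc hδ l hl
  refine ⟨3 * C + 2, by linarith, ?_⟩
  intro σ hσ Q hQ N hN J hJ hJs k hkQ ζ h0 h1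
  have hQ0 : (0 : ℝ) < Q := by positivity
  have hQ1 : (1 : ℝ) ≤ Q := by exact_mod_cast hQ
  have hk0 : (0 : ℝ) ≤ k := Nat.cast_nonneg k
  have hkQ' : (k : ℝ) ≤ Q := by exact_mod_cast hkQ
  have hmain := hdisc σ hσ 0 (-1) (-1) 0 (by norm_num) N hN J hJ hJs 1 zero_le_one
    (fun x hx y hy => by linarith [(hJs hx).2, (hJs hy).1]) 1 zero_le_one
    (fun x hx => by simp) k Q hQ0 ζ h0 h1
  refine hmain.trans ?_
  have hcard : ((fareyPts l k J).card : ℝ) ≤ (Q : ℝ) * Q := by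
    have : (fareyPts l k J).card ≤ k * k := by
      classical
      unfold fareyPts
      refine (Finset.card_filter_le _ _).trans ?_
      simp
    have h2 : ((fareyPts l k J).card : ℝ) ≤ (k : ℝ) * k := by exact_mod_cast this
    exact h2.trans (by gcongr)
  set X := (Q : ℝ) ^ (11 / 6 - 2 * c / 3 + δ) with hX
  have mon : ∀ {x y : ℝ}, x ≤ y → (Q : ℝ) ^ x ≤ (Q : ℝ) ^ y :=
    fun h => Real.rpow_le_rpow_of_exponent_le hQ1 h
  have hX1 : (Q : ℝ) ≤ X := by
    refine le_trans (le_of_eq (Real.rpow_one _).symm) (mon (by linarith))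
  have hX2 : (Q : ℝ) ^ δ * (Q : ℝ) ^ (7 / 4 : ℝ) ≤ X := by
    rw [← Real.rpow_add hQ0]
    exact mon (by linarith)
  have h74 : (Q : ℝ) ^ (3 / 4 : ℝ) * Q = (Q : ℝ) ^ (7 / 4 : ℝ) := by
    rw [← Real.rpow_add_one hQ0.ne']; norm_num
  have hT : 1 / (Q : ℝ) * (fareyPts l k J).card ≤ Q := by
    rw [one_div, inv_mul_le_iff₀ hQ0]; exact hcard
  simp only [Int.cast_zero, abs_zero, add_zero, mul_zero, mul_one, zero_add]
  rw [max_eq_left zero_le_one, div_one]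
  have hstep : C * (k : ℝ) ^ δ * ((k : ℝ) ^ (7 / 4 : ℝ) + (k : ℝ) ^ (3 / 4 : ℝ) * (1 + k)) ≤ 3 * C * X := by
    calc C * (k : ℝ) ^ δ * ((k : ℝ) ^ (7 / 4 : ℝ) + (k : ℝ) ^ (3 / 4 : ℝ) * (1 + k))
        ≤ C * (Q : ℝ) ^ δ * ((Q : ℝ) ^ (7 / 4 : ℝ) + (Q : ℝ) ^ (3 / 4 : ℝ) * (Q + Q)) := by
          gcongr
      _ = 3 * C * ((Q : ℝ) ^ δ * (Q : ℝ) ^ (7 / 4 : ℝ)) := by rw [mul_add ((Q : ℝ) ^ (3 / 4 : ℝ)), h74]; ring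
      _ ≤ 3 * C * X := by gcongr
  linarith

set_option maxHeartbeats 1000000 in
theorem fareyPts_disc_minor (l : ℕ) (hl : 0 < l) {c δ K : ℝ} (hc8 : 1 / 8 ≤ c) (hc2 : c ≤ 1 / 2)
    (hδ : 0 < δ) (hK : 1 ≤ K) :
    ∃ C : ℝ, 1 ≤ C ∧ ∀ σ : ℤ, IsUnit σ → ∀ (Q : ℕ), 0 < Q → ∀ N : ℝ, 0 ≤ N → N ≤ 2 * Q →
      ∀ J : Set ℝ, J.OrdConnected → J ⊆ Set.Ioc 0 1 → (volume J).toReal ≤ K * (Q : ℝ) ^ (-c) →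
      ∀ k : ℕ, k ≤ Q → ∀ ζ : ℝ, 0 ≤ ζ → ζ ≤ 1 →
      |(((fareyPts l k J).filter fun p => zcoord N σ p.1 p.2 < ζ).card : ℝ) -
        ζ * (fareyPts l k J).card| ≤ C * (Q : ℝ) ^ (11 / 6 - 2 * c / 3 + δ) := by
  obtain ⟨C, hC, hdisc⟩ := zcoord_disc hδ l hl
  obtain ⟨C', hC', hcard⟩ := card_fareyPts_le
  have hKδ : 1 ≤ (1 + K) ^ δ := Real.one_le_rpow (by linarith) hδ.le
  refine ⟨C * (1 + K) ^ δ * (18 * K ^ 2) + 1 + K + C', ?_, ?_⟩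
  · have : 0 ≤ C * (1 + K) ^ δ * (18 * K ^ 2) := by positivity
    linarith
  intro σ hσ Q hQ N hN hNQ J hJ hJs hJv k hkQ ζ h0 h1
  have hQ0 : (0 : ℝ) < Q := by positivity
  have hQ1 : (1 : ℝ) ≤ Q := by exact_mod_cast hQ
  have hk0 : (0 : ℝ) ≤ k := Nat.cast_nonneg k
  have hkQ' : (k : ℝ) ≤ Q := by exact_mod_cast hkQ
  have hK0 : 0 < K := by linarith
  rcases J.eq_empty_or_nonempty with rfl | ⟨γ, hγ⟩
  · have : fareyPts l k ∅ = ∅ := by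
      ext p; simp [mem_fareyPts]
    rw [this]
    simp
    positivity
  set κ : ℝ := (8 * c - 1) / 9 with hκ
  have hκ0 : 0 ≤ κ := by rw [hκ]; linarith
  have mon : ∀ {x y : ℝ}, x ≤ y → (Q : ℝ) ^ x ≤ (Q : ℝ) ^ y :=
    fun h => Real.rpow_le_rpow_of_exponent_le hQ1 h
  have hn : 0 < ⌊(Q : ℝ) ^ κ⌋₊ := Nat.floor_pos.mpr (Real.one_le_rpow hQ1 hκ0)
  obtain ⟨ρ, hρ, hρd⟩ := Real.exists_rat_abs_sub_le_and_den_le γ hn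
  have hs1 : (1 : ℝ) ≤ (ρ.den : ℝ) := by exact_mod_cast ρ.den_pos
  have hsκ : (ρ.den : ℝ) ≤ (Q : ℝ) ^ κ :=
    (Nat.cast_le.mpr hρd).trans (Nat.floor_le (by positivity))
  set s : ℝ := (ρ.den : ℝ) with hs
  have hcop : IsCoprime (ρ.den : ℤ) ρ.num := by
    rw [Int.isCoprime_iff_gcd_eq_one, Int.gcd_comm]
    exact ρ.reduced
  obtain ⟨v, u, huv⟩ := hcop
  set D : ℝ := (Q : ℝ) ^ (-κ) + K * s * (Q : ℝ) ^ (-c) with hD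
  set w : ℝ := K * (Q : ℝ) ^ (-c) with hw
  set T : ℝ := (Q : ℝ) ^ (1 / 6 - c / 3) with hT
  have hT0 : 0 < T := by positivity
  have hD0 : 0 ≤ D := by positivity
  have hfin : volume J ≠ ⊤ := ne_top_of_le_ne_top (by simp) (measure_mono hJs)
  have hdiam : ∀ x ∈ J, ∀ y ∈ J, x - y ≤ w := fun x hx y hy => (hJ.sub_le_volume hfin hx hy).trans hJv
  have hγρ : |s * γ - ρ.num| ≤ (Q : ℝ) ^ (-κ) := by
    have e1 : s * γ - ρ.num = s * (γ - ρ) := by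
      have : (ρ : ℝ) = ρ.num / s := Rat.cast_def ρ
      rw [this]; field_simp
    rw [e1, abs_mul, abs_of_nonneg (by linarith)]
    have hfl : (Q : ℝ) ^ κ ≤ (⌊(Q : ℝ) ^ κ⌋₊ : ℝ) + 1 := (Nat.lt_floor_add_one _).le
    have hQκ : 0 < (Q : ℝ) ^ κ := by positivity
    calc s * |γ - ρ| ≤ s * (1 / (((⌊(Q : ℝ) ^ κ⌋₊ : ℝ) + 1) * s)) := by gcongr
      _ = 1 / ((⌊(Q : ℝ) ^ κ⌋₊ : ℝ) + 1) := by field_simp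
      _ ≤ 1 / (Q : ℝ) ^ κ := by gcongr
      _ = _ := by rw [Real.rpow_neg hQ0.le, one_div]
  have hJD : ∀ x ∈ J, |((ρ.den : ℤ) : ℝ) * x - (ρ.num : ℝ)| ≤ D := by
    intro x hx
    rw [Int.cast_natCast, ← hs]
    have e1 : s * x - ρ.num = (s * γ - ρ.num) + s * (x - γ) := by ring
    rw [e1, hD]
    refine (abs_add_le _ _).trans (add_le_add hγρ ?_)
    rw [abs_mul, abs_of_nonneg (by linarith : 0 ≤ s), mul_comm K s, mul_assoc]
    gcongr
    rw [abs_le]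
    constructor <;> linarith [hdiam x hx γ hγ, hdiam γ hγ x hx]
  have hmain := hdisc σ hσ (ρ.den : ℤ) ρ.num u v (by linear_combination huv) N hN J hJ hJs w (by positivity)
    hdiam D hD0 hJD k T hT0 ζ h0 h1
  refine hmain.trans ?_
  rw [Int.cast_natCast, ← hs, abs_of_nonneg (by linarith : 0 ≤ s), max_eq_right hs1]
  have herr := dirichlet_error_le hQ1 hc8 hc2 hκ hK hs1 hsκ hD hT hN hNQ hw
  set X := (Q : ℝ) ^ (11 / 6 - 2 * c / 3) with hX
  have hX1 : 1 ≤ X := Real.one_le_rpow hQ1 (by linarith)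
  have hXδ : (Q : ℝ) ^ (11 / 6 - 2 * c / 3 + δ) = (Q : ℝ) ^ δ * X := by
    rw [← Real.rpow_add hQ0, add_comm]
  have hQδ : 1 ≤ (Q : ℝ) ^ δ := Real.one_le_rpow hQ1 hδ.le
  have hD1 : D ≤ 1 + K := by
    have e1 : (Q : ℝ) ^ (-κ) ≤ 1 := by
      have := mon (by linarith : -κ ≤ 0)
      rwa [Real.rpow_zero] at this
    have e2 : s * (Q : ℝ) ^ (-c) ≤ 1 := by
      have e3 : s * (Q : ℝ) ^ (-c) ≤ (Q : ℝ) ^ κ * (Q : ℝ) ^ (-c) := by gcongr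
      rw [← Real.rpow_add hQ0] at e3
      have := mon (by rw [hκ]; linarith : κ + -c ≤ 0)
      rw [Real.rpow_zero] at this
      linarith
    rw [hD, mul_assoc]
    nlinarith
  have hstep : C * ((k : ℝ) * D) ^ δ * (((k : ℝ) * D) ^ (7 / 4 : ℝ) + ((k : ℝ) * D) ^ (3 / 4 : ℝ) *
      (T * ((N + s) * s * w) + (1 + k / s))) ≤ C * (1 + K) ^ δ * (18 * K ^ 2) * ((Q : ℝ) ^ δ * X) := by
    have hw0 : 0 ≤ w := by positivity
    have hs0 : 0 < s := by linarith
    calc C * ((k : ℝ) * D) ^ δ * (((k : ℝ) * D) ^ (7 / 4 : ℝ) + ((k : ℝ) * D) ^ (3 / 4 : ℝ) *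
          (T * ((N + s) * s * w) + (1 + k / s)))
        ≤ C * ((Q : ℝ) * (1 + K)) ^ δ * (((Q : ℝ) * D) ^ (7 / 4 : ℝ) + ((Q : ℝ) * D) ^ (3 / 4 : ℝ) *
          (T * ((N + s) * s * w) + (1 + Q / s))) := by gcongr
      _ ≤ C * ((Q : ℝ) * (1 + K)) ^ δ * (18 * K ^ 2 * X) := by gcongr
      _ = _ := by rw [Real.mul_rpow hQ0.le (by linarith)]; ring
  have hcard2 : 1 / T * ((fareyPts l k J).card : ℝ) ≤ (K + C') * ((Q : ℝ) ^ δ * X) := by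
    have e0 : ((fareyPts l k J).card : ℝ) ≤ K * (Q : ℝ) ^ (2 - c) + C' * (Q : ℝ) ^ (3 / 2 : ℝ) := by
      have hsub : fareyPts l k J ⊆ fareyPts l Q J := by
        intro p hp
        rw [mem_fareyPts] at hp ⊢
        refine ⟨⟨⟨hp.1.1.1, ?_⟩, hp.1.2.1, ?_⟩, hp.2⟩ <;> omega
      refine (Nat.cast_le.mpr (Finset.card_le_card hsub)).trans ((hcard J hJ hJs l hl Q hQ).trans ?_)
      have : (Q : ℝ) ^ (2 - c) = (Q : ℝ) ^ (-c) * (Q : ℝ) ^ 2 := by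
        rw [← Real.rpow_two, ← Real.rpow_add hQ0]; ring_nf
      rw [this, ← mul_assoc]
      gcongr
    have e1 : 1 / T = (Q : ℝ) ^ (c / 3 - 1 / 6) := by
      rw [hT, one_div, ← Real.rpow_neg hQ0.le]; ring_nf
    have e2 : (Q : ℝ) ^ (c / 3 - 1 / 6) * (Q : ℝ) ^ (2 - c) ≤ X := by
      rw [← Real.rpow_add hQ0]; exact mon (by linarith)
    have e3 : (Q : ℝ) ^ (c / 3 - 1 / 6) * (Q : ℝ) ^ (3 / 2 : ℝ) ≤ X := by
      rw [← Real.rpow_add hQ0]; exact mon (by linarith)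
    have e4 : X ≤ (Q : ℝ) ^ δ * X := by nlinarith
    rw [e1]
    calc (Q : ℝ) ^ (c / 3 - 1 / 6) * ((fareyPts l k J).card : ℝ)
        ≤ (Q : ℝ) ^ (c / 3 - 1 / 6) * (K * (Q : ℝ) ^ (2 - c) + C' * (Q : ℝ) ^ (3 / 2 : ℝ)) := by gcongr
      _ = K * ((Q : ℝ) ^ (c / 3 - 1 / 6) * (Q : ℝ) ^ (2 - c))
          + C' * ((Q : ℝ) ^ (c / 3 - 1 / 6) * (Q : ℝ) ^ (3 / 2 : ℝ)) := by ring
      _ ≤ K * X + C' * X := by gcongr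
      _ = (K + C') * X := by ring
      _ ≤ _ := by gcongr
  have hone : 1 ≤ (Q : ℝ) ^ δ * X := by nlinarith
  rw [hXδ]
  linarith

/-- The total length, in the slope variable, of the free intervals attached to the fractions counted
by `fareyPts l Q J`. -/
noncomputable def gapSum (l Q : ℕ) (ε N : ℝ) (σ : ℤ) (J : Set ℝ) : ℝ :=
  ∑ p ∈ fareyPts l Q J, (1 - ε * p.2) / (p.2 * (N - p.2 * zcoord N σ p.1 p.2))

theorem fareyPts_disc (l : ℕ) (hl : 0 < l) {c δ K : ℝ} (hc2 : c ≤ 1 / 2)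
    (hδ : 0 < δ) (hK : 1 ≤ K) :
    ∃ C : ℝ, 1 ≤ C ∧ ∀ σ : ℤ, IsUnit σ → ∀ (Q : ℕ), 0 < Q → ∀ N : ℝ, 0 ≤ N → N ≤ 2 * Q →
      ∀ J : Set ℝ, J.OrdConnected → J ⊆ Set.Ioc 0 1 → (volume J).toReal ≤ K * (Q : ℝ) ^ (-c) →
      ∀ k : ℕ, k ≤ Q → ∀ ζ : ℝ, 0 ≤ ζ → ζ ≤ 1 →
      |(((fareyPts l k J).filter fun p => zcoord N σ p.1 p.2 < ζ).card : ℝ) -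
        ζ * (fareyPts l k J).card| ≤ C * (Q : ℝ) ^ (11 / 6 - 2 * c / 3 + δ) := by
  rcases le_total c (1 / 8) with h | h
  · obtain ⟨C, hC, H⟩ := fareyPts_disc_major l hl h hδ
    exact ⟨C, hC, fun σ hσ Q hQ N hN _ J hJ hJs _ => H σ hσ Q hQ N hN J hJ hJs⟩
  · exact fareyPts_disc_minor l hl h hc2 hδ hK

theorem fareyPts_filter_le {l Q k : ℕ} (hk : k ≤ Q) {J : Set ℝ} (hJs : J ⊆ Set.Ioc 0 1) :
    ((fareyPts l Q J).filter fun p => p.2 ≤ (k : ℤ)) = fareyPts l k J := by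
  ext p
  rw [Finset.mem_filter, mem_fareyPts, mem_fareyPts]
  constructor
  · rintro ⟨⟨⟨⟨h1, -⟩, h3, -⟩, h5, h6⟩, h7⟩
    refine ⟨⟨⟨h1, ?_⟩, h3, h7⟩, h5, h6⟩
    have hq : (0 : ℝ) < p.2 := by exact_mod_cast h3
    have := (hJs h5).2
    rw [div_le_one hq] at this
    have h8 : p.1 ≤ p.2 := by exact_mod_cast this
    omega
  · rintro ⟨⟨⟨h1, h2⟩, h3, h7⟩, h5, h6⟩
    refine ⟨⟨⟨⟨h1, ?_⟩, h3, ?_⟩, h5, h6⟩, h7⟩ <;> omega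

theorem gapSum_sub_le (l : ℕ) (hl : 2 ≤ l) {c δ K lam₀ : ℝ} (hc2 : c ≤ 1 / 2)
    (hδ : 0 < δ) (hK : 1 ≤ K) (hlam₀ : 1 < lam₀) :
    ∃ C : ℝ, 1 ≤ C ∧ ∀ σ : ℤ, IsUnit σ → ∀ lam : ℝ, lam₀ ≤ lam → lam ≤ 2 →
      ∀ (Q : ℕ) (ε : ℝ), 0 < Q → ε * Q ≤ 1 → 1 ≤ ε * (Q + 1) →
      ∀ J : Set ℝ, J.OrdConnected → J ⊆ Set.Ioc 0 1 → (volume J).toReal ≤ K * (Q : ℝ) ^ (-c) →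
      |gapSum l Q ε (lam * Q) σ J -
        Cconst l / l * (∫ u in (0 : ℝ)..1, ((1 - u) / u) * Real.log (lam / (lam - u))) *
          (volume J).toReal| ≤ C * (Q : ℝ) ^ (-(1 / 6 + 2 * c / 3) + δ) := by
  obtain ⟨C₁, hC₁, hdisc⟩ := fareyPts_disc l (by omega) hc2 hδ hK
  obtain ⟨C₂, hC₂, hmain⟩ := main_sum_le l hl hlam₀
  have hm : 0 < lam₀ - 1 := by linarith
  refine ⟨4 * C₁ / (lam₀ - 1) ^ 2 + C₂, ?_, ?_⟩
  · have : 0 ≤ 4 * C₁ / (lam₀ - 1) ^ 2 := by positivity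
    linarith
  intro σ hσ lam hlam hlam2 Q ε hQ hε1 hε2 J hJ hJs hJv
  have hQ0 : (0 : ℝ) < Q := by positivity
  have hQ1 : (1 : ℝ) ≤ Q := by exact_mod_cast hQ
  have hε0 : 0 ≤ ε := by
    by_contra h
    push Not at h
    nlinarith
  have hN : (Q : ℝ) < lam * Q := by nlinarith
  have hS := sum_sub_integral_le_of_disc (E := C₁ * (Q : ℝ) ^ (11 / 6 - 2 * c / 3 + δ)) hε0 hε1 hN
    (fareyPts l Q J) (fun p hp => (mem_fareyPts.mp hp).1.2) (fun p => zcoord (lam * Q) σ p.1 p.2)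
    (fun p hp => ⟨Int.fract_nonneg _, Int.fract_lt_one _⟩)
    (fun k hk ζ h0 h1 => by
      rw [fareyPts_filter_le hk hJs]
      exact hdisc σ hσ Q hQ (lam * Q) (by linarith) (by nlinarith) J hJ hJs hJv k hk ζ h0 h1)
  have hM := hmain lam hlam Q ε hQ hε1 hε2 J hJ hJs
  have e1 : 4 * (C₁ * (Q : ℝ) ^ (11 / 6 - 2 * c / 3 + δ)) / (lam * Q - Q) ^ 2 ≤
      4 * C₁ / (lam₀ - 1) ^ 2 * (Q : ℝ) ^ (-(1 / 6 + 2 * c / 3) + δ) := by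
    have hX : (Q : ℝ) ^ (11 / 6 - 2 * c / 3 + δ) = (Q : ℝ) ^ (-(1 / 6 + 2 * c / 3) + δ) * (Q : ℝ) ^ 2 := by
      rw [← Real.rpow_two, ← Real.rpow_add hQ0]; ring_nf
    have h2 : (lam₀ - 1) ^ 2 * (Q : ℝ) ^ 2 ≤ (lam * Q - Q) ^ 2 := by
      rw [← mul_pow]
      apply pow_le_pow_left₀ (by positivity)
      nlinarith
    rw [hX]
    calc 4 * (C₁ * ((Q : ℝ) ^ (-(1 / 6 + 2 * c / 3) + δ) * (Q : ℝ) ^ 2)) / (lam * Q - Q) ^ 2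
        ≤ 4 * (C₁ * ((Q : ℝ) ^ (-(1 / 6 + 2 * c / 3) + δ) * (Q : ℝ) ^ 2)) / ((lam₀ - 1) ^ 2 * (Q : ℝ) ^ 2) :=
          div_le_div_of_nonneg_left (by positivity) (by positivity) h2
      _ = _ := by field_simp
  have e2 : C₂ * (Q : ℝ) ^ (-(1 / 2) : ℝ) ≤ C₂ * (Q : ℝ) ^ (-(1 / 6 + 2 * c / 3) + δ) :=
    mul_le_mul_of_nonneg_left (Real.rpow_le_rpow_of_exponent_le hQ1 (by linarith)) (by linarith)
  unfold gapSum
  have := abs_sub_le (∑ p ∈ fareyPts l Q J, (1 - ε * p.2) / (p.2 * (lam * Q - p.2 * zcoord (lam * Q) σ p.1 p.2)))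
    (∑ p ∈ fareyPts l Q J, (1 - ε * p.2) * (∫ ζ in (0 : ℝ)..1, 1 / ((p.2 : ℝ) * (lam * Q - p.2 * ζ))))
    (Cconst l / l * (∫ u in (0 : ℝ)..1, ((1 - u) / u) * Real.log (lam / (lam - u))) * (volume J).toReal)
  rw [add_mul]
  linarith

theorem mem_Zl_add_Vseg {l : ℕ} {ε x y : ℝ} : (x, y) ∈ Zl l + Vseg ε ↔
    ∃ m n : ℤ, x = m ∧ |y - n| ≤ ε ∧ ¬ (l : ℤ) ∣ m - n := by
  constructor
  · rintro ⟨-, ⟨m, n, rfl, hmn⟩, ⟨v₁, v₂⟩, ⟨h1, h2, h3⟩, h⟩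
    simp only [Set.mem_singleton_iff] at h1 h2 h3
    change ((m : ℝ), (n : ℝ)) + (v₁, v₂) = (x, y) at h
    rw [Prod.mk_add_mk, Prod.mk.injEq] at h
    refine ⟨m, n, by rw [← h.1, h1, add_zero], ?_, hmn⟩
    rw [← h.2, add_sub_cancel_left]
    exact abs_le.mpr ⟨h2, h3⟩
  · rintro ⟨m, n, rfl, h, hmn⟩
    refine ⟨(m, n), ⟨m, n, rfl, hmn⟩, (0, y - n), ⟨rfl, abs_le.mp h⟩, ?_⟩
    simp

theorem ofReal_lt_qfree_iff {l : ℕ} {ε ω N : ℝ} (hN : 0 ≤ N) : ENNReal.ofReal N < qfree l ε ω ↔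
    ∀ m n : ℤ, 0 < m → |m * Real.tan ω - n| ≤ ε → ¬ (l : ℤ) ∣ m - n → N < m := by
  constructor
  · intro h m n hm hmn hl
    have hm' : (0 : ℝ) < m := by exact_mod_cast hm
    have h1 : qfree l ε ω ≤ ENNReal.ofReal m :=
      iInf_le (fun q : {q : ℝ // 0 < q ∧ (q, q * Real.tan ω) ∈ Zl l + Vseg ε} => ENNReal.ofReal q.1)
        ⟨(m : ℝ), hm', mem_Zl_add_Vseg.mpr ⟨m, n, rfl, hmn, hl⟩⟩
    exact (ENNReal.ofReal_lt_ofReal_iff hm').mp (h.trans_le h1)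
  · intro h
    have h1 : ENNReal.ofReal ((⌊N⌋ : ℝ) + 1) ≤ qfree l ε ω := by
      refine le_iInf ?_
      rintro ⟨x, hx, hxm⟩
      obtain ⟨m, n, rfl, hmn, hl⟩ := mem_Zl_add_Vseg.mp hxm
      have h2 := h m n (by exact_mod_cast hx) hmn hl
      apply ENNReal.ofReal_le_ofReal
      have h3 : ⌊N⌋ + 1 ≤ m := Int.floor_lt.mpr h2
      change (⌊N⌋ : ℝ) + 1 ≤ (m : ℝ)
      exact_mod_cast h3
    refine lt_of_lt_of_le ?_ h1
    exact (ENNReal.ofReal_lt_ofReal_iff (hN.trans_lt (Int.lt_floor_add_one N))).mpr (Int.lt_floor_add_one N)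

theorem exists_nat_abs_sub_mul_le {x y ε : ℝ} (hy : 0 ≤ y) (hx : ε < y → x ≤ ε) (k : ℕ)
    (hk : y - k * x ≤ ε) : ∃ i : ℕ, i ≤ k ∧ |y - i * x| ≤ ε := by
  induction k with
  | zero =>
    refine ⟨0, le_rfl, ?_⟩
    simp only [Nat.cast_zero, zero_mul, sub_zero] at hk ⊢
    rwa [abs_of_nonneg hy]
  | succ k ih =>
    by_cases h : y - k * x ≤ ε
    · obtain ⟨i, hi, h⟩ := ih h
      exact ⟨i, by omega, h⟩
    · push Not at h
      by_cases h2 : ε < y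
      · refine ⟨k + 1, le_rfl, ?_⟩
        rw [abs_le]
        refine ⟨?_, hk⟩
        have := hx h2
        push_cast at hk ⊢
        linarith
      · refine ⟨0, by omega, ?_⟩
        simp only [Nat.cast_zero, zero_mul, sub_zero]
        rw [abs_of_nonneg hy]
        linarith

theorem isUnit_cast_mul_self {σ : ℤ} (hσ : IsUnit σ) : (σ : ℝ) * σ = 1 := by
  rcases Int.isUnit_iff.mp hσ with rfl | rfl <;> norm_num

theorem abs_cast_isUnit {σ : ℤ} (hσ : IsUnit σ) : |(σ : ℝ)| = 1 := by
  rcases Int.isUnit_iff.mp hσ with rfl | rfl <;> norm_num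

/-- A slope slightly beyond `a / q` meets an obstacle of abscissa at most `N` as soon as it is within
`ε` of, or beyond, the lattice point `(X, B)`. -/
theorem exists_obstacle {l : ℕ} (hl : 2 ≤ l) {σ a q x b : ℤ} {k : ℕ} {ε t : ℝ} (hσ : IsUnit σ)
    (hq : 0 < q) (hx : 0 < x) (hla : (l : ℤ) ∣ q - a) (hdet : b * q - a * x = σ)
    (hxq : 1 ≤ ε * (q + x)) (ht : 0 < σ * (b - t * x))
    (hk : σ * ((b + k * a : ℝ) - t * (x + k * q)) ≤ ε) :
    ∃ m n : ℤ, 0 < m ∧ m ≤ x + k * q ∧ |m * t - n| ≤ ε ∧ ¬ (l : ℤ) ∣ m - n := by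
  have hσ2 := isUnit_cast_mul_self hσ
  have hdet' : (b : ℝ) * q - a * x = σ := by exact_mod_cast hdet
  have hx' : (0 : ℝ) < x := by exact_mod_cast hx
  have hrel : (x : ℝ) * (σ * (t * q - a)) + q * (σ * (b - t * x)) = 1 := by
    linear_combination σ * hdet' + hσ2
  obtain ⟨i, hi, h⟩ := exists_nat_abs_sub_mul_le (x := σ * (t * q - a)) (y := σ * (b - t * x)) (ε := ε)
    ht.le (fun h => by
      have hq' : (0 : ℝ) < q := by exact_mod_cast hq
      have h1 : (q : ℝ) * ε < q * (σ * (b - t * x)) := mul_lt_mul_of_pos_left h hq'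
      have h2 : (x : ℝ) * (σ * (t * q - a)) ≤ x * ε := by linarith
      exact le_of_mul_le_mul_left h2 hx') k (by linarith)
  refine ⟨x + i * q, b + i * a, by positivity, ?_, ?_, ?_⟩
  · have : (i : ℤ) * q ≤ k * q := mul_le_mul_of_nonneg_right (by exact_mod_cast hi) hq.le
    linarith
  · push_cast
    have e : (x + i * q) * t - (b + i * a : ℝ) = -(σ * (σ * (b - t * x) - i * (σ * (t * q - a)))) := by
      linear_combination (-(x + i * q) * t + (b + i * a : ℝ)) * hσ2
    rw [e, abs_neg, abs_mul, abs_cast_isUnit hσ, one_mul]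
    exact h
  · intro hd
    have h1 : (l : ℤ) ∣ σ := by
      obtain ⟨e, he⟩ := hd
      obtain ⟨f, hf⟩ := hla
      exact ⟨b * f - a * (e - i * f), by rw [← hdet]; linear_combination b * hf - a * he + a * i * hf⟩
    have h2 := Int.isUnit_iff_natAbs_eq.mp (isUnit_of_dvd_unit h1 hσ)
    simp at h2
    omega

theorem not_exists_obstacle {l : ℕ} {σ a q X B : ℤ} {ε t N : ℝ} (hσ : IsUnit σ) (hq : 0 < q)
    (hX : 0 < X) (hXN : N < X + q) (hla : (l : ℤ) ∣ q - a) (hdet : B * q - a * X = σ)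
    (ht : 0 < σ * (t * q - a)) (hε : 0 ≤ ε) (hY : ε < σ * (B - t * X)) {m n : ℤ} (hm : 0 < m)
    (hmn : |m * t - n| ≤ ε) (hl : ¬ (l : ℤ) ∣ m - n) : N < m := by
  by_contra hcon
  push Not at hcon
  have hσ2 := isUnit_cast_mul_self hσ
  have hσ3 : σ * σ = 1 := by exact_mod_cast hσ2
  have hdet' : (B : ℝ) * q - a * X = σ := by exact_mod_cast hdet
  obtain ⟨i, hi⟩ : ∃ i, i = σ * (m * B - n * X) := ⟨_, rfl⟩
  obtain ⟨j, hj⟩ : ∃ j, j = σ * (n * q - m * a) := ⟨_, rfl⟩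
  have em : m = i * q + j * X := by rw [hi, hj]; linear_combination -σ * m * hdet - m * hσ3
  have en : n = i * a + j * B := by rw [hi, hj]; linear_combination -σ * n * hdet - n * hσ3
  have em' : (m : ℝ) = i * q + j * X := by exact_mod_cast em
  have en' : (n : ℝ) = i * a + j * B := by exact_mod_cast en
  have hres : |i * (σ * (t * q - a)) - j * (σ * (B - t * X))| ≤ ε := by
    have : m * t - n = σ * (i * (σ * (t * q - a)) - j * (σ * (B - t * X))) := by
      rw [em', en']
      linear_combination (-(i * (t * q - a)) + j * (B - t * X)) * hσ2
    rwa [this, abs_mul, abs_cast_isUnit hσ, one_mul] at hmn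
  have hmX : m < X + q := by
    have : (m : ℝ) < X + q := by linarith
    exact_mod_cast this
  rw [abs_le] at hres
  rcases lt_trichotomy j 0 with h | h | h
  · have hi1 : 1 ≤ i := by
      by_contra hh
      push Not at hh
      nlinarith
    have hi1' : (1 : ℝ) ≤ i := by exact_mod_cast hi1
    have hj1' : (j : ℝ) ≤ -1 := by exact_mod_cast (by omega : j ≤ -1)
    nlinarith
  · apply hl
    obtain ⟨e, he⟩ := hla
    exact ⟨i * e, by rw [em, en, h]; linear_combination i * he⟩
  · have hi1 : i ≤ 0 := by
      by_contra hh
      push Not at hh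
      nlinarith
    have hi1' : (i : ℝ) ≤ 0 := by exact_mod_cast hi1
    have hj1' : (1 : ℝ) ≤ j := by exact_mod_cast h
    nlinarith

/-- `γ'` is the neighbour of `γ` in `FareyQ Q`, on the right if `σ = 1` and on the left if
`σ = -1`. -/
def FareyNbr (Q : ℕ) (σ : ℤ) (γ γ' : ℚ) : Prop :=
  γ ∈ FareyQ Q ∧ γ' ∈ FareyQ Q ∧ 0 < σ * (γ' - γ) ∧
    ∀ z ∈ FareyQ Q, ¬ (0 < σ * (z - γ) ∧ 0 < σ * (γ' - z))

theorem fareyNbr_one {Q : ℕ} {γ γ' : ℚ} : FareyNbr Q 1 γ γ' ↔ ConsecFarey Q γ γ' := by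
  simp [FareyNbr, ConsecFarey]

theorem fareyNbr_neg_one {Q : ℕ} {γ γ' : ℚ} : FareyNbr Q (-1) γ γ' ↔ ConsecFarey Q γ' γ := by
  simp only [FareyNbr, ConsecFarey, Int.cast_neg, Int.cast_one, neg_one_mul, neg_sub, sub_pos]
  constructor
  · rintro ⟨h1, h2, h3, h4⟩
    exact ⟨h2, h1, h3, fun z hz h => h4 z hz h.symm⟩
  · rintro ⟨h1, h2, h3, h4⟩
    exact ⟨h2, h1, h3, fun z hz h => h4 z hz h.symm⟩

theorem exists_zcoord_repr (N : ℝ) (σ : ℤ) {a q : ℤ} (hq : 0 < q) (h : Int.gcd a q = 1) :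
    ∃ X B : ℤ, (X : ℝ) = N - q * zcoord N σ a q ∧ B * q - a * X = σ := by
  have hq' : (q : ℝ) ≠ 0 := by exact_mod_cast hq.ne'
  have hb := Int.gcd_eq_gcd_ab a q
  rw [h] at hb
  push_cast at hb
  refine ⟨-σ * Int.gcdA a q + q * ⌊(N + σ * Int.gcdA a q) / q⌋,
    σ * Int.gcdB a q + a * ⌊(N + σ * Int.gcdA a q) / q⌋, ?_, ?_⟩
  · rw [zcoord, Int.fract]
    push_cast
    field_simp
    ring
  · linear_combination -σ * hb

theorem fareyNbr_det {Q : ℕ} {σ : ℤ} (hσ : IsUnit σ) {γ γ' : ℚ} (h : FareyNbr Q σ γ γ') :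
    γ'.num * γ.den - γ.num * γ'.den = σ ∧ (Q : ℤ) < γ.den + γ'.den := by
  obtain ⟨hγ, hγ', hlt, hno⟩ := h
  have hσ3 : σ * σ = 1 := Int.isUnit_mul_self hσ
  have hq : (0 : ℤ) < γ.den := by exact_mod_cast γ.den_pos
  have hqQ : (γ.den : ℤ) ≤ Q := by exact_mod_cast hγ.2.2
  have hx'Q : (γ'.den : ℤ) ≤ Q := by exact_mod_cast hγ'.2.2
  have hx' : (0 : ℤ) < γ'.den := by exact_mod_cast γ'.den_pos
  obtain ⟨x, b, hx, hdet⟩ := exists_zcoord_repr (Q : ℝ) σ (a := γ.num) hq γ.reduced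
  have hz0 : 0 ≤ zcoord Q σ γ.num γ.den := Int.fract_nonneg _
  have hz1 : zcoord Q σ γ.num γ.den < 1 := Int.fract_lt_one _
  have hqr : (0 : ℝ) < ((γ.den : ℤ) : ℝ) := by exact_mod_cast hq
  have hxQ : x ≤ Q := by
    have : (x : ℝ) ≤ Q := by nlinarith
    exact_mod_cast this
  have hxq : (Q : ℤ) < x + γ.den := by
    have : (Q : ℝ) < x + (γ.den : ℤ) := by nlinarith
    exact_mod_cast this
  have hx0 : 0 < x := by omega
  obtain ⟨q, hqd⟩ : ∃ q : ℤ, q = γ.den := ⟨_, rfl⟩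
  obtain ⟨x', hxd⟩ : ∃ q : ℤ, q = γ'.den := ⟨_, rfl⟩
  obtain ⟨a, ha⟩ : ∃ q : ℤ, q = γ.num := ⟨_, rfl⟩
  obtain ⟨b', hb⟩ : ∃ q : ℤ, q = γ'.num := ⟨_, rfl⟩
  have hγd : γ = a / q := by rw [ha, hqd]; exact (Rat.num_div_den γ).symm
  have hγd' : γ' = b' / x' := by rw [hb, hxd]; exact (Rat.num_div_den γ').symm
  rw [← hqd] at hq hqQ hdet hxq ⊢
  rw [← hxd] at hx' hx'Q ⊢
  rw [← ha] at hdet ⊢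
  rw [← hb]
  have hcop : IsCoprime b' x' := by
    rw [Int.isCoprime_iff_gcd_eq_one, hb, hxd]; exact γ'.reduced
  have hqq : (0 : ℚ) < q := by exact_mod_cast hq
  have hxx : (0 : ℚ) < x' := by exact_mod_cast hx'
  have hx0q : (0 : ℚ) < x := by exact_mod_cast hx0
  obtain ⟨i, hi⟩ : ∃ i, i = σ * (x' * b - b' * x) := ⟨_, rfl⟩
  obtain ⟨j, hj⟩ : ∃ j, j = σ * (b' * q - x' * a) := ⟨_, rfl⟩
  have em : x' = i * q + j * x := by rw [hi, hj]; linear_combination -σ * x' * hdet - x' * hσ3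
  have en : b' = i * a + j * b := by rw [hi, hj]; linear_combination -σ * b' * hdet - b' * hσ3
  have hj1 : 1 ≤ j := by
    have e : (σ * (γ' - γ) : ℚ) = j / (q * x') := by
      rw [hγd, hγd', hj]; push_cast; field_simp
    rw [e] at hlt
    have : (0 : ℚ) < j := by
      by_contra hh
      push Not at hh
      exact absurd hlt (not_lt.mpr (div_nonpos_of_nonpos_of_nonneg hh (by positivity)))
    exact_mod_cast this
  rcases lt_trichotomy i 0 with h | h | h
  · exfalso
    have h1 : 0 < σ * ((b : ℚ) / x - γ) := by
      have e : σ * ((b : ℚ) / x - γ) = ((σ * (b * q - a * x) : ℤ) : ℚ) / (q * x) := by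
        rw [hγd]; push_cast; field_simp
      rw [e, hdet, hσ3]
      push_cast
      positivity
    have h2 : 0 < σ * (γ' - (b : ℚ) / x) := by
      have e : σ * (γ' - (b : ℚ) / x) = ((-i : ℤ) : ℚ) / (x' * x) := by
        rw [hγd', hi]; push_cast; field_simp; ring
      rw [e]
      have : (0 : ℚ) < ((-i : ℤ) : ℚ) := by exact_mod_cast (by omega : 0 < -i)
      positivity
    refine hno (b / x) ⟨?_, ?_, ?_⟩ ⟨h1, h2⟩
    · rcases Int.isUnit_iff.mp hσ with rfl | rfl
      · push_cast at h1 h2; linarith [hγ.1]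
      · push_cast at h1 h2; linarith [hγ'.1]
    · rcases Int.isUnit_iff.mp hσ with rfl | rfl
      · push_cast at h1 h2; linarith [hγ'.2.1]
      · push_cast at h1 h2; linarith [hγ.2.1]
    · have h3 : (((b : ℚ) / x).den : ℤ) ∣ x := by
        rw [← Rat.divInt_eq_div]; exact Rat.den_dvd b x
      have := Int.le_of_dvd hx0 h3
      omega
  · rw [h, zero_mul, zero_add] at em en
    have hju : IsUnit j := hcop.isUnit_of_dvd' ⟨b, en⟩ ⟨x, em⟩
    have : j = 1 := by
      rcases Int.isUnit_iff.mp hju with h | h <;> omega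
    rw [this, one_mul] at em en
    rw [em, en]
    exact ⟨hdet, by omega⟩
  · exfalso
    nlinarith

/-- The length of the free interval of slopes attached to the fraction `a / q`. -/
noncomputable def gapLen (ε N : ℝ) (σ a q : ℤ) : ℝ := (1 - ε * q) / (q * (N - q * zcoord N σ a q))

theorem free_iff_lt_gapLen {l Q : ℕ} (hl : 2 ≤ l) {σ : ℤ} (hσ : IsUnit σ) {ε N t : ℝ}
    (hε0 : 0 ≤ ε) (hε : 1 ≤ ε * (Q + 1)) (hN : (Q : ℝ) < N) {γ γ' : ℚ}
    (h : FareyNbr Q σ γ γ') (hγ : γ ∈ FareyCong l) (ht : 0 < σ * (t - γ)) :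
    (0 < σ * (γ' - t) ∧ ∀ m n : ℤ, 0 < m → |m * t - n| ≤ ε → ¬ (l : ℤ) ∣ m - n → N < m) ↔
      σ * (t - γ) < gapLen ε N σ γ.num γ.den := by
  obtain ⟨hdet', hQx⟩ := fareyNbr_det hσ h
  have hσ2 := isUnit_cast_mul_self hσ
  have hq : (0 : ℤ) < γ.den := by exact_mod_cast γ.den_pos
  have hqQ : (γ.den : ℤ) ≤ Q := by exact_mod_cast h.1.2.2
  have hx'Q : (γ'.den : ℤ) ≤ Q := by exact_mod_cast h.2.1.2.2
  have hx' : (0 : ℤ) < γ'.den := by exact_mod_cast γ'.den_pos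
  obtain ⟨X, B, hX, hdet⟩ := exists_zcoord_repr N σ (a := γ.num) hq γ.reduced
  have hz0 : 0 ≤ zcoord N σ γ.num γ.den := Int.fract_nonneg _
  have hz1 : zcoord N σ γ.num γ.den < 1 := Int.fract_lt_one _
  have hgap : gapLen ε N σ γ.num γ.den = (1 - ε * (γ.den : ℤ)) / ((γ.den : ℤ) * X) := by
    rw [gapLen, hX]
  have hcong := hγ.2.2
  have hcop : IsCoprime (γ.den : ℤ) γ.num := by
    rw [Int.isCoprime_iff_gcd_eq_one, Int.gcd_comm]; exact γ.reduced
  obtain ⟨q, hqd⟩ : ∃ q : ℤ, q = γ.den := ⟨_, rfl⟩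
  obtain ⟨x, hxd⟩ : ∃ q : ℤ, q = γ'.den := ⟨_, rfl⟩
  obtain ⟨a, ha⟩ : ∃ q : ℤ, q = γ.num := ⟨_, rfl⟩
  obtain ⟨b, hb⟩ : ∃ q : ℤ, q = γ'.num := ⟨_, rfl⟩
  have hγd : (γ : ℝ) = a / q := by
    rw [ha, hqd, Int.cast_natCast]; exact Rat.cast_def γ
  have hγd' : (γ' : ℝ) = b / x := by
    rw [hb, hxd, Int.cast_natCast]; exact Rat.cast_def γ'
  rw [hgap]
  rw [← hqd] at hq hqQ hdet hdet' hQx hX hz0 hz1 hcong hcop ⊢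
  rw [← hxd] at hx' hx'Q hdet' hQx
  rw [← ha] at hdet hdet' hX hz0 hz1 hcong hcop
  rw [← hb] at hdet'
  have hqr : (0 : ℝ) < q := by exact_mod_cast hq
  have hxr : (0 : ℝ) < x := by exact_mod_cast hx'
  have hqQr : (q : ℝ) ≤ Q := by exact_mod_cast hqQ
  have hxQr : (x : ℝ) ≤ Q := by exact_mod_cast hx'Q
  have hQxr : (Q : ℝ) + 1 ≤ q + x := by exact_mod_cast hQx
  have hXN : (X : ℝ) ≤ N := by nlinarith
  have hXN' : N < X + q := by nlinarith
  have hX0 : (0 : ℝ) < X := by linarith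
  obtain ⟨k, hk⟩ : q ∣ X - x := by
    refine hcop.dvd_of_dvd_mul_left (⟨B - b, ?_⟩ : q ∣ a * (X - x))
    linear_combination hdet' - hdet
  have hBk : B = b + k * a := by
    have : q * (B - (b + k * a)) = 0 := by linear_combination hdet - hdet' + a * hk
    rcases mul_eq_zero.mp this with h | h <;> omega
  have hXk : X = x + k * q := by linear_combination hk
  have hk0 : 0 ≤ k := by
    have h1 : (-q : ℝ) < X - x := by linarith
    have h2 : -q < X - x := by exact_mod_cast h1
    rw [hk] at h2
    nlinarith
  obtain ⟨k, rfl⟩ := Int.eq_ofNat_of_zero_le hk0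
  have hXkr : (X : ℝ) = x + k * q := by rw [hXk]; push_cast; rfl
  have hBkr : (B : ℝ) = b + k * a := by rw [hBk]; push_cast; rfl
  have hdetr : (B : ℝ) * q - a * X = σ := by exact_mod_cast hdet
  have hu : (σ * (t * q - a) : ℝ) = q * (σ * (t - γ)) := by rw [hγd]; field_simp
  have hu0 : 0 < σ * (t * q - a : ℝ) := by rw [hu]; positivity
  have hy : (σ * (b - t * x) : ℝ) = x * (σ * (γ' - t)) := by rw [hγd']; field_simp
  have hrel : X * (q * (σ * (t - γ))) + q * (σ * (B - t * X)) = 1 := by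
    rw [← hu]
    linear_combination σ * hdetr + hσ2
  have hiff : σ * (t - γ) < (1 - ε * q) / (q * X) ↔ ε < σ * (B - t * X) := by
    rw [lt_div_iff₀ (by positivity)]
    constructor
    · intro h1
      have h2 : q * ε < q * (σ * (B - t * X)) := by linarith
      exact lt_of_mul_lt_mul_left h2 hqr.le
    · intro h1
      have h2 : q * ε < q * (σ * (B - t * X)) := mul_lt_mul_of_pos_left h1 hqr
      linarith
  rw [hiff]
  constructor
  · rintro ⟨h1, h2⟩
    by_contra hcon
    push Not at hcon
    rw [hBkr, hXkr] at hcon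
    obtain ⟨m, n, hm0, hm, hmn, hlm⟩ := exists_obstacle hl hσ hq hx' hcong hdet'
      (hε.trans (mul_le_mul_of_nonneg_left hQxr hε0)) (by rw [hy]; positivity) hcon
    have h3 := h2 m n hm0 hmn hlm
    rw [← hXk] at hm
    have h4 : (m : ℝ) ≤ X := by exact_mod_cast hm
    linarith
  · intro h1
    refine ⟨?_, fun m n hm hmn hlm => not_exists_obstacle hσ hq (by exact_mod_cast hX0) hXN' hcong hdet
      hu0 hε0 h1 hm hmn hlm⟩
    have h2 : 0 < x * (σ * (γ' - t)) := by
      rw [← hy]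
      have e : (σ * (b - t * x) : ℝ) = σ * (B - t * X) + k * (σ * (t * q - a)) := by
        rw [hBkr, hXkr]; ring
      rw [e]
      have : 0 ≤ k * (σ * (t * q - a) : ℝ) := mul_nonneg (Nat.cast_nonneg k) hu0.le
      linarith
    exact pos_of_mul_pos_right h2 hxr.le

/-- The common shape of the sets measured by `Gmeas2` (`σ = 1`) and `Gmeas3` (`σ = -1`). -/
def freeSet (l Q : ℕ) (ε N : ℝ) (σ : ℤ) (I : Set ℝ) : Set ℝ :=
  {ω ∈ Real.arctan '' I | ENNReal.ofReal N < qfree l ε ω ∧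
    ∃ γ γ' : ℚ, FareyNbr Q σ γ γ' ∧ (γ : ℝ) ∈ I ∧ (γ' : ℝ) ∈ I ∧ γ ∈ FareyCong l ∧
      0 < σ * (Real.tan ω - γ) ∧ 0 < σ * (γ' - Real.tan ω)}

theorem Gmeas2_eq_freeSet (l : ℕ) (I : Set ℝ) (ε lam : ℝ) :
    Gmeas2 l I ε lam = (volume (freeSet l ⌊1 / ε⌋₊ ε (lam * (⌊1 / ε⌋₊ : ℝ)) 1 I)).toReal := by
  unfold Gmeas2 freeSet
  simp only [fareyNbr_one, Int.cast_one, one_mul, sub_pos]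

theorem Gmeas3_eq_freeSet (l : ℕ) (I : Set ℝ) (ε lam : ℝ) :
    Gmeas3 l I ε lam = (volume (freeSet l ⌊1 / ε⌋₊ ε (lam * (⌊1 / ε⌋₊ : ℝ)) (-1) I)).toReal := by
  unfold Gmeas3 freeSet
  simp only [fareyNbr_neg_one, Int.cast_neg, Int.cast_one, neg_one_mul, neg_sub, sub_pos]
  congr 2
  ext ω
  simp only [Set.mem_ofPred_eq]
  refine and_congr_right fun _ => and_congr_right fun _ => ⟨?_, ?_⟩
  · rintro ⟨γ, γ', h1, h2, h3, h4, h5, h6⟩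
    exact ⟨γ', γ, h1, h3, h2, h4, h6, h5⟩
  · rintro ⟨γ, γ', h1, h2, h3, h4, h5, h6⟩
    exact ⟨γ', γ, h1, h3, h2, h4, h6, h5⟩

open Classical in
/-- The fractions of `fareyPts` whose neighbour on the side `σ` is also in `I`. -/
noncomputable def innerPts (l Q : ℕ) (σ : ℤ) (I : Set ℝ) : Finset (ℤ × ℤ) :=
  (fareyPts l Q (I ∩ Set.Ioc 0 1)).filter fun p =>
    ∃ γ' : ℚ, FareyNbr Q σ ((p.1 : ℚ) / p.2) γ' ∧ (γ' : ℝ) ∈ I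

theorem mem_innerPts {l Q : ℕ} {σ : ℤ} {I : Set ℝ} {p : ℤ × ℤ} :
    p ∈ innerPts l Q σ I ↔ p ∈ fareyPts l Q (I ∩ Set.Ioc 0 1) ∧
      ∃ γ' : ℚ, FareyNbr Q σ ((p.1 : ℚ) / p.2) γ' ∧ (γ' : ℝ) ∈ I := by
  simp only [innerPts, Finset.mem_filter]

theorem rat_of_mem_fareyPts {l Q : ℕ} {I : Set ℝ} {p : ℤ × ℤ}
    (hp : p ∈ fareyPts l Q (I ∩ Set.Ioc 0 1)) :
    ((p.1 : ℚ) / p.2).num = p.1 ∧ ((((p.1 : ℚ) / p.2).den : ℕ) : ℤ) = p.2 ∧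
    (p.1 : ℚ) / p.2 ∈ FareyQ Q ∧ (p.1 : ℚ) / p.2 ∈ FareyCong l ∧
    (((p.1 : ℚ) / p.2 : ℚ) : ℝ) = (p.1 : ℝ) / p.2 ∧ (p.1 : ℝ) / p.2 ∈ I := by
  obtain ⟨⟨⟨h1, h2⟩, h3, h4⟩, ⟨h5, h6, h7⟩, h8, h9⟩ := mem_fareyPts.mp hp
  have hn : ((p.1 : ℚ) / p.2).num = p.1 := Rat.num_div_eq_of_coprime (by omega) h9
  have hd : ((((p.1 : ℚ) / p.2).den : ℕ) : ℤ) = p.2 := Rat.den_div_eq_of_coprime (by omega) h9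
  have hc : (((p.1 : ℚ) / p.2 : ℚ) : ℝ) = (p.1 : ℝ) / p.2 := by push_cast; rfl
  have h6' : 0 < (p.1 : ℚ) / p.2 := by rw [← hc] at h6; exact_mod_cast h6
  have h7' : (p.1 : ℚ) / p.2 ≤ 1 := by rw [← hc] at h7; exact_mod_cast h7
  refine ⟨hn, hd, ⟨h6', h7', ?_⟩, ⟨h6', h7', ?_⟩, hc, h5⟩
  · have : ((((p.1 : ℚ) / p.2).den : ℕ) : ℤ) ≤ Q := by rw [hd]; exact h4
    exact_mod_cast this
  · rw [hn, hd]
    obtain ⟨e, he⟩ := h8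
    exact ⟨-e, by linear_combination -he⟩

theorem mem_fareyPts_of_rat {l Q : ℕ} {I : Set ℝ} {γ : ℚ} (h : γ ∈ FareyQ Q) (h' : γ ∈ FareyCong l)
    (hI : (γ : ℝ) ∈ I) : (γ.num, (γ.den : ℤ)) ∈ fareyPts l Q (I ∩ Set.Ioc 0 1) := by
  rw [mem_fareyPts]
  have hc : ((γ.num : ℝ) / ((γ.den : ℤ) : ℝ)) = γ := by
    rw [Int.cast_natCast]; exact (Rat.cast_def γ).symm
  have hd : (0 : ℤ) < γ.den := by exact_mod_cast γ.den_pos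
  have hdQ : (γ.den : ℤ) ≤ Q := by exact_mod_cast h.2.2
  have hn : 0 < γ.num := Rat.num_pos.mpr h.1
  have hnd : γ.num ≤ γ.den := by
    have h1 := h.2.1
    rw [← Rat.num_div_den γ, div_le_one (by exact_mod_cast γ.den_pos)] at h1
    exact_mod_cast h1
  refine ⟨⟨⟨?_, ?_⟩, ?_, ?_⟩, ?_, ?_, γ.reduced⟩
  · show (1 : ℤ) ≤ γ.num
    omega
  · show γ.num ≤ (Q : ℤ)
    omega
  · show (1 : ℤ) ≤ γ.den
    omega
  · exact hdQ
  · show ((γ.num : ℝ) / ((γ.den : ℤ) : ℝ)) ∈ _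
    rw [hc]
    exact ⟨hI, by exact_mod_cast h.1, by exact_mod_cast h.2.1⟩
  · obtain ⟨e, he⟩ := h'.2.2
    exact ⟨-e, by linear_combination -he⟩

theorem freeSet_eq_iUnion {l Q : ℕ} (hl : 2 ≤ l) {σ : ℤ} (hσ : IsUnit σ) {ε N : ℝ}
    (hε0 : 0 ≤ ε) (hε : 1 ≤ ε * (Q + 1)) (hN : (Q : ℝ) < N) {I : Set ℝ} (hI : I.OrdConnected) :
    freeSet l Q ε N σ I = ⋃ p ∈ innerPts l Q σ I, Real.arctan '' {t : ℝ |
      0 < σ * (t - (p.1 : ℝ) / p.2) ∧ σ * (t - (p.1 : ℝ) / p.2) < gapLen ε N σ p.1 p.2} := by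
  have hN0 : 0 ≤ N := (Nat.cast_nonneg Q).trans hN.le
  ext ω
  simp only [Set.mem_iUnion, exists_prop]
  constructor
  · rintro ⟨⟨t, htI, rfl⟩, hq, γ, γ', hnbr, hγI, hγ'I, hγ, h1, h2⟩
    rw [ofReal_lt_qfree_iff hN0] at hq
    rw [Real.tan_arctan] at hq h1 h2
    have hp := mem_fareyPts_of_rat hnbr.1 hγ hγI
    have hc : ((γ.num : ℝ) / ((γ.den : ℤ) : ℝ)) = γ := by
      rw [Int.cast_natCast]; exact (Rat.cast_def γ).symm
    have hcq : ((γ.num : ℚ) / ((γ.den : ℤ) : ℚ)) = γ := by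
      rw [Int.cast_natCast]; exact Rat.num_div_den γ
    refine ⟨(γ.num, (γ.den : ℤ)), ?_, t, ⟨?_, ?_⟩, rfl⟩
    · rw [mem_innerPts]
      refine ⟨hp, γ', ?_, hγ'I⟩
      rwa [hcq]
    · rwa [hc]
    · rw [hc]
      exact (free_iff_lt_gapLen hl hσ hε0 hε hN hnbr hγ h1).mp ⟨h2, hq⟩
  · rintro ⟨p, hp, t, ⟨h1, h2⟩, rfl⟩
    rw [mem_innerPts] at hp
    obtain ⟨hp, γ', hnbr, hγ'I⟩ := hp
    obtain ⟨hn, hd, -, hγ, hc, hpI⟩ := rat_of_mem_fareyPts hp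
    rw [← hc] at h1 h2 hpI
    obtain ⟨h3, h4⟩ := (free_iff_lt_gapLen hl hσ hε0 hε hN hnbr hγ h1).mpr (by
      rw [hn, hd]; exact h2)
    refine ⟨⟨t, ?_, rfl⟩, ?_, _, γ', hnbr, hpI, hγ'I, hγ, ?_, ?_⟩
    · rcases Int.isUnit_iff.mp hσ with rfl | rfl
      · push_cast at h1 h3
        refine hI.out hpI hγ'I ⟨?_, ?_⟩ <;> push_cast <;> linarith
      · push_cast at h1 h3
        refine hI.out hγ'I hpI ⟨?_, ?_⟩ <;> push_cast <;> linarith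
    · rw [ofReal_lt_qfree_iff hN0, Real.tan_arctan]
      exact h4
    · rwa [Real.tan_arctan]
    · rwa [Real.tan_arctan]

theorem arctan_image_Ioo (a b : ℝ) : Real.arctan '' Set.Ioo a b = Set.Ioo (Real.arctan a) (Real.arctan b) := by
  ext ω
  constructor
  · rintro ⟨t, ⟨h1, h2⟩, rfl⟩
    exact ⟨Real.arctan_strictMono h1, Real.arctan_strictMono h2⟩
  · rintro ⟨h1, h2⟩
    have e : Real.arctan (Real.tan ω) = ω := Real.arctan_tan
      ((Real.neg_pi_div_two_lt_arctan a).trans h1) (h2.trans (Real.arctan_lt_pi_div_two b))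
    refine ⟨Real.tan ω, ⟨?_, ?_⟩, e⟩
    · rw [← e] at h1; exact Real.arctan_strictMono.lt_iff_lt.mp h1
    · rw [← e] at h2; exact Real.arctan_strictMono.lt_iff_lt.mp h2

theorem arctan_image_slab {σ : ℤ} (hσ : IsUnit σ) (γ f : ℝ) :
    MeasurableSet (Real.arctan '' {t : ℝ | 0 < σ * (t - γ) ∧ σ * (t - γ) < f}) ∧
    volume (Real.arctan '' {t : ℝ | 0 < σ * (t - γ) ∧ σ * (t - γ) < f}) =
      ENNReal.ofReal (σ * (Real.arctan (γ + σ * f) - Real.arctan γ)) := by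
  rcases Int.isUnit_iff.mp hσ with rfl | rfl
  · have : {t : ℝ | 0 < ((1 : ℤ) : ℝ) * (t - γ) ∧ ((1 : ℤ) : ℝ) * (t - γ) < f} = Set.Ioo γ (γ + f) := by
      ext t
      simp only [Int.cast_one, one_mul, Set.mem_ofPred_eq, Set.mem_Ioo]
      constructor <;> rintro ⟨h1, h2⟩ <;> constructor <;> linarith
    rw [this, arctan_image_Ioo]
    refine ⟨measurableSet_Ioo, ?_⟩
    rw [Real.volume_Ioo]; push_cast; ring_nf
  · have : {t : ℝ | 0 < ((-1 : ℤ) : ℝ) * (t - γ) ∧ ((-1 : ℤ) : ℝ) * (t - γ) < f} = Set.Ioo (γ - f) γ := by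
      ext t
      simp only [Int.cast_neg, Int.cast_one, neg_one_mul, Set.mem_ofPred_eq, Set.mem_Ioo]
      constructor <;> rintro ⟨h1, h2⟩ <;> constructor <;> linarith
    rw [this, arctan_image_Ioo]
    refine ⟨measurableSet_Ioo, ?_⟩
    rw [Real.volume_Ioo]; push_cast; ring_nf

theorem abs_inv_one_add_sq_sub_le (x y : ℝ) : |1 / (1 + x ^ 2) - 1 / (1 + y ^ 2)| ≤ |x - y| := by
  have hx : 0 < 1 + x ^ 2 := by positivity
  have hy : 0 < 1 + y ^ 2 := by positivity
  have e : 1 / (1 + x ^ 2) - 1 / (1 + y ^ 2) = (x - y) * (-(x + y) / ((1 + x ^ 2) * (1 + y ^ 2))) := by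
    field_simp; ring
  rw [e, abs_mul]
  refine mul_le_of_le_one_right (abs_nonneg _) ?_
  rw [abs_div, abs_neg, abs_of_pos (by positivity : 0 < (1 + x ^ 2) * (1 + y ^ 2)),
    div_le_one (by positivity), abs_le]
  constructor <;> nlinarith [sq_nonneg (x - 1), sq_nonneg (y - 1), sq_nonneg (x + 1), sq_nonneg (y + 1),
    sq_nonneg (x * y)]

theorem abs_arctan_sub_sub_le (x y : ℝ) :
    |Real.arctan y - Real.arctan x - (y - x) / (1 + x ^ 2)| ≤ (y - x) ^ 2 := by
  have h := (convex_uIcc x y).norm_image_sub_le_of_norm_hasDerivWithin_le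
    (f := fun t => Real.arctan t - t * (1 / (1 + x ^ 2)))
    (f' := fun t => 1 / (1 + t ^ 2) - 1 * (1 / (1 + x ^ 2))) (C := |y - x|)
    (fun t _ => ((Real.hasDerivAt_arctan t).sub ((hasDerivAt_id t).mul_const _)).hasDerivWithinAt)
    (fun t ht => by
      rw [one_mul, Real.norm_eq_abs]
      exact (abs_inv_one_add_sq_sub_le t x).trans (Set.abs_sub_left_of_mem_uIcc ht))
    Set.left_mem_uIcc Set.right_mem_uIcc
  rw [Real.norm_eq_abs, Real.norm_eq_abs, abs_mul_abs_self, ← pow_two] at h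
  convert h using 2
  ring

theorem sum_fareyPts_inv_sq_le (l Q : ℕ) (J : Set ℝ) (hJs : J ⊆ Set.Ioc 0 1) :
    ∑ p ∈ fareyPts l Q J, 1 / (p.2 : ℝ) ^ 2 ≤ (Q : ℝ) := by
  have hmaps : ∀ p ∈ fareyPts l Q J, p.2 ∈ Finset.Icc (1 : ℤ) Q := fun p hp => by
    have := (mem_fareyPts.mp hp).1.2
    exact Finset.mem_Icc.mpr this
  rw [← Finset.sum_fiberwise_of_maps_to hmaps]
  calc ∑ q ∈ Finset.Icc (1 : ℤ) Q, ∑ p ∈ (fareyPts l Q J).filter (fun p => p.2 = q), 1 / (p.2 : ℝ) ^ 2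
      ≤ ∑ q ∈ Finset.Icc (1 : ℤ) Q, (1 : ℝ) := by
        refine Finset.sum_le_sum fun q hq => ?_
        rw [Finset.mem_Icc] at hq
        have hq1 : (1 : ℝ) ≤ q := by exact_mod_cast hq.1
        have e : ∑ p ∈ (fareyPts l Q J).filter (fun p => p.2 = q), 1 / (p.2 : ℝ) ^ 2 =
            ((fareyPts l Q J).filter (fun p => p.2 = q)).card * (1 / (q : ℝ) ^ 2) := by
          rw [Finset.sum_congr rfl (g := fun _ => 1 / (q : ℝ) ^ 2) fun p hp => by
            rw [(Finset.mem_filter.mp hp).2]]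
          rw [Finset.sum_const, nsmul_eq_mul]
        have hc : ((fareyPts l Q J).filter (fun p => p.2 = q)).card ≤ (Finset.Icc (1 : ℤ) q).card := by
          refine Finset.card_le_card_of_injOn Prod.fst (fun p hp => ?_) (fun p hp p' hp' h => ?_)
          · rw [Finset.mem_coe, Finset.mem_filter, mem_fareyPts] at hp
            obtain ⟨⟨⟨⟨h1, h2⟩, h3, h4⟩, h5, -⟩, h6⟩ := hp
            have h7 := (hJs h5).2
            rw [div_le_one (by exact_mod_cast h3)] at h7
            have h8 : p.1 ≤ p.2 := by exact_mod_cast h7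
            rw [Finset.coe_Icc, Set.mem_Icc]
            omega
          · rw [Finset.mem_coe, Finset.mem_filter] at hp hp'
            exact Prod.ext h (hp.2.trans hp'.2.symm)
        have hc' : (((fareyPts l Q J).filter (fun p => p.2 = q)).card : ℝ) ≤ q := by
          rw [Int.card_Icc] at hc
          have : (((fareyPts l Q J).filter (fun p => p.2 = q)).card : ℤ) ≤ q := by omega
          exact_mod_cast this
        rw [e]
        calc _ ≤ (q : ℝ) * (1 / (q : ℝ) ^ 2) := by gcongr
          _ = 1 / q := by field_simp
          _ ≤ 1 := by rw [div_le_one (by linarith)]; exact hq1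
    _ = Q := by simp

theorem FareyQ_finite (Q : ℕ) : (FareyQ Q).Finite := by
  refine Set.Finite.subset (Finset.finite_toSet
    ((Finset.Icc (0 : ℤ) Q ×ˢ Finset.Icc (0 : ℤ) Q).image fun p => (p.1 : ℚ) / p.2)) ?_
  rintro γ ⟨h1, h2, h3⟩
  rw [Finset.mem_coe, Finset.mem_image]
  have hn : 0 < γ.num := Rat.num_pos.mpr h1
  have hnd : γ.num ≤ γ.den := by
    rw [← Rat.num_div_den γ, div_le_one (by exact_mod_cast γ.den_pos)] at h2
    exact_mod_cast h2
  refine ⟨(γ.num, (γ.den : ℤ)), ?_, ?_⟩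
  · rw [Finset.mem_product, Finset.mem_Icc, Finset.mem_Icc]
    dsimp only
    omega
  · dsimp only
    rw [Int.cast_natCast]; exact Rat.num_div_den γ

theorem exists_fareyNbr_of_mem {Q : ℕ} {σ : ℤ} (hσ : IsUnit σ) {I : Set ℝ} (hI : I.OrdConnected)
    {γ w : ℚ} (hγ : γ ∈ FareyQ Q) (hw : w ∈ FareyQ Q) (hγI : (γ : ℝ) ∈ I) (hwI : (w : ℝ) ∈ I)
    (h : 0 < σ * (w - γ)) : ∃ γ' : ℚ, FareyNbr Q σ γ γ' ∧ (γ' : ℝ) ∈ I := by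
  obtain ⟨z, ⟨hz1, hz2⟩, hz⟩ := Set.exists_min_image {z | z ∈ FareyQ Q ∧ 0 < σ * (z - γ)}
    (fun z => (σ : ℚ) * z) ((FareyQ_finite Q).subset fun z hz => hz.1) ⟨w, hw, h⟩
  have hzw := hz w ⟨hw, h⟩
  refine ⟨z, ⟨hγ, hz1, hz2, fun y hy hyz => ?_⟩, ?_⟩
  · have := hz y ⟨hy, hyz.1⟩
    linarith [hyz.2]
  · rcases Int.isUnit_iff.mp hσ with rfl | rfl
    · push_cast at hz2 hzw
      exact hI.out hγI hwI ⟨by exact_mod_cast (by linarith : γ ≤ z), by exact_mod_cast (by linarith : z ≤ w)⟩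
    · push_cast at hz2 hzw
      exact hI.out hwI hγI ⟨by exact_mod_cast (by linarith : w ≤ z), by exact_mod_cast (by linarith : z ≤ γ)⟩

theorem card_sdiff_innerPts_le (l Q : ℕ) {σ : ℤ} (hσ : IsUnit σ) {I : Set ℝ} (hI : I.OrdConnected) :
    (fareyPts l Q (I ∩ Set.Ioc 0 1) \ innerPts l Q σ I).card ≤ 1 := by
  have key : ∀ p ∈ fareyPts l Q (I ∩ Set.Ioc 0 1) \ innerPts l Q σ I,
      ∀ p' ∈ fareyPts l Q (I ∩ Set.Ioc 0 1) \ innerPts l Q σ I,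
      ¬ 0 < (σ : ℚ) * ((p'.1 : ℚ) / p'.2 - (p.1 : ℚ) / p.2) := by
    intro p hp p' hp' h
    rw [Finset.mem_sdiff] at hp hp'
    obtain ⟨-, -, h3, -, h5, h6⟩ := rat_of_mem_fareyPts hp.1
    obtain ⟨-, -, h3', -, h5', h6'⟩ := rat_of_mem_fareyPts hp'.1
    rw [← h5] at h6
    rw [← h5'] at h6'
    exact hp.2 (mem_innerPts.mpr ⟨hp.1, exists_fareyNbr_of_mem hσ hI h3 h3' h6 h6' h⟩)
  rw [Finset.card_le_one]
  intro p hp p' hp'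
  have h1 := key p hp p' hp'
  have h2 := key p' hp' p hp
  have h3 : (p'.1 : ℚ) / p'.2 = (p.1 : ℚ) / p.2 := by
    rcases Int.isUnit_iff.mp hσ with rfl | rfl <;> push_cast at h1 h2 <;> linarith
  rw [Finset.mem_sdiff] at hp hp'
  obtain ⟨h4, h5, -⟩ := rat_of_mem_fareyPts hp.1
  obtain ⟨h4', h5', -⟩ := rat_of_mem_fareyPts hp'.1
  rw [h3] at h4' h5'
  exact Prod.ext (h4.symm.trans h4') (h5.symm.trans h5')

theorem gapLen_bounds {l Q : ℕ} {ε lam : ℝ} (hε0 : 0 ≤ ε) (hε : ε * Q ≤ 1) (hlam : 1 < lam) {σ : ℤ}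
    {J : Set ℝ} {p : ℤ × ℤ} (hp : p ∈ fareyPts l Q J) : 0 ≤ gapLen ε (lam * Q) σ p.1 p.2 ∧
      gapLen ε (lam * Q) σ p.1 p.2 ≤ 1 / ((lam - 1) * Q) * (1 / p.2) := by
  obtain ⟨⟨-, h1, h2⟩, -⟩ := mem_fareyPts.mp hp
  have hq : (1 : ℝ) ≤ p.2 := by exact_mod_cast h1
  have hqQ : (p.2 : ℝ) ≤ Q := by exact_mod_cast h2
  have hz0 : 0 ≤ zcoord (lam * Q) σ p.1 p.2 := Int.fract_nonneg _
  have hz1 : zcoord (lam * Q) σ p.1 p.2 < 1 := Int.fract_lt_one _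
  have h3 : ε * p.2 ≤ ε * Q := by gcongr
  have h4 : 0 ≤ ε * p.2 := by positivity
  have hm : 0 < lam - 1 := by linarith
  have hQ : (0 : ℝ) < Q := by linarith
  have h5 : (lam - 1) * Q ≤ lam * Q - p.2 * zcoord (lam * Q) σ p.1 p.2 := by nlinarith
  have h6 : 0 < (lam - 1) * Q := by positivity
  unfold gapLen
  constructor
  · exact div_nonneg (by linarith) (mul_nonneg (by linarith) (by linarith))
  · rw [one_div_mul_one_div, mul_comm ((lam - 1) * (Q : ℝ))]
    exact div_le_div₀ zero_le_one (by linarith) (by positivity) (by gcongr)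

theorem innerPts_pairwiseDisjoint {l Q : ℕ} (hl : 2 ≤ l) {σ : ℤ} (hσ : IsUnit σ) {ε N : ℝ}
    (hε0 : 0 ≤ ε) (hε : 1 ≤ ε * (Q + 1)) (hN : (Q : ℝ) < N) {I : Set ℝ} :
    (innerPts l Q σ I : Set (ℤ × ℤ)).PairwiseDisjoint fun p => Real.arctan '' {t : ℝ |
      0 < σ * (t - (p.1 : ℝ) / p.2) ∧ σ * (t - (p.1 : ℝ) / p.2) < gapLen ε N σ p.1 p.2} := by
  have key : ∀ p ∈ innerPts l Q σ I, ∀ p' ∈ innerPts l Q σ I, ∀ t : ℝ,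
      (0 < σ * (t - (p.1 : ℝ) / p.2) ∧ σ * (t - (p.1 : ℝ) / p.2) < gapLen ε N σ p.1 p.2) →
      0 < σ * (t - (p'.1 : ℝ) / p'.2) →
      ¬ 0 < (σ : ℚ) * ((p'.1 : ℚ) / p'.2 - (p.1 : ℚ) / p.2) := by
    rintro p hp p' hp' t ⟨h1, h2⟩ h3 h4
    obtain ⟨hpf, γ', hnbr, -⟩ := mem_innerPts.mp hp
    obtain ⟨hn, hd, -, hγ, hc, -⟩ := rat_of_mem_fareyPts hpf
    obtain ⟨-, -, hF', -, hc', -⟩ := rat_of_mem_fareyPts (mem_innerPts.mp hp').1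
    rw [← hc] at h1 h2
    rw [← hc'] at h3
    have h5 := ((free_iff_lt_gapLen hl hσ hε0 hε hN hnbr hγ h1).mpr (by rw [hn, hd]; exact h2)).1
    refine hnbr.2.2.2 _ hF' ⟨h4, ?_⟩
    have h6 : 0 < (σ : ℝ) * (γ' - ((p'.1 : ℚ) / p'.2 : ℚ)) := by linarith
    exact_mod_cast h6
  intro p hp p' hp' hne
  rw [Function.onFun, Set.disjoint_left]
  rintro _ ⟨t, ht, rfl⟩ ⟨t', ht', htt⟩
  rw [Real.arctan_injective htt] at ht'
  rw [Finset.mem_coe] at hp hp'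
  have h1 := key p hp p' hp' t ht ht'.1
  have h2 := key p' hp' p hp t ht' ht.1
  have h3 : (p'.1 : ℚ) / p'.2 = (p.1 : ℚ) / p.2 := by
    rcases Int.isUnit_iff.mp hσ with rfl | rfl <;> push_cast at h1 h2 <;> linarith
  obtain ⟨h4, h5, -⟩ := rat_of_mem_fareyPts (mem_innerPts.mp hp).1
  obtain ⟨h4', h5', -⟩ := rat_of_mem_fareyPts (mem_innerPts.mp hp').1
  rw [h3] at h4' h5'
  exact hne (Prod.ext (h4.symm.trans h4') (h5.symm.trans h5'))

theorem volume_freeSet {l Q : ℕ} (hl : 2 ≤ l) {σ : ℤ} (hσ : IsUnit σ) {ε N : ℝ}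
    (hε0 : 0 ≤ ε) (hε : 1 ≤ ε * (Q + 1)) (hN : (Q : ℝ) < N) {I : Set ℝ} (hI : I.OrdConnected)
    (hf : ∀ p ∈ innerPts l Q σ I, 0 ≤ gapLen ε N σ p.1 p.2) :
    (volume (freeSet l Q ε N σ I)).toReal = ∑ p ∈ innerPts l Q σ I,
      σ * (Real.arctan ((p.1 : ℝ) / p.2 + σ * gapLen ε N σ p.1 p.2) - Real.arctan ((p.1 : ℝ) / p.2)) := by
  rw [freeSet_eq_iUnion hl hσ hε0 hε hN hI, measure_biUnion_finset
    (innerPts_pairwiseDisjoint hl hσ hε0 hε hN) (fun p _ => (arctan_image_slab hσ _ _).1),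
    ENNReal.toReal_sum fun p _ => by rw [(arctan_image_slab hσ _ _).2]; exact ENNReal.ofReal_ne_top]
  refine Finset.sum_congr rfl fun p hp => ?_
  rw [(arctan_image_slab hσ _ _).2, ENNReal.toReal_ofReal]
  have h := hf p hp
  rcases Int.isUnit_iff.mp hσ with rfl | rfl
  · push_cast at h ⊢
    rw [one_mul, one_mul, sub_nonneg]
    exact Real.arctan_mono (by linarith)
  · push_cast at h ⊢
    rw [neg_one_mul, neg_one_mul, neg_sub, sub_nonneg]
    exact Real.arctan_mono (by linarith)

theorem abs_volume_freeSet_sub_le {l Q : ℕ} (hl : 2 ≤ l) {σ : ℤ} (hσ : IsUnit σ) {ε lam : ℝ}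
    (hQ : 0 < Q) (hε0 : 0 ≤ ε) (hε1 : ε * Q ≤ 1) (hε : 1 ≤ ε * (Q + 1)) (hlam : 1 < lam)
    {I : Set ℝ} (hI : I.OrdConnected) :
    |(volume (freeSet l Q ε (lam * Q) σ I)).toReal - ∑ p ∈ fareyPts l Q (I ∩ Set.Ioc 0 1),
      1 / (1 + ((p.1 : ℝ) / p.2) ^ 2) * gapLen ε (lam * Q) σ p.1 p.2| ≤
      (1 / (lam - 1) ^ 2 + 1 / (lam - 1)) / Q := by
  have hQ0 : (0 : ℝ) < Q := by exact_mod_cast hQ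
  have hm : 0 < lam - 1 := by linarith
  have hN : (Q : ℝ) < lam * Q := by nlinarith
  have hsub : innerPts l Q σ I ⊆ fareyPts l Q (I ∩ Set.Ioc 0 1) := fun p hp => (mem_innerPts.mp hp).1
  have hb := fun p (hp : p ∈ fareyPts l Q (I ∩ Set.Ioc 0 1)) =>
    gapLen_bounds (σ := σ) hε0 hε1 hlam hp
  have hσ2 := isUnit_cast_mul_self hσ
  rw [volume_freeSet hl hσ hε0 hε hN hI fun p hp => (hb p (hsub hp)).1,
    ← Finset.sum_sdiff hsub, add_comm, ← sub_sub, ← Finset.sum_sub_distrib, add_div]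
  refine (abs_sub _ _).trans (add_le_add ?_ ?_)
  · refine (Finset.abs_sum_le_sum_abs _ _).trans ?_
    calc _ ≤ ∑ p ∈ innerPts l Q σ I, (1 / ((lam - 1) * Q)) ^ 2 * (1 / (p.2 : ℝ) ^ 2) := by
          refine Finset.sum_le_sum fun p hp => ?_
          have h1 := abs_arctan_sub_sub_le ((p.1 : ℝ) / p.2)
            ((p.1 : ℝ) / p.2 + σ * gapLen ε (lam * Q) σ p.1 p.2)
          have h2 := hb p (hsub hp)
          have e : (σ : ℝ) * (Real.arctan ((p.1 : ℝ) / p.2 + σ * gapLen ε (lam * Q) σ p.1 p.2) -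
              Real.arctan ((p.1 : ℝ) / p.2)) -
              1 / (1 + ((p.1 : ℝ) / p.2) ^ 2) * gapLen ε (lam * Q) σ p.1 p.2 =
              σ * (Real.arctan ((p.1 : ℝ) / p.2 + σ * gapLen ε (lam * Q) σ p.1 p.2) -
              Real.arctan ((p.1 : ℝ) / p.2) - ((p.1 : ℝ) / p.2 + σ * gapLen ε (lam * Q) σ p.1 p.2 -
              (p.1 : ℝ) / p.2) / (1 + ((p.1 : ℝ) / p.2) ^ 2)) := by
            linear_combination (1 / (1 + ((p.1 : ℝ) / p.2) ^ 2) * gapLen ε (lam * Q) σ p.1 p.2) * hσ2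
          rw [e, abs_mul, abs_cast_isUnit hσ, one_mul]
          refine h1.trans ?_
          rw [add_sub_cancel_left, mul_pow, pow_two (σ : ℝ), hσ2, one_mul]
          refine (pow_le_pow_left₀ h2.1 h2.2 2).trans (le_of_eq ?_)
          rw [mul_pow, one_div_pow, one_div_pow]
      _ ≤ ∑ p ∈ fareyPts l Q (I ∩ Set.Ioc 0 1), (1 / ((lam - 1) * Q)) ^ 2 * (1 / (p.2 : ℝ) ^ 2) :=
          Finset.sum_le_sum_of_subset_of_nonneg hsub fun p _ _ => by positivity
      _ ≤ (1 / ((lam - 1) * Q)) ^ 2 * Q := by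
          rw [← Finset.mul_sum]
          exact mul_le_mul_of_nonneg_left (sum_fareyPts_inv_sq_le l Q _ Set.inter_subset_right) (by positivity)
      _ = _ := by field_simp
  · refine (Finset.abs_sum_le_sum_abs _ _).trans ?_
    refine (Finset.sum_le_card_nsmul _ _ (1 / (lam - 1) / Q) fun p hp => ?_).trans ?_
    · have hp' := (Finset.mem_sdiff.mp hp).1
      have h2 := hb p hp'
      have h3 := (mem_fareyPts.mp hp').1.2.1
      have h4 : (1 : ℝ) ≤ p.2 := by exact_mod_cast h3
      have hw : 1 / (1 + ((p.1 : ℝ) / p.2) ^ 2) ≤ 1 := by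
        rw [div_le_one (by positivity)]
        nlinarith [sq_nonneg ((p.1 : ℝ) / p.2)]
      rw [abs_mul, abs_of_nonneg h2.1, abs_of_nonneg (by positivity)]
      calc _ ≤ 1 * (1 / ((lam - 1) * Q) * (1 / p.2)) := mul_le_mul hw h2.2 h2.1 zero_le_one
        _ ≤ 1 * (1 / ((lam - 1) * Q) * 1) := by
          gcongr
          rw [div_le_one (by linarith)]; exact h4
        _ = _ := by field_simp
    · rw [nsmul_eq_mul]
      refine mul_le_of_le_one_left (by positivity) ?_
      exact_mod_cast card_sdiff_innerPts_le l Q hσ hI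

theorem integral_indicator_lt {x : ℝ} (h0 : 0 ≤ x) (h1 : x ≤ 1) :
    ∫ t in (0 : ℝ)..1, (if t < x then (1 : ℝ) else 0) = x := by
  rw [intervalIntegral.integral_of_le zero_le_one]
  have : (fun t : ℝ => if t < x then (1 : ℝ) else 0) = (Set.Iio x).indicator fun _ => 1 := by
    ext t; simp [Set.indicator_apply]
  rw [this, setIntegral_indicator measurableSet_Iio, setIntegral_const, smul_eq_mul, mul_one,
    measureReal_def]
  have e : Set.Ioc (0 : ℝ) 1 ∩ Set.Iio x = Set.Ioo 0 x := by
    ext t; simp only [Set.mem_inter_iff, Set.mem_Ioc, Set.mem_Iio, Set.mem_Ioo]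
    constructor
    · rintro ⟨⟨h2, h3⟩, h4⟩; exact ⟨h2, h4⟩
    · rintro ⟨h2, h3⟩; exact ⟨⟨h2, by linarith⟩, h3⟩
  rw [e, Real.volume_Ioo, ENNReal.toReal_ofReal] <;> linarith

theorem intervalIntegrable_indicator_lt (x a b : ℝ) :
    IntervalIntegrable (fun t => if t < x then (1 : ℝ) else 0) volume a b := by
  apply Antitone.intervalIntegrable
  intro s t hst
  dsimp only
  by_cases h : t < x
  · rw [if_pos h, if_pos (hst.trans_lt h)]
  · rw [if_neg h]
    split_ifs <;> norm_num

theorem setIntegral_eq_integral_volume_lt {J : Set ℝ} (hJs : J ⊆ Set.Ioc 0 1)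
    {w : ℝ → ℝ} (hw : Continuous w) (h0 : ∀ x, 0 ≤ w x) (h1 : ∀ x, w x ≤ 1) :
    ∫ u in J, w u = ∫ t in (0 : ℝ)..1, (volume {u ∈ J | t < w u}).toReal := by
  have hfin : volume J ≠ ⊤ := ne_top_of_le_ne_top (by simp) (measure_mono hJs)
  have hInt : Integrable w (volume.restrict J) := by
    have : IsFiniteMeasure (volume.restrict J) := ⟨by simpa using hfin.lt_top⟩
    refine Integrable.of_bound hw.aestronglyMeasurable 1 (Eventually.of_forall fun x => ?_)
    rw [Real.norm_eq_abs, abs_of_nonneg (h0 x)]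
    exact h1 x
  rw [hInt.integral_eq_integral_meas_lt (Eventually.of_forall h0), intervalIntegral.integral_of_le zero_le_one]
  have e : ∀ t, (volume.restrict J).real {a | t < w a} = (volume {u ∈ J | t < w u}).toReal := by
    intro t
    rw [measureReal_def, Measure.restrict_apply (isOpen_lt continuous_const hw).measurableSet]
    congr 2
    ext u
    simp only [Set.mem_inter_iff, Set.mem_ofPred_eq]
    tauto
  simp_rw [e]
  refine setIntegral_eq_of_subset_of_forall_sdiff_eq_zero measurableSet_Ioi (fun t ht => ht.1) fun t ht => ?_
  have : {u ∈ J | t < w u} = ∅ := by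
    ext u
    simp only [Set.mem_ofPred_eq, Set.mem_empty_iff_false, iff_false, not_and, not_lt]
    intro _
    have h2 : ¬ t ≤ 1 := fun h => ht.2 ⟨ht.1, h⟩
    linarith [h1 u]
  rw [this]; simp

theorem abs_sum_weight_sub_le {l Q : ℕ} {ε N : ℝ} {σ : ℤ} {J : Set ℝ} (hJ : J.OrdConnected)
    (hJs : J ⊆ Set.Ioc 0 1) {w : ℝ → ℝ} (hw : Continuous w) (h0 : ∀ x, 0 ≤ w x) (h1 : ∀ x, w x ≤ 1)
    (hanti : AntitoneOn w (Set.Ioi 0)) {κ E : ℝ}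
    (h : ∀ J' ⊆ J, J'.OrdConnected → |gapSum l Q ε N σ J' - κ * (volume J').toReal| ≤ E) :
    |∑ p ∈ fareyPts l Q J, w ((p.1 : ℝ) / p.2) * gapLen ε N σ p.1 p.2 - κ * ∫ u in J, w u| ≤ E := by
  have hfin : volume J ≠ ⊤ := ne_top_of_le_ne_top (by simp) (measure_mono hJs)
  have hconn : ∀ t, {u ∈ J | t < w u}.OrdConnected := by
    intro t
    refine ⟨fun x hx y hy z hz => ⟨hJ.out hx.1 hy.1 hz, hy.2.trans_le ?_⟩⟩
    exact hanti ((hJs hx.1).1.trans_le hz.1) (hJs hy.1).1 hz.2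
  have hgap : ∀ t, gapSum l Q ε N σ {u ∈ J | t < w u} = ∑ p ∈ fareyPts l Q J,
      gapLen ε N σ p.1 p.2 * (if t < w ((p.1 : ℝ) / p.2) then (1 : ℝ) else 0) := by
    intro t
    have e : fareyPts l Q {u ∈ J | t < w u} = (fareyPts l Q J).filter fun p => t < w ((p.1 : ℝ) / p.2) := by
      ext p
      rw [Finset.mem_filter, mem_fareyPts, mem_fareyPts, Set.mem_ofPred_eq]
      tauto
    rw [gapSum, e, Finset.sum_filter]
    refine Finset.sum_congr rfl fun p _ => ?_
    rw [mul_ite, mul_one, mul_zero, gapLen]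
  have hsum : ∑ p ∈ fareyPts l Q J, w ((p.1 : ℝ) / p.2) * gapLen ε N σ p.1 p.2 =
      ∫ t in (0 : ℝ)..1, gapSum l Q ε N σ {u ∈ J | t < w u} := by
    simp_rw [hgap]
    rw [intervalIntegral.integral_finsetSum fun p _ => (intervalIntegrable_indicator_lt _ _ _).const_mul _]
    refine Finset.sum_congr rfl fun p _ => ?_
    rw [intervalIntegral.integral_const_mul, integral_indicator_lt (h0 _) (h1 _), mul_comm]
  have hInt1 : IntervalIntegrable (fun t => gapSum l Q ε N σ {u ∈ J | t < w u}) volume 0 1 := by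
    simp_rw [hgap]
    have := IntervalIntegrable.sum (μ := volume) (a := 0) (b := 1) (fareyPts l Q J)
      (f := fun p t => gapLen ε N σ p.1 p.2 * (if t < w ((p.1 : ℝ) / p.2) then (1 : ℝ) else 0))
      fun p _ => (intervalIntegrable_indicator_lt _ _ _).const_mul _
    refine this.congr fun t _ => ?_
    rw [Finset.sum_apply]
  have hInt2 : IntervalIntegrable (fun t => (volume {u ∈ J | t < w u}).toReal) volume 0 1 := by
    apply Antitone.intervalIntegrable
    intro s t hst
    refine ENNReal.toReal_mono (ne_top_of_le_ne_top hfin (measure_mono fun u hu => hu.1))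
      (measure_mono fun u hu => ⟨hu.1, hst.trans_lt hu.2⟩)
  rw [hsum, setIntegral_eq_integral_volume_lt hJs hw h0 h1, ← intervalIntegral.integral_const_mul,
    ← intervalIntegral.integral_sub hInt1 (hInt2.const_mul _)]
  have := intervalIntegral.norm_integral_le_of_norm_le_const (a := 0) (b := 1) (C := E)
    (f := fun t => gapSum l Q ε N σ {u ∈ J | t < w u} - κ * (volume {u ∈ J | t < w u}).toReal)
    fun t _ => h _ (fun u hu => hu.1) (hconn t)
  simpa using this

theorem rpow_neg_floor_le {ε s : ℝ} (hε0 : 0 < ε) (hε : ε < 1 / 2) :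
    (⌊1 / ε⌋₊ : ℝ) ^ (-s) ≤ 2 ^ |s| * ε ^ s := by
  have h1 : (⌊1 / ε⌋₊ : ℝ) ≤ 1 / ε := Nat.floor_le (by positivity)
  have h2 : 1 / ε < (⌊1 / ε⌋₊ : ℝ) + 1 := Nat.lt_floor_add_one _
  have h3 : 2 < 1 / ε := by rw [lt_div_iff₀ hε0]; linarith
  have h4 : 1 / (2 * ε) ≤ (⌊1 / ε⌋₊ : ℝ) := by
    have : 1 / (2 * ε) = 1 / ε / 2 := by field_simp
    linarith
  have h5 : 0 < 1 / (2 * ε) := by positivity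
  rcases le_total 0 s with hs | hs
  · calc (⌊1 / ε⌋₊ : ℝ) ^ (-s) ≤ (1 / (2 * ε)) ^ (-s) := Real.rpow_le_rpow_of_nonpos h5 h4 (by linarith)
      _ = 2 ^ |s| * ε ^ s := by
        rw [abs_of_nonneg hs, one_div, Real.inv_rpow (by positivity), ← Real.rpow_neg (by positivity), neg_neg,
          Real.mul_rpow (by norm_num) hε0.le]
  · calc (⌊1 / ε⌋₊ : ℝ) ^ (-s) ≤ (1 / ε) ^ (-s) := Real.rpow_le_rpow (by positivity) h1 (by linarith)
      _ = 1 * ε ^ s := by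
        rw [one_div, Real.inv_rpow hε0.le, ← Real.rpow_neg hε0.le, neg_neg, one_mul]
      _ ≤ 2 ^ |s| * ε ^ s := by
        gcongr
        exact Real.one_le_rpow (by norm_num) (abs_nonneg s)

theorem arctan_sub_le {x y : ℝ} (h : y ≤ x) : Real.arctan x - Real.arctan y ≤ x - y := by
  have := (convex_Icc y x).norm_image_sub_le_of_norm_hasDerivWithin_le (C := 1)
    (f := Real.arctan) (f' := fun t => 1 / (1 + t ^ 2))
    (fun t _ => (Real.hasDerivAt_arctan t).hasDerivWithinAt)
    (fun t _ => by
      rw [Real.norm_eq_abs, abs_of_nonneg (by positivity), div_le_one (by positivity)]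
      nlinarith [sq_nonneg t])
    (Set.left_mem_Icc.mpr h) (Set.right_mem_Icc.mpr h)
  rw [one_mul, Real.norm_eq_abs, Real.norm_eq_abs, abs_of_nonneg (sub_nonneg.mpr h)] at this
  exact (le_abs_self _).trans this

theorem volume_arctan_image_le {I : Set ℝ} (hI : I.OrdConnected) (hfin : volume I ≠ ⊤) :
    volume (Real.arctan '' I) ≤ ENNReal.ofReal (2 * (volume I).toReal) := by
  rcases I.eq_empty_or_nonempty with rfl | ⟨x, hx⟩
  · simp
  refine (measure_mono (t := Set.Icc (Real.arctan x - (volume I).toReal)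
    (Real.arctan x + (volume I).toReal)) ?_).trans ?_
  · rintro _ ⟨y, hy, rfl⟩
    have h1 := hI.sub_le_volume hfin hx hy
    have h2 := hI.sub_le_volume hfin hy hx
    rcases le_total x y with h | h
    · have := arctan_sub_le h
      have := Real.arctan_mono h
      constructor <;> linarith
    · have := arctan_sub_le h
      have := Real.arctan_mono h
      constructor <;> linarith
  · rw [Real.volume_Icc]
    exact ENNReal.ofReal_le_ofReal (by linarith)

theorem volume_freeSet_le {l Q : ℕ} {ε N : ℝ} {σ : ℤ} {I : Set ℝ} (hI : I.OrdConnected)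
    (hfin : volume I ≠ ⊤) : (volume (freeSet l Q ε N σ I)).toReal ≤ 2 * (volume I).toReal := by
  have h1 : volume (freeSet l Q ε N σ I) ≤ ENNReal.ofReal (2 * (volume I).toReal) :=
    (measure_mono fun ω hω => hω.1).trans (volume_arctan_image_le hI hfin)
  have h2 := ENNReal.toReal_mono ENNReal.ofReal_ne_top h1
  rwa [ENNReal.toReal_ofReal (by positivity)] at h2

theorem abs_integral_log_le_one {lam : ℝ} (hlam : 1 < lam) :
    |∫ u in (0 : ℝ)..1, ((1 - u) / u) * Real.log (lam / (lam - u))| ≤ 1 := by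
  rw [← integral_gapMean hlam]
  have := intervalIntegral.norm_integral_le_of_norm_le_const (a := 0) (b := 1) (C := 1)
    (f := gapMean lam) fun u hu => by
      rw [Set.uIoc_of_le zero_le_one] at hu
      rw [Real.norm_eq_abs, abs_of_nonneg (gapMean_nonneg hlam hu.2)]
      refine (gapMean_antitone hlam hu.1.le hu.2).trans ?_
      rw [gapMean_zero, div_le_one (by linarith)]
      exact hlam.le
  simpa using this

theorem abs_setIntegral_inv_one_add_sq_le {I : Set ℝ} (hfin : volume I ≠ ⊤) :
    |∫ u in I, 1 / (1 + u ^ 2)| ≤ (volume I).toReal := by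
  have := norm_setIntegral_le_of_norm_le_const (μ := volume) (s := I) (C := 1)
    (f := fun u : ℝ => 1 / (1 + u ^ 2)) hfin.lt_top fun u _ => by
      rw [Real.norm_eq_abs, abs_of_nonneg (by positivity), div_le_one (by positivity)]
      nlinarith [sq_nonneg u]
  rwa [one_mul, Real.norm_eq_abs, measureReal_def] at this

theorem freeSet_estimate_of_half_le {l : ℕ} {lam : ℝ} (hlam : 1 < lam) {Q : ℕ} {ε N : ℝ} {σ : ℤ}
    {I : Set ℝ} (hI : I.OrdConnected) (hfin : volume I ≠ ⊤) :
    |(volume (freeSet l Q ε N σ I)).toReal - (∫ u in I, 1 / (1 + u ^ 2)) * Cconst l / l *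
      ∫ u in (0 : ℝ)..1, ((1 - u) / u) * Real.log (lam / (lam - u))| ≤
      (2 + |Cconst l / l|) * (volume I).toReal := by
  have h1 := volume_freeSet_le (l := l) (Q := Q) (ε := ε) (N := N) (σ := σ) hI hfin
  have h2 := abs_integral_log_le_one hlam
  have h3 := abs_setIntegral_inv_one_add_sq_le hfin
  have h4 : 0 ≤ (volume I).toReal := ENNReal.toReal_nonneg
  refine (abs_sub _ _).trans ?_
  rw [abs_of_nonneg ENNReal.toReal_nonneg, mul_div_assoc, abs_mul, abs_mul, add_mul]
  refine add_le_add h1 ?_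
  calc _ ≤ (volume I).toReal * |Cconst l / l| * 1 := by gcongr
    _ = _ := by ring

theorem freeSet_estimate (l : ℕ) (hl : 2 ≤ l) {c δ K lam₀ : ℝ} (hc0 : 0 < c) (hc2 : c ≤ 1 / 2)
    (hδ : 0 < δ) (hK : 1 ≤ K) (hlam₀ : 1 < lam₀) :
    ∃ C : ℝ, 1 ≤ C ∧ ∀ σ : ℤ, IsUnit σ → ∀ ε : ℝ, 0 < ε → ε < 1 / 2 → ∀ lam : ℝ, lam₀ ≤ lam → lam ≤ 2 →
      ∀ I : Set ℝ, I ⊆ Set.Icc 0 1 → I.OrdConnected → (volume I).toReal ≤ K * ε ^ c →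
      |(volume (freeSet l ⌊1 / ε⌋₊ ε (lam * (⌊1 / ε⌋₊ : ℝ)) σ I)).toReal -
        (∫ u in I, 1 / (1 + u ^ 2)) * Cconst l / l *
        ∫ u in (0 : ℝ)..1, ((1 - u) / u) * Real.log (lam / (lam - u))| ≤
        C * ε ^ (1 / 6 + 2 * c / 3 - δ) := by
  obtain ⟨C, hC, H⟩ := gapSum_sub_le l hl hc2 hδ hK hlam₀
  have hm : 0 < lam₀ - 1 := by linarith
  set s := 1 / 6 + 2 * c / 3 - δ with hs
  refine ⟨(1 / (lam₀ - 1) ^ 2 + 1 / (lam₀ - 1)) * 2 + C * 2 ^ |s|, ?_, ?_⟩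
  · have h1 : 0 ≤ (1 / (lam₀ - 1) ^ 2 + 1 / (lam₀ - 1)) * 2 := by positivity
    have h2 : 1 ≤ C * (2 : ℝ) ^ |s| :=
      one_le_mul_of_one_le_of_one_le hC (Real.one_le_rpow (by norm_num) (abs_nonneg s))
    linarith
  intro σ hσ ε hε0 hε lam hlam hlam2 I hIs hI hIv
  set Q := ⌊1 / ε⌋₊ with hQd
  have h1 : (Q : ℝ) ≤ 1 / ε := Nat.floor_le (by positivity)
  have h2 : 1 / ε < (Q : ℝ) + 1 := Nat.lt_floor_add_one _
  have h3 : 2 < 1 / ε := by rw [lt_div_iff₀ hε0]; linarith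
  have hQ0 : (0 : ℝ) < Q := by linarith
  have hQ : 0 < Q := by exact_mod_cast hQ0
  have hεQ : ε * Q ≤ 1 := by rw [le_div_iff₀ hε0] at h1; linarith
  have hεQ' : 1 ≤ ε * (Q + 1) := by rw [div_lt_iff₀ hε0] at h2; linarith
  have hlam1 : 1 < lam := by linarith
  have hfin : volume I ≠ ⊤ := ne_top_of_le_ne_top (by simp) (measure_mono hIs)
  set J := I ∩ Set.Ioc 0 1 with hJ
  have hJc : J.OrdConnected := hI.inter Set.ordConnected_Ioc
  have hJI : J =ᵐ[volume] I := by
    refine (ae_eq_set).mpr ⟨?_, ?_⟩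
    · rw [Set.sdiff_eq_empty.mpr Set.inter_subset_left]; simp
    · refine measure_mono_null (t := {0}) ?_ (by simp)
      rintro x ⟨hx, hxJ⟩
      by_contra hx0
      exact hxJ ⟨hx, lt_of_le_of_ne (hIs hx).1 (Ne.symm hx0), (hIs hx).2⟩
  have hpow : ε ^ c ≤ (Q : ℝ) ^ (-c) := by
    rw [Real.rpow_neg hQ0.le, ← Real.inv_rpow hQ0.le]
    refine Real.rpow_le_rpow hε0.le ?_ hc0.le
    rw [le_inv_comm₀ hε0 hQ0, ← one_div]
    exact h1
  have hgeo := abs_volume_freeSet_sub_le hl hσ hQ hε0.le hεQ hεQ' hlam1 hI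
  have hana := abs_sum_weight_sub_le (l := l) (Q := Q) (ε := ε) (N := lam * Q) (σ := σ) hJc
    Set.inter_subset_right (w := fun t => 1 / (1 + t ^ 2))
    (continuous_const.div (by fun_prop) fun t => by positivity) (fun t => by positivity)
    (fun t => by rw [div_le_one (by positivity)]; nlinarith [sq_nonneg t])
    (fun x hx y hy hxy => by
      have : (0 : ℝ) < x := hx
      dsimp only
      gcongr)
    (κ := Cconst l / l * ∫ u in (0 : ℝ)..1, ((1 - u) / u) * Real.log (lam / (lam - u)))
    (E := C * (Q : ℝ) ^ (-(1 / 6 + 2 * c / 3) + δ))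
    (fun J' hJ' hJ'c => H σ hσ lam hlam hlam2 Q ε hQ hεQ hεQ' J' hJ'c (hJ'.trans Set.inter_subset_right)
      ((ENNReal.toReal_mono hfin (measure_mono (hJ'.trans Set.inter_subset_left))).trans
        (hIv.trans (mul_le_mul_of_nonneg_left hpow (by linarith)))))
  rw [setIntegral_congr_set hJI] at hana
  have e1 : (1 / (lam - 1) ^ 2 + 1 / (lam - 1)) / Q ≤ (1 / (lam₀ - 1) ^ 2 + 1 / (lam₀ - 1)) * 2 * ε ^ s := by
    have hQi : 1 / (Q : ℝ) ≤ 2 * ε := by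
      rw [div_le_iff₀ hQ0]
      nlinarith
    have hεs : ε ≤ ε ^ s := by
      calc ε = ε ^ (1 : ℝ) := (Real.rpow_one ε).symm
        _ ≤ ε ^ s := Real.rpow_le_rpow_of_exponent_ge hε0 (by linarith) (by rw [hs]; linarith)
    calc (1 / (lam - 1) ^ 2 + 1 / (lam - 1)) / Q
        = (1 / (lam - 1) ^ 2 + 1 / (lam - 1)) * (1 / Q) := by ring
      _ ≤ (1 / (lam₀ - 1) ^ 2 + 1 / (lam₀ - 1)) * (2 * ε ^ s) := by
        refine mul_le_mul (by gcongr) (hQi.trans (by linarith)) (by positivity) (by positivity)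
      _ = _ := by ring
  have e2 : C * (Q : ℝ) ^ (-(1 / 6 + 2 * c / 3) + δ) ≤ C * 2 ^ |s| * ε ^ s := by
    have : -(1 / 6 + 2 * c / 3) + δ = -s := by rw [hs]; ring
    rw [this, mul_assoc]
    exact mul_le_mul_of_nonneg_left (rpow_neg_floor_le hε0 hε) (by linarith)
  have e3 : (∫ u in I, 1 / (1 + u ^ 2)) * Cconst l / l *
      (∫ u in (0 : ℝ)..1, ((1 - u) / u) * Real.log (lam / (lam - u))) =
      Cconst l / l * (∫ u in (0 : ℝ)..1, ((1 - u) / u) * Real.log (lam / (lam - u))) *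
        ∫ u in I, 1 / (1 + u ^ 2) := by ring
  rw [e3]
  refine (abs_sub_le _ _ _).trans ((add_le_add (hgeo.trans e1) (hana.trans e2)).trans (le_of_eq ?_))
  ring

theorem statement11 (l : ℕ) (hl : 2 ≤ l)
    (c c₁ δ K : ℝ) (hc : c ∈ Set.Ioo (0 : ℝ) 1) (hc₁ : c₁ ∈ Set.Ioo (0 : ℝ) 1)
    (hδ : 0 < δ) (hK : 1 ≤ K) (Λ : Set ℝ) (hΛc : IsCompact Λ) (hΛ : Λ ⊆ Set.Ioc 1 2) :
    ∃ C > 0, ∃ ε₀ > 0, ∀ ε : ℝ, 0 < ε → ε < ε₀ → ∀ lam ∈ Λ,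
      ∀ I : Set ℝ, I ⊆ Set.Icc 0 1 → I.OrdConnected →
      K⁻¹ * ε ^ c ≤ (volume I).toReal → (volume I).toReal ≤ K * ε ^ c →
      |Gmeas2 l I ε lam - (∫ u in I, 1 / (1 + u ^ 2)) * Cconst l / l *
          ∫ u in (0 : ℝ)..1, ((1 - u) / u) * Real.log (lam / (lam - u))| ≤
        C * ε ^ (min (c + c₁) (1 / 2 - 2 * c₁) - δ) ∧
      |Gmeas3 l I ε lam - (∫ u in I, 1 / (1 + u ^ 2)) * Cconst l / l *
          ∫ u in (0 : ℝ)..1, ((1 - u) / u) * Real.log (lam / (lam - u))| ≤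
        C * ε ^ (min (c + c₁) (1 / 2 - 2 * c₁) - δ) := by
  have hc₁0 : 0 < c₁ := hc₁.1
  set θ := min (c + c₁) (1 / 2 - 2 * c₁) with hθ
  have hθ1 : θ ≤ c + c₁ := min_le_left _ _
  have hθ2 : θ ≤ 1 / 2 - 2 * c₁ := min_le_right _ _
  rcases Λ.eq_empty_or_nonempty with rfl | hne
  · exact ⟨1, one_pos, 1, one_pos, fun ε _ _ lam hlam => hlam.elim⟩
  obtain ⟨lam₀, hmem, hmin⟩ := hΛc.exists_isLeast hne
  have hpow : ∀ {ε s : ℝ}, 0 < ε → ε < 1 / 2 → θ - δ ≤ s → ε ^ s ≤ ε ^ (θ - δ) :=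
    fun h0 h1 h => Real.rpow_le_rpow_of_exponent_ge h0 (by linarith) h
  rcases le_or_gt c (1 / 2) with hc2 | hc2
  · obtain ⟨C, hC, H⟩ := freeSet_estimate l hl hc.1 hc2 hδ hK (hΛ hmem).1
    refine ⟨C, by linarith, 1 / 2, by norm_num, fun ε hε0 hε lam hlam I hIs hI _ hIv => ?_⟩
    have hle : C * ε ^ (1 / 6 + 2 * c / 3 - δ) ≤ C * ε ^ (θ - δ) :=
      mul_le_mul_of_nonneg_left (hpow hε0 hε (by linarith)) (by linarith)
    rw [Gmeas2_eq_freeSet, Gmeas3_eq_freeSet]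
    exact ⟨(H 1 isUnit_one ε hε0 hε lam (hmin hlam) (hΛ hlam).2 I hIs hI hIv).trans hle,
      (H (-1) isUnit_one.neg ε hε0 hε lam (hmin hlam) (hΛ hlam).2 I hIs hI hIv).trans hle⟩
  · refine ⟨(2 + |Cconst l / l|) * K, by positivity, 1 / 2, by norm_num,
      fun ε hε0 hε lam hlam I hIs hI _ hIv => ?_⟩
    have hfin : volume I ≠ ⊤ := ne_top_of_le_ne_top (by simp) (measure_mono hIs)
    have hle : (2 + |Cconst l / l|) * (volume I).toReal ≤
        (2 + |Cconst l / l|) * K * ε ^ (θ - δ) := by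
      rw [mul_assoc]
      exact mul_le_mul_of_nonneg_left (hIv.trans (mul_le_mul_of_nonneg_left
        (hpow hε0 hε (by linarith)) (by linarith))) (by positivity)
    rw [Gmeas2_eq_freeSet, Gmeas3_eq_freeSet]
    exact ⟨(freeSet_estimate_of_half_le (hΛ hlam).1 hI hfin).trans hle,
      (freeSet_estimate_of_half_le (hΛ hlam).1 hI hfin).trans hle⟩
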